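/- arXiv:1303.4792 — 6 statements merged into one kernel-verified Lean document; each statement's English description precedes it below -/
import Mathlib

section
/- Let (Ω₁,M₁,μ₁) and (Ω₂,M₂,μ₂) be σ-finite measure spaces, let 1 ≤ p₁, p₂ < ∞ and let q₁ be the conjugate exponent of p₁ (so 1/p₁ + 1/q₁ = 1). A bounded linear operator T : L^{p₁}(μ₁) → L^{p₂}(μ₂) is nuclear if and only if there exist a sequence (g_m) in L^{p₂}(μ₂) and a sequence (h_m) in L^{q₁}(μ₁) such that ∑_{m=1}^∞ ‖g_m‖_{L^{p₂}} ‖h_m‖_{L^{q₁}} < ∞ and, for every f ∈ L^{p₁}(μ₁), T f(x) = ∫ (∑_{m=1}^∞ g_m(x) h_m(y)) f(y) dμ₁(y) for μ₂-almost every x (the series ∑_m g_m(x)h_m(y) converging absolutely for (μ₂×μ₁)-almost every (x,y)). -/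
open MeasureTheory ENNReal NNReal Real

noncomputable section

/-- For `0 < r ≤ 1`, a bounded linear operator `T : E → F` between complex Banach spaces is
`r`-nuclear if there are sequences `(x'_m)` of continuous functionals on `E` and `(y_m)` in `F`
with `T v = ∑ₘ x'_m(v) • y_m` for all `v` and `∑ₘ ‖x'_m‖^r ‖y_m‖^r < ∞`. -/
def IsRNuclear {E F : Type*} [NormedAddCommGroup E] [NormedSpace ℂ E]
    [NormedAddCommGroup F] [NormedSpace ℂ F] (r : ℝ) (T : E →L[ℂ] F) : Prop :=
  ∃ (x' : ℕ → (E →L[ℂ] ℂ)) (y : ℕ → F),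
    (∀ v : E, HasSum (fun m => x' m v • y m) (T v)) ∧
    Summable (fun m => ‖x' m‖ ^ r * ‖y m‖ ^ r)

open Filter Topology
open scoped symmDiff

section LpDuality

variable {Ω : Type*} [MeasurableSpace Ω]

/-- A bounded functional on `L^p` of a finite measure, evaluated on indicator functions,
is a complex measure. -/
def MeasureTheory.Lp.indicatorVectorMeasure (μ : Measure Ω) [IsFiniteMeasure μ] {p : ℝ≥0∞}
    [Fact (1 ≤ p)] (hp : p ≠ ∞) (φ : Lp ℂ p μ →L[ℂ] ℂ) : ComplexMeasure Ω := by
  classical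
  exact
  { measureOf' := fun s => if hs : MeasurableSet s then
      φ (indicatorConstLp p hs (measure_ne_top μ s) 1) else 0
    empty' := by
      rw [dif_pos MeasurableSet.empty, indicatorConstLp_empty, map_zero]
    not_measurable' := fun s hs => dif_neg hs
    m_iUnion' := fun A hA hd => by
      have hfin : ∀ t : Finset ℕ, MeasurableSet (⋃ i ∈ t, A i) :=
        fun t => t.measurableSet_biUnion fun i _ => hA i
      have hsum : ∀ t : Finset ℕ,
          indicatorConstLp p (hfin t) (measure_ne_top μ _) (1 : ℂ) =
            ∑ i ∈ t, indicatorConstLp p (hA i) (measure_ne_top μ _) (1 : ℂ) := by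
        intro t
        induction t using Finset.induction_on with
        | empty => simp [indicatorConstLp_empty]
        | insert a t ha ih =>
          rw [Finset.sum_insert ha, ← ih, ← indicatorConstLp_disjoint_union]
          · congr 1
            simp
          · rw [Set.disjoint_iUnion₂_right]
            exact fun i hi => hd fun h => ha (h ▸ hi)
      have htend : Tendsto (fun t : Finset ℕ => μ ((⋃ i ∈ t, A i) ∆ (⋃ i, A i))) atTop (𝓝 0) := by
        have h0 : Tendsto (fun t : Finset ℕ => μ (⋃ i, A i) - ∑ i ∈ t, μ (A i)) atTop
            (𝓝 (μ (⋃ i, A i) - ∑' i, μ (A i))) :=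
          ENNReal.Tendsto.sub tendsto_const_nhds ENNReal.summable.hasSum
            (Or.inl (measure_ne_top μ _))
        rw [measure_iUnion hd hA, tsub_self] at h0
        refine h0.congr fun t => ?_
        have hsub : (⋃ i ∈ t, A i) ⊆ ⋃ i, A i := Set.iUnion₂_subset_iUnion _ _
        rw [Set.symmDiff_def, Set.sdiff_eq_empty.2 hsub, Set.empty_union,
          measure_sdiff hsub (hfin t).nullMeasurableSet (measure_ne_top μ _),
          measure_biUnion_finset (fun i _ j _ h => hd h) (fun i _ => hA i), measure_iUnion hd hA]
      have hlim := (φ.continuous.tendsto _).comp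
        (tendsto_indicatorConstLp_set (c := (1 : ℂ)) (hs := MeasurableSet.iUnion hA)
          (hμs := measure_ne_top μ _) (ht := hfin) (hμt := fun _ => measure_ne_top μ _) hp htend)
      rw [dif_pos (MeasurableSet.iUnion hA)]
      refine hlim.congr fun t => ?_
      simp only [Function.comp_apply, hsum, map_sum]
      exact Finset.sum_congr rfl fun i _ => by rw [dif_pos (hA i)] }

theorem MeasureTheory.Lp.indicatorVectorMeasure_apply (μ : Measure Ω) [IsFiniteMeasure μ] {p : ℝ≥0∞}
    [Fact (1 ≤ p)] (hp : p ≠ ∞) (φ : Lp ℂ p μ →L[ℂ] ℂ) {s : Set Ω} (hs : MeasurableSet s) :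
    Lp.indicatorVectorMeasure μ hp φ s = φ (indicatorConstLp p hs (measure_ne_top μ s) 1) :=
  dif_pos hs

/-- The Radon–Nikodym theorem for complex measures. -/
theorem MeasureTheory.ComplexMeasure.exists_setIntegral_eq (μ : Measure Ω) [SigmaFinite μ]
    (c : ComplexMeasure Ω) (hc : c ≪ᵥ μ.toENNRealVectorMeasure) :
    ∃ k : Ω → ℂ, Measurable k ∧ Integrable k μ ∧
      ∀ s, MeasurableSet s → c s = ∫ x in s, k x ∂μ := by
  obtain ⟨hre, him⟩ := (ComplexMeasure.absolutelyContinuous_ennreal_iff c _).1 hc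
  have hk := c.integrable_rnDeriv μ
  have hkr := SignedMeasure.integrable_rnDeriv (ComplexMeasure.re c) μ
  have hki := SignedMeasure.integrable_rnDeriv (ComplexMeasure.im c) μ
  refine ⟨c.rnDeriv μ, ?_, hk, fun s hs => ?_⟩
  · exact Complex.measurableEquivRealProd.symm.measurable.comp
      ((SignedMeasure.measurable_rnDeriv _ _).prodMk (SignedMeasure.measurable_rnDeriv _ _))
  · rw [← setIntegral_re_add_im hk.integrableOn]
    have e1 := congrArg (fun v => v s)
      (SignedMeasure.withDensityᵥ_rnDeriv_eq (ComplexMeasure.re c) μ hre)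
    have e2 := congrArg (fun v => v s)
      (SignedMeasure.withDensityᵥ_rnDeriv_eq (ComplexMeasure.im c) μ him)
    simp only [withDensityᵥ_apply hkr hs, withDensityᵥ_apply hki hs] at e1 e2
    apply Complex.ext
    · simpa [ComplexMeasure.rnDeriv, -ComplexMeasure.re_apply] using! e1.symm
    · simpa [ComplexMeasure.rnDeriv, -ComplexMeasure.im_apply] using! e2.symm

/-- The converse of Hölder's inequality, for `u` already known to be in `L^q`. -/
theorem MeasureTheory.MemLp.eLpNorm_le_of_forall_norm_integral_mul_le {μ : Measure Ω}
    [IsFiniteMeasure μ] {p q : ℝ≥0∞}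
    [Fact (1 ≤ p)] [HolderConjugate p q] (hp : p ≠ ∞) {u : Ω → ℂ}
    (hu : MemLp u q μ) (hum : Measurable u) {C : ℝ} (hC : 0 ≤ C)
    (h : ∀ f : Lp ℂ p μ, ‖∫ x, u x * f x ∂μ‖ ≤ C * ‖f‖) :
    eLpNorm u q μ ≤ ENNReal.ofReal C := by
  have h' : ∀ f : Ω → ℂ, MemLp f p μ → ‖∫ x, u x * f x ∂μ‖ ≤ C * (eLpNorm f p μ).toReal := by
    intro f hf
    have := h (hf.toLp f)
    rwa [Lp.norm_toLp, integral_congr_ae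
      (g := fun x => u x * f x) (by filter_upwards [hf.coeFn_toLp] with x hx; rw [hx])] at this
  by_cases hq : q = ∞
  · have hp1 : p = 1 := by
      have := HolderConjugate.inv_add_inv_eq_one p q
      simpa [hq] using this
    subst hq hp1
    rw [eLpNorm_exponent_top]
    refine eLpNormEssSup_le_of_ae_bound ?_
    set B : Set Ω := {x | C < ‖u x‖} with hB
    have hBm : MeasurableSet B := measurableSet_lt measurable_const hum.norm
    have hu1 : Integrable u μ := memLp_one_iff_integrable.1 (hu.mono_exponent le_top)
    have key := h' (B.indicator fun x => (starRingEnd ℂ) (u x) * ((‖u x‖⁻¹ : ℝ) : ℂ)) (by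
      refine (memLp_top_of_bound (Measurable.aestronglyMeasurable (by fun_prop (disch := assumption)))
        1 (ae_of_all _ fun x => ?_)).mono_exponent le_top
      by_cases hx : x ∈ B
      · have : 0 < ‖u x‖ := hC.trans_lt hx
        simp [hx, this.ne']
      · simp [hx])
    have e1 : ∫ x, u x * B.indicator (fun x => (starRingEnd ℂ) (u x) * ((‖u x‖⁻¹ : ℝ) : ℂ)) x ∂μ
        = ((∫ x in B, ‖u x‖ ∂μ : ℝ) : ℂ) := by
      rw [← integral_complex_ofReal, ← integral_indicator hBm]
      refine integral_congr_ae (ae_of_all _ fun x => ?_)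
      by_cases hx : x ∈ B
      · have : 0 < ‖u x‖ := hC.trans_lt hx
        simp only [hx, Set.indicator_of_mem]
        rw [← mul_assoc, Complex.mul_conj, Complex.normSq_eq_norm_sq, ← Complex.ofReal_mul]
        congr 1
        field_simp
      · simp [hx]
    have e2 : eLpNorm (B.indicator fun x => (starRingEnd ℂ) (u x) * ((‖u x‖⁻¹ : ℝ) : ℂ)) 1 μ
        = μ B := by
      rw [eLpNorm_one_eq_lintegral_enorm, ← lintegral_indicator_one hBm]
      refine lintegral_congr fun x => ?_
      by_cases hx : x ∈ B
      · have : 0 < ‖u x‖ := hC.trans_lt hx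
        have h1 : ‖(starRingEnd ℂ) (u x) * ((‖u x‖⁻¹ : ℝ) : ℂ)‖ = 1 := by simp [this.ne']
        simp only [hx, Set.indicator_of_mem, Pi.one_apply]
        rw [← ofReal_norm, h1, ENNReal.ofReal_one]
      · simp [hx]
    rw [e1, e2, Complex.norm_real, Real.norm_of_nonneg
      (integral_nonneg fun x => norm_nonneg _)] at key
    have e3 : ∫ x in B, (‖u x‖ - C) ∂μ ≤ 0 := by
      rw [integral_sub hu1.norm.integrableOn (integrable_const C), setIntegral_const, smul_eq_mul,
        mul_comm]
      exact sub_nonpos.2 key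
    have e4 : ¬ 0 < μ B := by
      intro hpos
      refine absurd e3 (not_le.2 ?_)
      rw [setIntegral_pos_iff_support_of_nonneg_ae]
      · refine hpos.trans_le (measure_mono fun x hx => ⟨?_, hx⟩)
        exact (sub_pos.2 hx).ne'
      · filter_upwards [ae_restrict_mem hBm] with x hx using (sub_pos.2 hx).le
      · exact (hu1.norm.integrableOn).sub (integrable_const C)
    have e5 : μ B = 0 := by simpa using e4
    rw [ae_iff]
    simpa [hB, not_le] using e5
  · have hp0 : p ≠ 0 := HolderConjugate.ne_zero p q
    have hq0 : q ≠ 0 := HolderConjugate.ne_zero q p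
    have hqr : p.toReal.HolderConjugate q.toReal := by
      simpa using HolderTriple.toReal 1 (ENNReal.toReal_pos hp0 hp) (ENNReal.toReal_pos hq0 hq)
    set Q := q.toReal
    set P := p.toReal
    have hQ1 : 1 < Q := hqr.symm.lt
    have hnorm : ∀ x, ‖(starRingEnd ℂ) (u x) * ((‖u x‖ ^ (Q - 2) : ℝ) : ℂ)‖ = ‖u x‖ ^ (Q - 1) := by
      intro x
      rw [norm_mul, Complex.norm_real, Real.norm_of_nonneg (by positivity), RCLike.norm_conj]
      rcases eq_or_ne (u x) 0 with h0 | h0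
      · rw [h0, norm_zero, zero_mul, Real.zero_rpow (by linarith)]
      · rw [← Real.rpow_one_add' (norm_nonneg _) (by linarith)]
        ring_nf
    have hpow : ∀ x, (‖u x‖ ^ (Q - 1)) ^ P = ‖u x‖ ^ Q := by
      intro x
      rw [← Real.rpow_mul (norm_nonneg _), hqr.symm.sub_one_mul_conj]
    have hfm : Measurable fun x => (starRingEnd ℂ) (u x) * ((‖u x‖ ^ (Q - 2) : ℝ) : ℂ) := by
      fun_prop
    have hmem : MemLp (fun x => (starRingEnd ℂ) (u x) * ((‖u x‖ ^ (Q - 2) : ℝ) : ℂ)) p μ := by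
      rw [← integrable_norm_rpow_iff hfm.aestronglyMeasurable hp0 hp]
      simp_rw [hnorm]
      change Integrable (fun x => (‖u x‖ ^ (Q - 1)) ^ P) μ
      simp_rw [hpow]
      exact hu.integrable_norm_rpow hq0 hq
    have key := h' _ hmem
    have e1 : ∫ x, u x * ((starRingEnd ℂ) (u x) * ((‖u x‖ ^ (Q - 2) : ℝ) : ℂ)) ∂μ
        = ((∫ x, ‖u x‖ ^ Q ∂μ : ℝ) : ℂ) := by
      rw [← integral_complex_ofReal]
      refine integral_congr_ae (ae_of_all _ fun x => ?_)
      simp only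
      rw [← mul_assoc, Complex.mul_conj, Complex.normSq_eq_norm_sq, ← Complex.ofReal_mul]
      congr 1
      rw [← Real.rpow_natCast, ← Real.rpow_add' (norm_nonneg _) (by push_cast; linarith)]
      push_cast
      ring_nf
    have hI : 0 ≤ ∫ x, ‖u x‖ ^ Q ∂μ := integral_nonneg fun x => by positivity
    rw [hmem.eLpNorm_eq_integral_rpow_norm hp0 hp, ENNReal.toReal_ofReal (by positivity), e1,
      Complex.norm_real, Real.norm_of_nonneg hI] at key
    simp_rw [hnorm] at key
    change _ ≤ C * (∫ x, (‖u x‖ ^ (Q - 1)) ^ P ∂μ) ^ P⁻¹ at key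
    simp_rw [hpow] at key
    rw [hu.eLpNorm_eq_integral_rpow_norm hq0 hq]
    refine ENNReal.ofReal_le_ofReal ?_
    change (∫ x, ‖u x‖ ^ Q ∂μ) ^ Q⁻¹ ≤ C
    set I := ∫ x, ‖u x‖ ^ Q ∂μ
    rcases hI.eq_or_lt with h0 | h0
    · rw [← h0, Real.zero_rpow (by positivity)]
      exact hC
    · have h1 : I = I ^ Q⁻¹ * I ^ P⁻¹ := by
        rw [← Real.rpow_add h0, hqr.symm.inv_add_inv_eq_one, Real.rpow_one]
      have hIP : 0 < I ^ P⁻¹ := Real.rpow_pos_of_pos h0 _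
      refine le_of_mul_le_mul_right ?_ hIP
      rwa [← h1]


/-- Two continuous functionals on `L^p` of a finite measure agreeing on indicator functions
are equal. -/
theorem MeasureTheory.Lp.continuousLinearMap_ext_indicator {μ : Measure Ω} [IsFiniteMeasure μ]
    {p : ℝ≥0∞} [Fact (1 ≤ p)] (hp : p ≠ ∞) {φ ψ : Lp ℂ p μ →L[ℂ] ℂ}
    (h : ∀ (s : Set Ω) (hs : MeasurableSet s),
      φ (indicatorConstLp p hs (measure_ne_top μ s) 1) =
        ψ (indicatorConstLp p hs (measure_ne_top μ s) 1)) : φ = ψ := by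
  ext f
  induction f using Lp.induction hp with
  | @indicatorConst c s hs hμs =>
    have hc : (Lp.simpleFunc.indicatorConst p hs hμs.ne c : Lp ℂ p μ) =
        c • indicatorConstLp p hs (measure_ne_top μ _) (1 : ℂ) := by
      rw [Lp.simpleFunc.coe_indicatorConst, indicatorConstLp, indicatorConstLp,
        ← MemLp.toLp_const_smul]
      congr 1
      ext x
      by_cases hx : x ∈ s <;> simp [hx]
    rw [hc, map_smul, map_smul, h]
  | add hf hg _ h1 h2 => rw [map_add, map_add, h1, h2]
  | isClosed => exact isClosed_eq φ.continuous ψ.continuous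

/-- Riesz representation of bounded functionals on `L^p` of a finite measure. -/
theorem MeasureTheory.Lp.exists_integral_eq_of_isFiniteMeasure (μ : Measure Ω) [IsFiniteMeasure μ]
    {p q : ℝ≥0∞} [Fact (1 ≤ p)] [Fact (1 ≤ q)] [HolderConjugate p q] (hp : p ≠ ∞)
    (φ : Lp ℂ p μ →L[ℂ] ℂ) :
    ∃ h : Lp ℂ q μ, ‖h‖ ≤ ‖φ‖ ∧ ∀ f : Lp ℂ p μ, φ f = ∫ x, h x * f x ∂μ := by
  obtain ⟨k, hkm, hki, hk⟩ := (Lp.indicatorVectorMeasure μ hp φ).exists_setIntegral_eq μ (by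
    refine VectorMeasure.AbsolutelyContinuous.mk fun s hs h0 => ?_
    rw [Measure.toENNRealVectorMeasure_apply_measurable hs] at h0
    rw [Lp.indicatorVectorMeasure_apply μ hp φ hs]
    have : indicatorConstLp p hs (measure_ne_top μ s) (1 : ℂ) = 0 := by
      rw [← norm_eq_zero, norm_indicatorConstLp (HolderConjugate.ne_zero p q) hp]
      have := ENNReal.toReal_pos (HolderConjugate.ne_zero p q) hp
      simp [measureReal_def, h0, this.ne', Real.zero_rpow]
    rw [this, map_zero])
  have hkφ : ∀ (s : Set Ω) (hs : MeasurableSet s),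
      φ (indicatorConstLp p hs (measure_ne_top μ s) 1) = ∫ x in s, k x ∂μ := fun s hs => by
    rw [← hk s hs, Lp.indicatorVectorMeasure_apply μ hp φ hs]
  let M := ContinuousLinearMap.mul ℂ ℂ
  have hpair : ∀ (v : Lp ℂ q μ) (s : Set Ω) (hs : MeasurableSet s),
      M.lpPairing μ q p v (indicatorConstLp p hs (measure_ne_top μ s) 1) = ∫ x in s, v x ∂μ := by
    intro v s hs
    rw [ContinuousLinearMap.lpPairing_eq_integral, ← integral_indicator hs]
    refine integral_congr_ae ?_
    filter_upwards [indicatorConstLp_coeFn (p := p) (hs := hs) (hμs := measure_ne_top μ s)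
      (c := (1 : ℂ))] with x hx
    rw [hx]
    by_cases hxs : x ∈ s <;> simp [M, hxs]
  let A : ℕ → Set Ω := fun n => {x | ‖k x‖ ≤ n}
  have hA : ∀ n, MeasurableSet (A n) := fun n => measurableSet_le hkm.norm measurable_const
  have hkn : ∀ n r, MemLp ((A n).indicator k) r μ := fun n r => by
    refine (memLp_top_of_bound ((hkm.indicator (hA n)).aestronglyMeasurable) n
      (ae_of_all _ fun x => ?_)).mono_exponent le_top
    by_cases hx : x ∈ A n
    · rw [Set.indicator_of_mem hx]
      exact hx
    · simp [hx]
  have hbound : ∀ n, eLpNorm ((A n).indicator k) q μ ≤ ENNReal.ofReal ‖φ‖ := by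
    intro n
    refine (hkn n q).eLpNorm_le_of_forall_norm_integral_mul_le hp (hkm.indicator (hA n))
      (norm_nonneg _) fun f => ?_
    have hone : MemLp ((A n).indicator fun _ => (1 : ℂ)) ∞ μ :=
      memLp_indicator_const _ (hA n) _ (Or.inr (measure_ne_top μ _))
    let R : Lp ℂ p μ →L[ℂ] Lp ℂ p μ := (M.holderL μ p ∞ p).flip hone.toLp
    have hR : ∀ g : Lp ℂ p μ, R g =ᵐ[μ] (A n).indicator g := fun g => by
      have h1 := M.coeFn_holder (r := p) g hone.toLp
      filter_upwards [h1, hone.coeFn_toLp] with x h1 h2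
      change M.holder p g hone.toLp x = _
      rw [h1, h2]
      by_cases hx : x ∈ A n <;> simp [M, hx]
    have heq : φ ∘L R = M.lpPairing μ q p ((hkn n q).toLp) := by
      refine Lp.continuousLinearMap_ext_indicator hp fun s hs => ?_
      rw [hpair, ContinuousLinearMap.comp_apply]
      have : R (indicatorConstLp p hs (measure_ne_top μ s) 1) =
          indicatorConstLp p ((hA n).inter hs) (measure_ne_top μ _) 1 := by
        apply Lp.ext
        filter_upwards [hR (indicatorConstLp p hs (measure_ne_top μ s) 1),
          indicatorConstLp_coeFn (p := p) (hs := hs) (hμs := measure_ne_top μ s) (c := (1 : ℂ)),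
          indicatorConstLp_coeFn (p := p) (hs := (hA n).inter hs) (hμs := measure_ne_top μ _)
            (c := (1 : ℂ))] with x h1 h2 h3
        rw [h1, h3]
        by_cases hx : x ∈ A n <;> by_cases hxs : x ∈ s <;> simp [hx, hxs, h2]
      rw [this, hkφ, Set.inter_comm, ← setIntegral_indicator (hA n)]
      exact integral_congr_ae (ae_restrict_of_ae (hkn n q).coeFn_toLp.symm)
    have h1 : ∫ x, (A n).indicator k x * f x ∂μ = φ (R f) := by
      rw [← ContinuousLinearMap.comp_apply, heq, ContinuousLinearMap.lpPairing_eq_integral]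
      refine integral_congr_ae ?_
      filter_upwards [(hkn n q).coeFn_toLp] with x hx
      rw [hx]; rfl
    rw [h1]
    refine (φ.le_opNorm _).trans ?_
    gcongr
    refine Lp.norm_le_norm_of_ae_le ?_
    filter_upwards [hR f] with x hx
    rw [hx]
    exact norm_indicator_le_norm_self _ _
  have hfin : eLpNorm k q μ ≤ ENNReal.ofReal ‖φ‖ := by
    have hlim : ∀ᵐ x ∂μ, Tendsto (fun n => (A n).indicator k x) atTop (𝓝 (k x)) := by
      refine ae_of_all _ fun x => tendsto_const_nhds.congr' ?_
      obtain ⟨N, hN⟩ := exists_nat_ge ‖k x‖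
      filter_upwards [eventually_ge_atTop N] with n hn
      have : x ∈ A n := hN.trans (by exact_mod_cast hn)
      simp [this]
    refine (Lp.eLpNorm_lim_le_liminf_eLpNorm (fun n => (hkn n q).1) k hlim).trans ?_
    exact liminf_le_of_frequently_le' (Frequently.of_forall hbound)
  have hkq : MemLp k q μ := ⟨hkm.aestronglyMeasurable, hfin.trans_lt ENNReal.ofReal_lt_top⟩
  refine ⟨hkq.toLp, ?_, fun f => ?_⟩
  · rw [Lp.norm_toLp]
    exact ENNReal.toReal_le_of_le_ofReal (norm_nonneg _) hfin
  · have : φ = M.lpPairing μ q p hkq.toLp := by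
      refine Lp.continuousLinearMap_ext_indicator hp fun s hs => ?_
      rw [hpair, hkφ]
      exact integral_congr_ae (ae_restrict_of_ae hkq.coeFn_toLp.symm)
    rw [this, ContinuousLinearMap.lpPairing_eq_integral]
    rfl

/-- Multiplication by `g ^ (1 / r)` maps `L^r(g μ)` isometrically to `L^r(μ)`. -/
theorem MeasureTheory.eLpNorm_rpow_inv_smul_eq_eLpNorm_withDensity {μ : Measure Ω} {g : Ω → ℝ≥0}
    (hg : Measurable g) (hpos : ∀ x, 0 < g x) {r : ℝ≥0∞} (hr : r ≠ 0) (s : Ω → ℂ) :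
    eLpNorm (fun x => ((g x : ℝ) ^ r.toReal⁻¹) • s x) r μ =
      eLpNorm s r (μ.withDensity fun x => g x) := by
  by_cases hr' : r = ∞
  · subst hr'
    have hae : ae (μ.withDensity fun x => (g x : ℝ≥0∞)) = ae μ :=
      le_antisymm (withDensity_absolutelyContinuous μ _).ae_le
        (withDensity_absolutelyContinuous' hg.coe_nnreal_ennreal.aemeasurable
          (ae_of_all _ fun x => by simpa using (hpos x).ne')).ae_le
    simp [eLpNormEssSup, essSup, hae]
  · have hr0 := ENNReal.toReal_pos hr hr'
    rw [eLpNorm_eq_lintegral_rpow_enorm_toReal hr hr',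
      eLpNorm_eq_lintegral_rpow_enorm_toReal hr hr',
      lintegral_withDensity_eq_lintegral_mul_non_measurable μ hg.coe_nnreal_ennreal
        (ae_of_all _ fun x => ENNReal.coe_lt_top)]
    congr 1
    refine lintegral_congr fun x => ?_
    rw [enorm_smul, ENNReal.mul_rpow_of_nonneg _ _ hr0.le, Pi.mul_apply]
    congr 1
    rw [Real.enorm_of_nonneg (by positivity), ENNReal.ofReal_rpow_of_nonneg (by positivity) hr0.le,
      Real.rpow_inv_rpow (NNReal.coe_nonneg _) hr0.ne', ENNReal.ofReal_coe_nnreal]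

/-- Riesz representation of bounded functionals on `L^p` of a σ-finite measure. -/
theorem MeasureTheory.Lp.exists_integral_eq (μ : Measure Ω) [SigmaFinite μ] {p q : ℝ≥0∞}
    [Fact (1 ≤ p)] [Fact (1 ≤ q)] [HolderConjugate p q] (hp : p ≠ ∞) (φ : Lp ℂ p μ →L[ℂ] ℂ) :
    ∃ h : Lp ℂ q μ, ‖h‖ ≤ ‖φ‖ ∧ ∀ f : Lp ℂ p μ, φ f = ∫ x, h x * f x ∂μ := by
  obtain ⟨g, hpos, hg, hint⟩ := exists_pos_lintegral_lt_of_sigmaFinite μ (one_ne_zero (α := ℝ≥0∞))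
  set ρ : Measure Ω := μ.withDensity fun x => g x with hρ
  have : IsFiniteMeasure ρ := isFiniteMeasure_withDensity (hint.trans_le le_top).ne
  have hp0 : p ≠ 0 := HolderConjugate.ne_zero p q
  have hq0 : q ≠ 0 := HolderConjugate.ne_zero q p
  have hμρ : μ ≪ ρ := withDensity_absolutelyContinuous' hg.coe_nnreal_ennreal.aemeasurable
    (ae_of_all _ fun x => by simpa using (hpos x).ne')
  have hρμ : ρ ≪ μ := withDensity_absolutelyContinuous μ _
  have hnorm : ∀ {r : ℝ≥0∞}, r ≠ 0 → ∀ s : Ω → ℂ,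
      eLpNorm (fun x => ((g x : ℝ) ^ r.toReal⁻¹) • s x) r μ = eLpNorm s r ρ := fun hr s =>
    eLpNorm_rpow_inv_smul_eq_eLpNorm_withDensity hg hpos hr s
  have hmem : ∀ {r : ℝ≥0∞}, r ≠ 0 → ∀ s : Lp ℂ r ρ,
      MemLp (fun x => ((g x : ℝ) ^ r.toReal⁻¹) • s x) r μ := fun hr s =>
    ⟨(hg.coe_nnreal_real.pow_const _).aestronglyMeasurable.smul ((Lp.memLp s).1.mono_ac hμρ),
      (hnorm hr s).trans_lt (Lp.memLp s).2⟩
  let J : Lp ℂ p ρ →L[ℂ] Lp ℂ p μ := LinearMap.mkContinuous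
    { toFun := fun s => (hmem hp0 s).toLp
      map_add' := fun s t => by
        rw [← MemLp.toLp_add]
        refine MemLp.toLp_congr _ _ ?_
        filter_upwards [hμρ.ae_le (Lp.coeFn_add s t)] with x hx
        change (g x : ℝ) ^ p.toReal⁻¹ • (s + t : Lp ℂ p ρ) x = _ • s x + _ • t x
        rw [hx, Pi.add_apply, smul_add]
      map_smul' := fun c s => by
        rw [RingHom.id_apply, ← MemLp.toLp_const_smul]
        refine MemLp.toLp_congr _ _ ?_
        filter_upwards [hμρ.ae_le (Lp.coeFn_smul c s)] with x hx
        simp [hx, mul_left_comm] } 1 fun s => by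
    change ‖(hmem hp0 s).toLp‖ ≤ _
    rw [Lp.norm_toLp, hnorm hp0, one_mul, Lp.norm_def]
  have hJ : ‖J‖ ≤ 1 := LinearMap.mkContinuous_norm_le _ zero_le_one _
  obtain ⟨k, hkn, hk⟩ := Lp.exists_integral_eq_of_isFiniteMeasure ρ (q := q) hp (φ ∘L J)
  refine ⟨(hmem hq0 k).toLp, ?_, fun f => ?_⟩
  · rw [Lp.norm_toLp, hnorm hq0, ← Lp.norm_def]
    exact hkn.trans ((φ.opNorm_comp_le J).trans (mul_le_of_le_one_right (norm_nonneg _) hJ))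
  · have hfs : ∀ x, ((g x : ℝ) ^ p.toReal⁻¹) • (((g x : ℝ) ^ p.toReal⁻¹)⁻¹ • f x) = f x := fun x =>
      smul_inv_smul₀ (Real.rpow_pos_of_pos (hpos x) _).ne' _
    have hs : MemLp (fun x => ((g x : ℝ) ^ p.toReal⁻¹)⁻¹ • f x) p ρ := by
      refine ⟨(hg.coe_nnreal_real.pow_const _).inv.aestronglyMeasurable.smul
        ((Lp.memLp f).1.mono_ac hρμ), ?_⟩
      rw [← hnorm hp0]
      simp_rw [hfs]
      exact (Lp.memLp f).2
    have hJs : J hs.toLp = f := by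
      apply Lp.ext
      refine (MemLp.coeFn_toLp (hmem hp0 hs.toLp)).trans ?_
      filter_upwards [hμρ.ae_le hs.coeFn_toLp] with x hx
      rw [hx, hfs]
    have hpq : p.toReal⁻¹ + q.toReal⁻¹ = 1 := by
      rw [← ENNReal.toReal_inv, ← ENNReal.toReal_inv, ← ENNReal.toReal_add (by simpa) (by simpa),
        HolderConjugate.inv_add_inv_eq_one p q, ENNReal.toReal_one]
    have := hk hs.toLp
    rw [ContinuousLinearMap.comp_apply, hJs] at this
    refine this.trans ((integral_withDensity_eq_integral_smul hg _).trans (integral_congr_ae ?_))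
    filter_upwards [(hmem hq0 k).coeFn_toLp, hμρ.ae_le hs.coeFn_toLp] with x h1 h2
    have hg1 : (g x : ℝ) = (g x : ℝ) ^ p.toReal⁻¹ * (g x : ℝ) ^ q.toReal⁻¹ := by
      rw [← Real.rpow_add (NNReal.coe_pos.2 (hpos x)), hpq, Real.rpow_one]
    have ha : (((g x : ℝ) ^ p.toReal⁻¹ : ℝ) : ℂ) ≠ 0 :=
      Complex.ofReal_ne_zero.2 (Real.rpow_pos_of_pos (hpos x) _).ne'
    rw [h1, h2, NNReal.smul_def]
    generalize (g x : ℝ) ^ p.toReal⁻¹ = a at ha hg1 ⊢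
    generalize (g x : ℝ) ^ q.toReal⁻¹ = b at hg1 ⊢
    rw [hg1]
    simp only [Complex.real_smul]
    push_cast
    field_simp

end LpDuality

section Kernel

variable {Ω₁ Ω₂ : Type*} [MeasurableSpace Ω₁] [MeasurableSpace Ω₂]
  {μ₁ : Measure Ω₁} {μ₂ : Measure Ω₂} {p₁ p₂ q₁ : ℝ≥0∞}

/-- Hölder's inequality for elements of `L^p` spaces. -/
theorem MeasureTheory.Lp.integrable_mul_and_integral_norm_mul_le [HolderConjugate p₁ q₁]
    (h : Lp ℂ q₁ μ₁) (f : Lp ℂ p₁ μ₁) :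
    Integrable (fun y => h y * f y) μ₁ ∧ ∫ y, ‖h y * f y‖ ∂μ₁ ≤ ‖h‖ * ‖f‖ := by
  have hae := Lp.coeFn_lpSMul (r := 1) h f
  refine ⟨(L1.integrable_coeFn (h • f : Lp ℂ 1 μ₁)).congr hae, ?_⟩
  refine le_trans (le_of_eq ?_) (Lp.norm_smul_le (r := 1) h f)
  rw [L1.norm_eq_integral_norm]
  refine integral_congr_ae ?_
  filter_upwards [hae] with y hy
  rw [hy]
  rfl

/-- If `∑ ‖g m‖ ‖h m‖ < ∞` in `L^p` norms, then `∑ ‖g m x‖ ‖h m‖ < ∞` for almost every `x`. -/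
theorem MeasureTheory.Lp.ae_summable_norm_mul {E : Type*} [NormedAddCommGroup E] [Fact (1 ≤ p₂)]
    {g : ℕ → Lp ℂ p₂ μ₂} {h : ℕ → E} (hs : Summable fun m => ‖g m‖ * ‖h m‖) :
    ∀ᵐ x ∂μ₂, Summable fun m => ‖g m x‖ * ‖h m‖ := by
  have key := summable_norm_of_tsum_eLpNorm_ne_top (μ := μ₂) (p := p₂) Fact.out
    (f := fun m x => (‖h m‖ : ℂ) * g m x)
    (fun m => (Lp.aestronglyMeasurable (g m)).const_mul _) (by
      have : ∀ m, eLpNorm (fun x => (‖h m‖ : ℂ) * g m x) p₂ μ₂ = ENNReal.ofReal (‖g m‖ * ‖h m‖) := by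
        intro m
        have := eLpNorm_const_smul (‖h m‖ : ℂ) (g m) p₂ μ₂
        simp only [Pi.smul_def, smul_eq_mul] at this
        rw [this, ENNReal.ofReal_mul (norm_nonneg _), ofReal_norm, Lp.enorm_def, mul_comm,
          ← ofReal_norm]
        simp
      simp_rw [this]
      exact hs.tsum_ofReal_ne_top)
  filter_upwards [key] with x hx
  simpa [mul_comm] using hx

/-- Absolute convergence almost everywhere of the kernel series. -/
theorem MeasureTheory.Lp.ae_prod_summable_norm_mul [SFinite μ₁] [Fact (1 ≤ p₂)] [Fact (1 ≤ q₁)]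
    {g : ℕ → Lp ℂ p₂ μ₂} {h : ℕ → Lp ℂ q₁ μ₁} (hs : Summable fun m => ‖g m‖ * ‖h m‖) :
    ∀ᵐ z ∂(μ₂.prod μ₁), Summable fun m => ‖g m z.1 * h m z.2‖ := by
  have hmeas : MeasurableSet {z : Ω₂ × Ω₁ | Summable fun m => ‖g m z.1 * h m z.2‖} := by
    simp_rw [← tsum_enorm_ne_top_iff_summable_norm]
    refine (measurableSet_singleton ∞).compl.preimage
      (f := fun z : Ω₂ × Ω₁ => ∑' m, ‖g m z.1 * h m z.2‖ₑ) ?_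
    refine Measurable.tsum fun m => ?_
    exact (((Lp.stronglyMeasurable (g m)).measurable.comp measurable_fst).mul
      ((Lp.stronglyMeasurable (h m)).measurable.comp measurable_snd)).enorm
  rw [Measure.ae_prod_iff_ae_ae hmeas]
  filter_upwards [Lp.ae_summable_norm_mul hs] with x hx
  have := Lp.ae_summable_norm_mul (g := h) (h := fun m => g m x) (by simpa [mul_comm] using hx)
  filter_upwards [this] with y hy
  simpa [mul_comm] using hy

/-- The operator `f ↦ ∑ₘ (∫ hₘ f) gₘ` is the integral operator with kernel `∑ₘ gₘ(x) hₘ(y)`. -/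
theorem MeasureTheory.Lp.tsum_integral_smul_ae_eq [Fact (1 ≤ p₁)] [Fact (1 ≤ p₂)] [Fact (1 ≤ q₁)]
    [HolderConjugate p₁ q₁] {g : ℕ → Lp ℂ p₂ μ₂} {h : ℕ → Lp ℂ q₁ μ₁}
    (hs : Summable fun m => ‖g m‖ * ‖h m‖) (f : Lp ℂ p₁ μ₁) :
    Summable (fun m => ‖(∫ y, h m y * f y ∂μ₁) • g m‖) ∧
    ∀ᵐ x ∂μ₂, (∑' m, (∫ y, h m y * f y ∂μ₁) • g m : Lp ℂ p₂ μ₂) x =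
      ∫ y, (∑' m, g m x * h m y) * f y ∂μ₁ := by
  have hhol := fun m => Lp.integrable_mul_and_integral_norm_mul_le (h m) f
  have hsum : Summable fun m => ‖(∫ y, h m y * f y ∂μ₁) • g m‖ := by
    refine Summable.of_nonneg_of_le (fun m => norm_nonneg _) (fun m => ?_) (hs.mul_right ‖f‖)
    rw [norm_smul]
    calc _ ≤ (‖h m‖ * ‖f‖) * ‖g m‖ := by
          gcongr
          exact (norm_integral_le_integral_norm _).trans (hhol m).2
      _ = _ := by ring
  refine ⟨hsum, ?_⟩
  have htop : ∑' m, ‖(∫ y, h m y * f y ∂μ₁) • g m‖ₑ ≠ ∞ :=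
    tsum_enorm_ne_top_iff_summable_norm.2 hsum
  have hsmul : ∀ᵐ x ∂μ₂, ∀ m, ((∫ y, h m y * f y ∂μ₁) • g m : Lp ℂ p₂ μ₂) x =
      (∫ y, h m y * f y ∂μ₁) • g m x := ae_all_iff.2 fun m => Lp.coeFn_smul _ _
  filter_upwards [Lp.hasSum_coeFn_tsum htop, hsmul, Lp.ae_summable_norm_mul hs] with x h1 h2 h3
  have h4 := hasSum_integral_of_summable_integral_norm (μ := μ₁)
    (F := fun m y => g m x * (h m y * f y)) (fun m => (hhol m).1.const_mul _) (by
      refine Summable.of_nonneg_of_le (fun m => integral_nonneg fun _ => norm_nonneg _)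
        (fun m => ?_) (h3.mul_right ‖f‖)
      simp_rw [norm_mul (g m x)]
      rw [integral_const_mul, mul_assoc]
      gcongr
      exact (hhol m).2)
  rw [← h1.tsum_eq]
  have h5 : ∀ m, ∫ y, g m x * (h m y * f y) ∂μ₁ =
      ((∫ y, h m y * f y ∂μ₁) • g m : Lp ℂ p₂ μ₂) x := fun m => by
    rw [h2 m, integral_const_mul, smul_eq_mul, mul_comm]
  simp_rw [h5] at h4
  rw [h4.tsum_eq]
  refine integral_congr_ae (ae_of_all _ fun y => ?_)
  simp only [← mul_assoc]
  exact tsum_mul_right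

end Kernel

/-- **Characterisation of nuclear operators on `L^p`-spaces.** Let `(Ω₁,μ₁)`, `(Ω₂,μ₂)` be
σ-finite measure spaces, `1 ≤ p₁, p₂ < ∞` and `1/p₁ + 1/q₁ = 1`. A bounded operator
`T : L^{p₁}(μ₁) → L^{p₂}(μ₂)` is nuclear iff there are sequences `(g_m)` in `L^{p₂}(μ₂)` and
`(h_m)` in `L^{q₁}(μ₁)` with `∑ₘ ‖g_m‖ ‖h_m‖ < ∞`, the series `∑ₘ g_m(x) h_m(y)` converging
absolutely a.e., and `T f (x) = ∫ (∑ₘ g_m(x) h_m(y)) f(y) dμ₁(y)` for a.e. `x`. -/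
theorem nuclear_iff_kernel_representation
    {Ω₁ Ω₂ : Type*} [MeasurableSpace Ω₁] [MeasurableSpace Ω₂]
    (μ₁ : Measure Ω₁) (μ₂ : Measure Ω₂) [SigmaFinite μ₁] [SigmaFinite μ₂]
    (p₁ p₂ q₁ : ℝ≥0∞) [Fact (1 ≤ p₁)] [Fact (1 ≤ p₂)] [Fact (1 ≤ q₁)]
    (hp₁ : p₁ ≠ ∞) (hp₂ : p₂ ≠ ∞) (hq₁ : 1 / p₁ + 1 / q₁ = 1)
    (T : Lp ℂ p₁ μ₁ →L[ℂ] Lp ℂ p₂ μ₂) :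
    IsRNuclear 1 T ↔
      ∃ (g : ℕ → Lp ℂ p₂ μ₂) (h : ℕ → Lp ℂ q₁ μ₁),
        Summable (fun m => ‖g m‖ * ‖h m‖) ∧
        (∀ᵐ z ∂(μ₂.prod μ₁), Summable fun m => ‖g m z.1 * h m z.2‖) ∧
        ∀ f : Lp ℂ p₁ μ₁, ∀ᵐ x ∂μ₂,
          T f x = ∫ y, (∑' m, g m x * h m y) * f y ∂μ₁ := by
  have : HolderConjugate p₁ q₁ := holderConjugate_iff.2 (by simpa using hq₁)
  constructor
  · rintro ⟨x', g, hT, hs⟩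
    simp only [Real.rpow_one] at hs
    choose h hn hx' using fun m => Lp.exists_integral_eq μ₁ (q := q₁) hp₁ (x' m)
    have hs' : Summable fun m => ‖g m‖ * ‖h m‖ := by
      refine Summable.of_nonneg_of_le (fun m => by positivity) (fun m => ?_) hs
      rw [mul_comm]
      gcongr
      exact hn m
    refine ⟨g, h, hs', Lp.ae_prod_summable_norm_mul hs', fun f => ?_⟩
    rw [← (hT f).tsum_eq]
    simp_rw [hx']
    exact (Lp.tsum_integral_smul_ae_eq hs' f).2
  · rintro ⟨g, h, hs, -, hT⟩
    have hx' : ∀ m (f : Lp ℂ p₁ μ₁),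
        (ContinuousLinearMap.mul ℂ ℂ).lpPairing μ₁ q₁ p₁ (h m) f = ∫ y, h m y * f y ∂μ₁ :=
      fun m f => ContinuousLinearMap.lpPairing_eq_integral _ _ _
    refine ⟨fun m => (ContinuousLinearMap.mul ℂ ℂ).lpPairing μ₁ q₁ p₁ (h m), g, fun f => ?_, ?_⟩
    · obtain ⟨hsum, hae⟩ := Lp.tsum_integral_smul_ae_eq hs f
      have hTf : T f = ∑' m, (∫ y, h m y * f y ∂μ₁) • g m := by
        apply Lp.ext
        filter_upwards [hT f, hae] with x h1 h2
        rw [h1, h2]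
      simp_rw [hx', hTf]
      exact hsum.of_norm.hasSum
    · simp only [Real.rpow_one]
      refine Summable.of_nonneg_of_le (fun m => by positivity) (fun m => ?_) hs
      rw [mul_comm]
      gcongr
      refine ContinuousLinearMap.opNorm_le_bound _ (norm_nonneg _) fun f => ?_
      rw [hx']
      exact (norm_integral_le_integral_norm _).trans
        (Lp.integrable_mul_and_integral_norm_mul_le (h m) f).2
end
end

section
/- Let (Ω₁,M₁,μ₁) and (Ω₂,M₂,μ₂) be σ-finite measure spaces, let 0 < r ≤ 1, let 1 ≤ p₁, p₂ < ∞ and let q₁ be the conjugate exponent of p₁ (so 1/p₁ + 1/q₁ = 1). A bounded linear operator T : L^{p₁}(μ₁) → L^{p₂}(μ₂) is r-nuclear if and only if there exist a sequence (g_m) in L^{p₂}(μ₂) and a sequence (h_m) in L^{q₁}(μ₁) such that ∑_{m=1}^∞ ‖g_m‖_{L^{p₂}}^r ‖h_m‖_{L^{q₁}}^r < ∞ and, for every f ∈ L^{p₁}(μ₁), T f(x) = ∫ (∑_{m=1}^∞ g_m(x) h_m(y)) f(y) dμ₁(y) for μ₂-almost every x (the series ∑_m g_m(x)h_m(y) converging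 absolutely for (μ₂×μ₁)-almost every (x,y)). -/
open MeasureTheory ENNReal NNReal Real

noncomputable section

section representation

open Filter Topology

variable {Ω : Type*} [MeasurableSpace Ω] {μ : Measure Ω} {p q : ℝ≥0∞}

/-- An absolutely convergent series in `L^p` converges pointwise almost everywhere. -/
theorem Lp_ae_hasSum_of_summable_norm [Fact (1 ≤ p)] {u : ℕ → Lp ℂ p μ}
    (hu : Summable fun m => ‖u m‖) :
    ∀ᵐ x ∂μ, HasSum (fun m => u m x) ((∑' m, u m : Lp ℂ p μ) x) :=
  Lp.hasSum_coeFn_tsum (tsum_enorm_ne_top_iff_summable_norm.2 hu)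

theorem integral_norm_mul_le [Fact (1 ≤ p)] [Fact (1 ≤ q)] [ENNReal.HolderConjugate q p]
    (h : Lp ℂ q μ) (f : Lp ℂ p μ) :
    Integrable (fun y => h y * f y) μ ∧ ∫ y, ‖h y * f y‖ ∂μ ≤ ‖h‖ * ‖f‖ := by
  have hae := (ContinuousLinearMap.mul ℂ ℂ).coeFn_holder (r := 1) h f
  refine ⟨(L1.integrable_coeFn _).congr hae, ?_⟩
  have h1 := (ContinuousLinearMap.mul ℂ ℂ).norm_holder_apply_apply_le (r := 1) h f
  rw [L1.norm_eq_integral_norm] at h1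
  rw [integral_congr_ae (hae.mono fun x hx => by rw [hx])] at h1
  refine h1.trans ?_
  rw [mul_assoc]
  exact mul_le_of_le_one_left (by positivity) (ContinuousLinearMap.opNorm_mul_le _ _)

section kernel

variable {Ω₁ Ω₂ : Type*} [MeasurableSpace Ω₁] [MeasurableSpace Ω₂]
  {μ₁ : Measure Ω₁} {μ₂ : Measure Ω₂} {p₁ p₂ q₁ : ℝ≥0∞}
  [Fact (1 ≤ p₁)] [Fact (1 ≤ p₂)] [Fact (1 ≤ q₁)] [ENNReal.HolderConjugate q₁ p₁]
  {g : ℕ → Lp ℂ p₂ μ₂} {h : ℕ → Lp ℂ q₁ μ₁}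

theorem ae_summable_integral_norm (hgh : Summable fun m => ‖g m‖ * ‖h m‖) (f : Lp ℂ p₁ μ₁) :
    ∀ᵐ x ∂μ₂, Summable fun m => ∫ y, ‖g m x * h m y * f y‖ ∂μ₁ := by
  let u : ℕ → Lp ℂ p₂ μ₂ := fun m => ((∫ y, ‖h m y * f y‖ ∂μ₁ : ℝ) : ℂ) • g m
  have hu : Summable fun m => ‖u m‖ := by
    refine Summable.of_nonneg_of_le (fun _ => norm_nonneg _) (fun m => ?_) (hgh.mul_right ‖f‖)
    rw [norm_smul, Complex.norm_real,
      Real.norm_of_nonneg (integral_nonneg fun _ => norm_nonneg _)]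
    calc _ ≤ (‖h m‖ * ‖f‖) * ‖g m‖ := by gcongr; exact (integral_norm_mul_le (h m) f).2
      _ = _ := by ring
  have hae : ∀ᵐ x ∂μ₂, ∀ m, u m x = ((∫ y, ‖h m y * f y‖ ∂μ₁ : ℝ) : ℂ) * g m x :=
    ae_all_iff.2 fun m => Lp.coeFn_smul _ _
  filter_upwards [Lp_ae_hasSum_of_summable_norm hu, hae] with x hx hux
  refine hx.summable.norm.congr fun m => ?_
  rw [hux, norm_mul, Complex.norm_real,
    Real.norm_of_nonneg (integral_nonneg fun _ => norm_nonneg _), mul_comm, ← integral_const_mul]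
  simp only [mul_assoc, norm_mul]

theorem ae_tsum_smul_eq_integral (hgh : Summable fun m => ‖g m‖ * ‖h m‖) (f : Lp ℂ p₁ μ₁) :
    (Summable fun m => (∫ y, h m y * f y ∂μ₁) • g m) ∧
    ∀ᵐ x ∂μ₂, (∑' m, (∫ y, h m y * f y ∂μ₁) • g m : Lp ℂ p₂ μ₂) x
      = ∫ y, (∑' m, g m x * h m y) * f y ∂μ₁ := by
  have hu : Summable fun m => ‖(∫ y, h m y * f y ∂μ₁) • g m‖ := by
    refine Summable.of_nonneg_of_le (fun _ => norm_nonneg _) (fun m => ?_) (hgh.mul_right ‖f‖)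
    rw [norm_smul]
    calc _ ≤ (‖h m‖ * ‖f‖) * ‖g m‖ := by
          gcongr
          exact (norm_integral_le_integral_norm _).trans (integral_norm_mul_le (h m) f).2
      _ = _ := by ring
  refine ⟨hu.of_norm, ?_⟩
  have hae : ∀ᵐ x ∂μ₂, ∀ m, ((∫ y, h m y * f y ∂μ₁) • g m : Lp ℂ p₂ μ₂) x
      = (∫ y, h m y * f y ∂μ₁) * g m x := ae_all_iff.2 fun m => Lp.coeFn_smul _ _
  filter_upwards [Lp_ae_hasSum_of_summable_norm hu, hae,
    ae_summable_integral_norm hgh f] with x hx hux hs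
  have hint : ∀ m, Integrable (fun y => g m x * h m y * f y) μ₁ := fun m => by
    simpa only [mul_assoc] using (integral_norm_mul_le (h m) f).1.const_mul (g m x)
  rw [← hx.tsum_eq]
  have hmul : ∀ y, (∑' m, g m x * h m y) * f y = ∑' m, g m x * h m y * f y :=
    fun y => tsum_mul_right.symm
  simp only [hmul]
  rw [← (hasSum_integral_of_summable_integral_norm hint hs).tsum_eq]
  refine tsum_congr fun m => ?_
  rw [hux, mul_comm, ← integral_const_mul]
  simp only [mul_assoc]

theorem ae_prod_summable_norm [SFinite μ₁] [SFinite μ₂]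
    (hgh : Summable fun m => ‖g m‖ * ‖h m‖) {f : Lp ℂ p₁ μ₁} (hf : ∀ᵐ y ∂μ₁, f y ≠ 0) :
    ∀ᵐ z ∂(μ₂.prod μ₁), Summable fun m => ‖g m z.1 * h m z.2‖ := by
  have hiff : ∀ z : Ω₂ × Ω₁, (Summable fun m => ‖g m z.1 * h m z.2‖) ↔
      ∑' m, ‖g m z.1 * h m z.2‖ₑ ≠ ∞ := fun z => by
    rw [← tsum_enorm_ne_top_iff_summable_norm]
  have hg := fun m => (Lp.stronglyMeasurable (g m)).measurable
  have hh := fun m => (Lp.stronglyMeasurable (h m)).measurable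
  have hmeas : MeasurableSet {z : Ω₂ × Ω₁ | Summable fun m => ‖g m z.1 * h m z.2‖} := by
    simp only [hiff]
    exact (measurableSet_singleton ∞).compl.preimage (by fun_prop)
  rw [Measure.ae_prod_iff_ae_ae hmeas]
  filter_upwards [ae_summable_integral_norm hgh f] with x hs
  have hint : ∀ m, Integrable (fun y => g m x * h m y * f y) μ₁ := fun m => by
    simpa only [mul_assoc] using (integral_norm_mul_le (h m) f).1.const_mul (g m x)
  have hae : ∀ᵐ y ∂μ₁, ∀ m, (hint m).toL1 _ y = g m x * h m y * f y :=
    ae_all_iff.2 fun m => Integrable.coeFn_toL1 _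
  have hL1 : Summable fun m => ‖(hint m).toL1‖ := by
    refine hs.congr fun m => ?_
    rw [L1.norm_of_fun_eq_integral_norm]
  filter_upwards [Lp_ae_hasSum_of_summable_norm hL1, hae, hf] with y hsum hey hfy
  have hy := hsum.summable.norm
  simp only [hey, norm_mul _ (f y)] at hy
  exact (summable_mul_right_iff (norm_ne_zero_iff.2 hfy)).1 hy

end kernel

section duality

theorem exists_pos_memLp [SigmaFinite μ] (hp0 : p ≠ 0) (hp : p ≠ ∞) :
    ∃ φ : Ω → ℝ, Measurable φ ∧ (∀ x, 0 < φ x) ∧ MemLp φ p μ := by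
  obtain ⟨w, hw0, hwm, hw⟩ := exists_pos_lintegral_lt_of_sigmaFinite μ one_ne_zero
  have hP : 0 < p.toReal := ENNReal.toReal_pos hp0 hp
  have hm : Measurable fun x => ((w x ^ (1 / p.toReal) : ℝ≥0) : ℝ) := by fun_prop
  refine ⟨_, hm, fun x => NNReal.coe_pos.2 (NNReal.rpow_pos (hw0 x)),
    hm.aestronglyMeasurable, ?_⟩
  rw [eLpNorm_lt_top_iff_lintegral_rpow_enorm_lt_top hp0 hp]
  convert hw.trans ENNReal.one_lt_top using 3 with x
  rw [Real.enorm_eq_ofReal (NNReal.coe_nonneg _), ENNReal.ofReal_coe_nnreal,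
    ← ENNReal.coe_rpow_of_nonneg _ hP.le, ← NNReal.rpow_mul, one_div, inv_mul_cancel₀ hP.ne',
    NNReal.rpow_one]

/-- Dominated convergence in `L^p`. -/
theorem tendsto_toLp_of_dominated [Fact (1 ≤ p)] (hp : p ≠ ∞) {ι : Type*} {l : Filter ι}
    [l.IsCountablyGenerated] {F : ι → Ω → ℂ} {f : Ω → ℂ} (hF : ∀ i, MemLp (F i) p μ)
    (hf : MemLp f p μ) {g : Ω → ℝ} (hg : MemLp g p μ) (hFg : ∀ i x, ‖F i x‖ ≤ g x)
    (hfg : ∀ x, ‖f x‖ ≤ g x) (hlim : ∀ x, Tendsto (fun i => F i x) l (𝓝 (f x))) :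
    Tendsto (fun i => (hF i).toLp (F i)) l (𝓝 (hf.toLp f)) := by
  have hp0 : p ≠ 0 := (zero_lt_one.trans_le Fact.out).ne'
  have hP : 0 < p.toReal := ENNReal.toReal_pos hp0 hp
  rw [Lp.tendsto_Lp_iff_tendsto_eLpNorm'']
  simp only [eLpNorm_eq_lintegral_rpow_enorm_toReal hp0 hp]
  have hlim0 : Tendsto (fun i => ∫⁻ x, ‖(F i - f) x‖ₑ ^ p.toReal ∂μ) l (𝓝 (∫⁻ _, 0 ∂μ)) := by
    refine tendsto_lintegral_filter_of_dominated_convergence'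
      (fun x => ‖(2 : ℝ) * g x‖ₑ ^ p.toReal)
      (Eventually.of_forall fun i => ((hF i).1.sub hf.1).enorm.pow_const _)
      (Eventually.of_forall fun i => Eventually.of_forall fun x => ?_) ?_
      (Eventually.of_forall fun x => ?_)
    · gcongr
      refine enorm_le_iff_norm_le.2 ?_
      calc ‖F i x - f x‖ ≤ ‖F i x‖ + ‖f x‖ := norm_sub_le _ _
        _ ≤ 2 * g x := by linarith [hFg i x, hfg x]
        _ ≤ _ := le_abs_self _
    · exact ((eLpNorm_lt_top_iff_lintegral_rpow_enorm_lt_top hp0 hp).1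
        (hg.const_mul 2).eLpNorm_lt_top).ne
    · have h0 : Tendsto (fun i => ‖F i x - f x‖ₑ) l (𝓝 0) := by
        simpa using ((hlim x).sub_const (f x)).enorm
      simpa [hP, Function.comp_def] using
        ((ENNReal.continuous_rpow_const (y := p.toReal)).tendsto 0).comp h0
  rw [lintegral_zero] at hlim0
  have hinv : (0 : ℝ) < 1 / p.toReal := by positivity
  simpa [hP, Function.comp_def] using
    ((ENNReal.continuous_rpow_const (y := 1 / p.toReal)).tendsto 0).comp hlim0

theorem toLp_eq_zero_of_ae_eq_zero {f : Ω → ℂ} (hf : MemLp f p μ) (h0 : f =ᵐ[μ] 0) :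
    hf.toLp f = 0 :=
  (MemLp.toLp_eq_toLp_iff hf MemLp.zero).2 h0

theorem memLp_mul_of_bounded {u φ : Ω → ℂ} (hφ : MemLp φ p μ) (hu : StronglyMeasurable u) {C : ℝ}
    (hC : ∀ x, ‖u x‖ ≤ C) : MemLp (fun x => u x * φ x) p μ :=
  hφ.of_le_mul (c := C) (hu.aestronglyMeasurable.mul hφ.1) (Eventually.of_forall fun x => by
    rw [norm_mul]; gcongr; exact hC x)

/-- A complex measure absolutely continuous with respect to a σ-finite measure has an integrable
density. -/
theorem exists_integrable_density [SigmaFinite μ] (c : ComplexMeasure Ω)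
    (hc : ∀ s, μ s = 0 → c s = 0) :
    ∃ k : Ω → ℂ, StronglyMeasurable k ∧ Integrable k μ ∧
      ∀ s, MeasurableSet s → c s = ∫ x in s, k x ∂μ := by
  have hac : c ≪ᵥ μ.toENNRealVectorMeasure := VectorMeasure.AbsolutelyContinuous.mk fun s hs h0 =>
    hc s (by rwa [Measure.toENNRealVectorMeasure_apply_measurable hs] at h0)
  obtain ⟨hre, him⟩ := (ComplexMeasure.absolutelyContinuous_ennreal_iff c _).1 hac
  have hre' := SignedMeasure.withDensityᵥ_rnDeriv_eq _ μ hre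
  have him' := SignedMeasure.withDensityᵥ_rnDeriv_eq _ μ him
  refine ⟨c.rnDeriv μ, ?_, ComplexMeasure.integrable_rnDeriv c μ, fun s hs => ?_⟩
  · have hm : Measurable (c.rnDeriv μ) := measurable_of_re_im (𝕜 := ℂ)
      (SignedMeasure.measurable_rnDeriv _ μ) (SignedMeasure.measurable_rnDeriv _ μ)
    exact hm.stronglyMeasurable
  · have hint := ComplexMeasure.integrable_rnDeriv c μ
    apply Complex.ext
    · rw [← RCLike.re_eq_complex_re, ← integral_re hint.integrableOn]
      change ComplexMeasure.re c s = ∫ x in s, (ComplexMeasure.re c).rnDeriv μ x ∂μ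
      rw [← withDensityᵥ_apply (SignedMeasure.integrable_rnDeriv _ _) hs, hre']
    · rw [← RCLike.im_eq_complex_im, ← integral_im hint.integrableOn]
      change ComplexMeasure.im c s = ∫ x in s, (ComplexMeasure.im c).rnDeriv μ x ∂μ
      rw [← withDensityᵥ_apply (SignedMeasure.integrable_rnDeriv _ _) hs, him']

open Classical in
/-- The complex measure `s ↦ L (s.indicator φ)` attached to a functional `L` on `L^p`. -/
def complexMeasureOfDual [Fact (1 ≤ p)] (hp : p ≠ ∞) (L : Lp ℂ p μ →L[ℂ] ℂ) {φ : Ω → ℂ}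
    (hφ : MemLp φ p μ) : ComplexMeasure Ω where
  measureOf' s := if hs : MeasurableSet s then L ((hφ.indicator hs).toLp _) else 0
  empty' := by
    have h0 : (hφ.indicator MeasurableSet.empty).toLp _ = 0 :=
      toLp_eq_zero_of_ae_eq_zero _ (Eventually.of_forall fun x => by simp)
    rw [dif_pos MeasurableSet.empty, h0, map_zero]
  not_measurable' s hs := dif_neg hs
  m_iUnion' f hf hdisj := by
    have hU : ∀ t : Finset ℕ, MeasurableSet (⋃ i ∈ t, f i) :=
      fun t => t.measurableSet_biUnion fun i _ => hf i
    have hsum : ∀ t : Finset ℕ, ∑ i ∈ t, L ((hφ.indicator (hf i)).toLp _)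
        = L ((hφ.indicator (hU t)).toLp _) := by
      intro t
      induction t using Finset.induction_on with
      | empty =>
        rw [Finset.sum_empty, toLp_eq_zero_of_ae_eq_zero _ (Eventually.of_forall fun x => by simp),
          map_zero]
      | insert a t ha ih =>
        rw [Finset.sum_insert ha, ih, ← map_add, ← MemLp.toLp_add]
        congr 1
        refine MemLp.toLp_congr _ _ (Eventually.of_forall fun x => ?_)
        have hd : Disjoint (f a) (⋃ i ∈ t, f i) := by
          simp only [Set.disjoint_iUnion_right]
          exact fun i hi => hdisj (fun h => ha (h ▸ hi))
        rw [Finset.set_biUnion_insert, Set.indicator_union_of_disjoint hd]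
        rfl
    simp only [dif_pos (hf _), dif_pos (MeasurableSet.iUnion hf)]
    rw [HasSum]
    simp only [hsum]
    exact (L.continuous.tendsto _).comp <| tendsto_toLp_of_dominated hp
      (fun t => hφ.indicator (hU t)) (hφ.indicator (MeasurableSet.iUnion hf)) hφ.norm
      (fun t x => norm_indicator_le_norm_self _ _) (fun x => norm_indicator_le_norm_self _ _)
      fun x => (tendsto_indicator_biUnion_finset f φ x).mono_right (pure_le_nhds _)

theorem exists_density_of_dual [SigmaFinite μ] [Fact (1 ≤ p)] (hp : p ≠ ∞)
    (L : Lp ℂ p μ →L[ℂ] ℂ) {φ : Ω → ℂ} (hφ : MemLp φ p μ) :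
    ∃ k : Ω → ℂ, StronglyMeasurable k ∧ Integrable k μ ∧
      ∀ (u : Ω → ℂ) (C : ℝ) (hu : StronglyMeasurable u) (hC : ∀ x, ‖u x‖ ≤ C),
        L ((memLp_mul_of_bounded hφ hu hC).toLp _) = ∫ x, k x * u x ∂μ := by
  have happly : ∀ s (hs : MeasurableSet s),
      complexMeasureOfDual hp L hφ s = L ((hφ.indicator hs).toLp _) := fun s hs => dif_pos hs
  obtain ⟨k, hkm, hk, hkc⟩ := exists_integrable_density (μ := μ) (complexMeasureOfDual hp L hφ)
    fun s h0 => by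
      by_cases hs : MeasurableSet s
      · rw [happly s hs, toLp_eq_zero_of_ae_eq_zero _ (indicator_meas_zero h0), map_zero]
      · exact VectorMeasure.not_measurable _ hs
  refine ⟨k, hkm, hk, fun u C hu hC => ?_⟩
  have hkint : ∀ (u : Ω → ℂ) (C : ℝ), StronglyMeasurable u → (∀ x, ‖u x‖ ≤ C) →
      Integrable (fun x => k x * u x) μ := fun u C hu hC =>
    hk.mul_bdd hu.aestronglyMeasurable (Eventually.of_forall hC)
  have hsimple : ∀ (v : SimpleFunc Ω ℂ) (hv : MemLp (fun x => v x * φ x) p μ),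
      L (hv.toLp _) = ∫ x, k x * v x ∂μ := by
    intro v
    induction v using SimpleFunc.induction with
    | const c hs =>
      rename_i s
      intro hv
      have heq : hv.toLp _ = c • (hφ.indicator hs).toLp _ := by
        rw [← MemLp.toLp_const_smul]
        refine MemLp.toLp_congr _ _ (Eventually.of_forall fun x => ?_)
        by_cases hx : x ∈ s <;> simp [hx]
      rw [heq, map_smul, ← happly s hs, hkc s hs, ← integral_indicator hs, smul_eq_mul,
        ← integral_const_mul]
      refine integral_congr_ae (Eventually.of_forall fun x => ?_)
      by_cases hx : x ∈ s <;> simp [hx, mul_comm]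
    | @add f g _ hf hg =>
      intro hv
      obtain ⟨Cf, hCf⟩ := f.exists_forall_norm_le
      obtain ⟨Cg, hCg⟩ := g.exists_forall_norm_le
      have hf' := memLp_mul_of_bounded hφ f.stronglyMeasurable hCf
      have hg' := memLp_mul_of_bounded hφ g.stronglyMeasurable hCg
      have heq : hv.toLp _ = hf'.toLp _ + hg'.toLp _ := by
        rw [← MemLp.toLp_add]
        exact MemLp.toLp_congr _ _ (Eventually.of_forall fun x => by simp [add_mul])
      rw [heq, map_add, hf hf', hg hg', ← integral_add (hkint f Cf f.stronglyMeasurable hCf)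
        (hkint g Cg g.stronglyMeasurable hCg)]
      simp [mul_add]
  rcases isEmpty_or_nonempty Ω with hΩ | ⟨⟨x₀⟩⟩
  · rw [toLp_eq_zero_of_ae_eq_zero _ (Eventually.of_forall fun x => hΩ.elim x), map_zero,
      integral_of_isEmpty]
  have hC0 : 0 ≤ C := (norm_nonneg _).trans (hC x₀)
  have hbd := hu.norm_approxBounded_le hC0
  have hL : Tendsto (fun n => L ((memLp_mul_of_bounded hφ
      (hu.approxBounded C n).stronglyMeasurable (hbd n)).toLp _)) atTop
      (𝓝 (L ((memLp_mul_of_bounded hφ hu hC).toLp _))) := by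
    refine (L.continuous.tendsto _).comp <| tendsto_toLp_of_dominated hp _ _
      (hφ.norm.const_mul C) (fun n x => ?_) (fun x => ?_)
      fun x => (hu.tendsto_approxBounded_of_norm_le (hC x)).mul_const _
    · rw [norm_mul]; gcongr; exact hbd n x
    · rw [norm_mul]; gcongr; exact hC x
  refine tendsto_nhds_unique hL ?_
  simp only [hsimple]
  refine tendsto_integral_of_dominated_convergence (fun x => ‖k x‖ * C)
    (fun n => (hkint _ C (hu.approxBounded C n).stronglyMeasurable (hbd n)).1)
    (hk.norm.mul_const C) (fun n => Eventually.of_forall fun x => ?_)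
    (Eventually.of_forall fun x => (hu.tendsto_approxBounded_of_norm_le (hC x)).const_mul _)
  rw [norm_mul]; gcongr; exact hbd n x

/-- The converse of Hölder's inequality. -/
theorem eLpNorm_le_of_forall_lintegral_mul_le [SigmaFinite μ] [ENNReal.HolderConjugate q p]
    (hp : p ≠ ∞) {a : Ω → ℝ≥0∞} (ha : Measurable a) (ha' : ∀ x, a x ≠ ∞) {C : ℝ≥0∞}
    (h : ∀ v : Ω → ℝ≥0∞, Measurable v → ∫⁻ x, a x * v x ∂μ ≤ C * eLpNorm v p μ) :
    eLpNorm a q μ ≤ C := by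
  by_cases hq : q = ∞
  · obtain rfl : p = 1 := by
      have := ENNReal.HolderConjugate.inv_add_inv_eq_one q p
      rw [hq, ENNReal.inv_top, zero_add] at this
      exact ENNReal.inv_eq_one.1 this
    subst hq
    rw [eLpNorm_exponent_top, eLpNormEssSup]
    refine essSup_le_of_ae_le _ ?_
    simp only [enorm_eq_self]
    refine ae_le_of_forall_setLIntegral_le_of_sigmaFinite ha fun s hs _ => ?_
    have := h (s.indicator 1) (measurable_one.indicator hs)
    rw [eLpNorm_one_eq_lintegral_enorm] at this
    simp only [enorm_eq_self] at this
    rw [lintegral_indicator_one hs] at this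
    rw [setLIntegral_const, ← lintegral_indicator hs]
    refine le_trans (le_of_eq (lintegral_congr fun x => ?_)) this
    by_cases hx : x ∈ s <;> simp [hx]
  have hp0 : p ≠ 0 := ENNReal.HolderConjugate.ne_zero p q
  have hq0 : q ≠ 0 := ENNReal.HolderConjugate.ne_zero q p
  have hP : 0 < p.toReal := ENNReal.toReal_pos hp0 hp
  have hQ : 0 < q.toReal := ENNReal.toReal_pos hq0 hq
  have hPQ : q.toReal⁻¹ + p.toReal⁻¹ = 1 := by
    have := congrArg ENNReal.toReal (ENNReal.HolderConjugate.inv_add_inv_eq_one q p)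
    rwa [ENNReal.toReal_add (by simpa) (by simpa), ENNReal.toReal_inv, ENNReal.toReal_inv,
      ENNReal.toReal_one] at this
  have hQ1 : 1 ≤ q.toReal := by
    rw [← inv_le_one₀ hQ]
    linarith [inv_pos.2 hP]
  have hmul : (q.toReal - 1) * p.toReal = q.toReal := by
    field_simp at hPQ
    linarith
  let A : ℕ → Set Ω := fun n => {x | a x ≤ n} ∩ spanningSets μ n
  have hA : ∀ n, MeasurableSet (A n) := fun n =>
    (measurableSet_le ha measurable_const).inter (measurableSet_spanningSets μ n)
  have hAmono : Monotone A := fun m n hmn =>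
    Set.inter_subset_inter (fun x (hx : a x ≤ m) => hx.trans (by exact_mod_cast hmn))
      (monotone_spanningSets μ hmn)
  have hAU : ⋃ n, A n = Set.univ := by
    refine Set.eq_univ_of_forall fun x => ?_
    obtain ⟨m, hm⟩ := ENNReal.exists_nat_gt (ha' x)
    obtain ⟨n, hn⟩ := Set.mem_iUnion.1 ((iUnion_spanningSets μ).symm ▸ Set.mem_univ x)
    refine Set.mem_iUnion.2 ⟨max m n, hm.le.trans ?_, monotone_spanningSets μ (le_max_right m n) hn⟩
    exact_mod_cast le_max_left m n
  have hX : ∀ n, ∫⁻ x in A n, a x ^ q.toReal ∂μ ≤ C ^ q.toReal := by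
    intro n
    set X := ∫⁻ x in A n, a x ^ q.toReal ∂μ with hXdef
    rcases eq_or_ne X 0 with h0 | h0
    · rw [h0]; exact zero_le
    have hXtop : X ≠ ∞ := by
      refine ne_top_of_le_ne_top (b := (n : ℝ≥0∞) ^ q.toReal * μ (spanningSets μ n)) ?_ ?_
      · exact ENNReal.mul_ne_top (ENNReal.rpow_ne_top_of_nonneg hQ.le (ENNReal.natCast_ne_top n))
          (measure_spanningSets_lt_top μ n).ne
      · calc X ≤ ∫⁻ _ in A n, (n : ℝ≥0∞) ^ q.toReal ∂μ := setLIntegral_mono measurable_const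
              fun x hx => ENNReal.rpow_le_rpow hx.1 hQ.le
          _ = (n : ℝ≥0∞) ^ q.toReal * μ (A n) := setLIntegral_const _ _
          _ ≤ _ := by gcongr; exact Set.inter_subset_right
    have hv := h ((A n).indicator fun x => a x ^ (q.toReal - 1))
      ((ha.pow_const _).indicator (hA n))
    have hleft : ∫⁻ x, a x * (A n).indicator (fun x => a x ^ (q.toReal - 1)) x ∂μ = X := by
      rw [hXdef, ← lintegral_indicator (hA n)]
      refine lintegral_congr fun x => ?_
      by_cases hx : x ∈ A n
      · simp only [Set.indicator_of_mem hx]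
        nth_rewrite 1 [← ENNReal.rpow_one (a x)]
        rw [← ENNReal.rpow_add_of_nonneg _ _ zero_le_one (by linarith), add_sub_cancel]
      · simp [hx]
    have hright : eLpNorm ((A n).indicator fun x => a x ^ (q.toReal - 1)) p μ
        = X ^ p.toReal⁻¹ := by
      rw [eLpNorm_eq_lintegral_rpow_enorm_toReal hp0 hp, one_div, hXdef,
        ← lintegral_indicator (hA n)]
      congr 1
      refine lintegral_congr fun x => ?_
      by_cases hx : x ∈ A n
      · simp only [Set.indicator_of_mem hx, enorm_eq_self]
        rw [← ENNReal.rpow_mul, hmul]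
      · simp [hx, hP]
    rw [hleft, hright] at hv
    have hXq : X ^ q.toReal⁻¹ ≤ C := by
      rw [eq_sub_of_add_eq hPQ, ENNReal.rpow_sub _ _ h0 hXtop, ENNReal.rpow_one]
      exact ENNReal.div_le_of_le_mul hv
    calc X = (X ^ q.toReal⁻¹) ^ q.toReal := by
          rw [← ENNReal.rpow_mul, inv_mul_cancel₀ hQ.ne', ENNReal.rpow_one]
      _ ≤ _ := ENNReal.rpow_le_rpow hXq hQ.le
  rw [eLpNorm_eq_lintegral_rpow_enorm_toReal hq0 hq, one_div, ENNReal.rpow_inv_le_iff hQ]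
  simp only [enorm_eq_self]
  rw [← setLIntegral_univ, ← hAU,
    setLIntegral_iUnion_of_directed _ (directed_of_isDirected_le hAmono)]
  exact iSup_le hX

/-- Every functional on `L^p`, `p < ∞`, is integration against a function in `L^q`. -/
theorem exists_Lp_eq_integral_of_dual [SigmaFinite μ] [Fact (1 ≤ p)]
    [ENNReal.HolderConjugate q p] (hp : p ≠ ∞) (L : Lp ℂ p μ →L[ℂ] ℂ) :
    ∃ h : Lp ℂ q μ, ‖h‖ ≤ ‖L‖ ∧ ∀ f : Lp ℂ p μ, L f = ∫ x, h x * f x ∂μ := by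
  have hp0 : p ≠ 0 := (zero_lt_one.trans_le Fact.out).ne'
  obtain ⟨φ, hφm, hφ0, hφ⟩ := exists_pos_memLp (μ := μ) hp0 hp
  have hφc0 : ∀ x, (φ x : ℂ) ≠ 0 := fun x => Complex.ofReal_ne_zero.2 (hφ0 x).ne'
  obtain ⟨k, hkm, hk, hL⟩ := exists_density_of_dual hp L hφ.ofReal
  have hφcm : Measurable fun x => (φ x : ℂ) := by fun_prop
  set h : Ω → ℂ := fun x => k x / φ x with hdef
  have hm : Measurable h := hkm.measurable.div hφcm
  have hbdd : ∀ (v : Ω → ℝ≥0∞) (n : ℕ), Measurable v → (∀ x, v x ≤ n * ENNReal.ofReal (φ x)) →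
      ∫⁻ x, ‖h x‖ₑ * v x ∂μ ≤ ‖L‖ₑ * eLpNorm v p μ := by
    intro v n hv hvn
    have hvtop : ∀ x, v x ≠ ∞ := fun x => ne_top_of_le_ne_top
      (ENNReal.mul_ne_top (ENNReal.natCast_ne_top n) ENNReal.ofReal_ne_top) (hvn x)
    set b : Ω → ℝ := fun x => (v x).toReal / φ x with hb
    have hb0 : ∀ x, 0 ≤ b x := fun x => div_nonneg ENNReal.toReal_nonneg (hφ0 x).le
    have hbm : Measurable b := hv.ennreal_toReal.div hφm
    have hbn : ∀ x, b x ≤ n := fun x => by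
      rw [hb, div_le_iff₀ (hφ0 x)]
      have := ENNReal.toReal_mono
        (ENNReal.mul_ne_top (ENNReal.natCast_ne_top n) ENNReal.ofReal_ne_top) (hvn x)
      rwa [ENNReal.toReal_mul, ENNReal.toReal_natCast, ENNReal.toReal_ofReal (hφ0 x).le] at this
    set u : Ω → ℂ := fun x => (starRingEnd ℂ) (k x) / (‖k x‖ : ℂ) * b x with hu
    have hkm' := hkm.measurable
    have hum : Measurable u :=
      ((Complex.continuous_conj.measurable.comp hkm').div
        (Complex.measurable_ofReal.comp hkm'.norm)).mul (Complex.measurable_ofReal.comp hbm)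
    have hub : ∀ x, ‖u x‖ ≤ b x := fun x => by
      rw [hu, norm_mul, norm_div, RCLike.norm_conj, Complex.norm_real, Complex.norm_real, norm_norm,
        Real.norm_of_nonneg (hb0 x)]
      exact mul_le_of_le_one_left (hb0 x) (div_self_le_one _)
    have hku : ∀ x, k x * u x = ((‖k x‖ * b x : ℝ) : ℂ) := fun x => by
      rcases eq_or_ne (k x) 0 with h0 | h0
      · simp [h0]
      · have : (‖k x‖ : ℂ) ≠ 0 := Complex.ofReal_ne_zero.2 (norm_ne_zero_iff.2 h0)
        rw [hu]
        push_cast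
        field_simp
        rw [Complex.mul_conj']
    have hLu := hL u n hum.stronglyMeasurable fun x => (hub x).trans (hbn x)
    simp only [hku] at hLu
    rw [integral_complex_ofReal] at hLu
    have hint : Integrable (fun x => ‖k x‖ * b x) μ :=
      hk.norm.mul_bdd hbm.aestronglyMeasurable (Eventually.of_forall fun x => by
        rw [Real.norm_of_nonneg (hb0 x)]; exact hbn x)
    calc ∫⁻ x, ‖h x‖ₑ * v x ∂μ = ∫⁻ x, ENNReal.ofReal (‖k x‖ * b x) ∂μ := by
          refine lintegral_congr fun x => ?_
          rw [← ofReal_norm, ← ENNReal.ofReal_toReal (hvtop x),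
            ← ENNReal.ofReal_mul (norm_nonneg _), hdef, norm_div, Complex.norm_real,
            Real.norm_of_nonneg (hφ0 x).le]
          congr 1
          rw [hb]
          ring
      _ = ENNReal.ofReal (∫ x, ‖k x‖ * b x ∂μ) :=
          (ofReal_integral_eq_lintegral_ofReal hint
            (Eventually.of_forall fun x => mul_nonneg (norm_nonneg _) (hb0 x))).symm
      _ = ‖((∫ x, ‖k x‖ * b x ∂μ : ℝ) : ℂ)‖ₑ := by
          rw [← ofReal_norm, Complex.norm_real, Real.norm_of_nonneg
            (integral_nonneg fun x => mul_nonneg (norm_nonneg _) (hb0 x))]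
      _ ≤ ‖L‖ₑ * ‖(memLp_mul_of_bounded hφ.ofReal hum.stronglyMeasurable
            fun x => (hub x).trans (hbn x)).toLp _‖ₑ := by
          rw [← hLu]
          exact L.le_opENorm _
      _ ≤ ‖L‖ₑ * eLpNorm v p μ := by
          rw [Lp.enorm_toLp]
          gcongr
          refine eLpNorm_mono_enorm fun x => ?_
          rw [enorm_eq_self, ← ofReal_norm, ← ENNReal.ofReal_toReal (hvtop x)]
          refine ENNReal.ofReal_le_ofReal ?_
          rw [norm_mul]
          calc _ ≤ b x * φ x := by
                gcongr
                · exact hb0 x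
                · exact hub x
                · rw [RCLike.norm_ofReal, abs_of_pos (hφ0 x)]
            _ = _ := div_mul_cancel₀ _ (hφ0 x).ne'
  have hnorm : eLpNorm h q μ ≤ ‖L‖ₑ := by
    rw [← eLpNorm_enorm]
    refine eLpNorm_le_of_forall_lintegral_mul_le (p := p) hp hm.enorm (fun x => enorm_ne_top)
      fun v hv => ?_
    have hsup : ∀ x, ‖h x‖ₑ * v x = ⨆ n : ℕ, ‖h x‖ₑ * min (v x) (n * ENNReal.ofReal (φ x)) := by
      intro x
      rw [← ENNReal.mul_iSup, ← inf_iSup_eq, ← ENNReal.iSup_mul, ENNReal.iSup_natCast,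
        ENNReal.top_mul (ENNReal.ofReal_pos.2 (hφ0 x)).ne', inf_top_eq]
    have hmeas : ∀ n : ℕ, Measurable fun x => min (v x) (n * ENNReal.ofReal (φ x)) := fun n =>
      hv.min (hφm.ennreal_ofReal.const_mul _)
    simp only [hsup]
    have hmono : Monotone fun (n : ℕ) x => ‖h x‖ₑ * min (v x) (n * ENNReal.ofReal (φ x)) :=
      fun m n hmn x => by
        dsimp only
        gcongr
    rw [lintegral_iSup (f := fun (n : ℕ) x => ‖h x‖ₑ * min (v x) (n * ENNReal.ofReal (φ x)))
      (fun n => hm.enorm.mul (hmeas n)) hmono]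
    refine iSup_le fun n => (hbdd _ n (hmeas n) fun x => min_le_right _ _).trans ?_
    gcongr
    refine eLpNorm_mono_enorm fun x => ?_
    simp only [enorm_eq_self]
    exact min_le_left _ _
  have hh : MemLp h q μ := ⟨hm.aestronglyMeasurable, hnorm.trans_lt enorm_lt_top⟩
  have : Fact (1 ≤ q) := ⟨ENNReal.HolderConjugate.one_le q p⟩
  refine ⟨hh.toLp h, ?_, fun f => ?_⟩
  · rw [Lp.norm_toLp, ← toReal_enorm L]
    exact ENNReal.toReal_mono enorm_ne_top hnorm
  have hfm := Lp.stronglyMeasurable f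
  let S : ℕ → Set Ω := fun n => {x | ‖f x / φ x‖ ≤ n}
  have hS : ∀ n, MeasurableSet (S n) := fun n =>
    measurableSet_le (hfm.measurable.div hφcm).norm measurable_const
  let u : ℕ → Ω → ℂ := fun n => (S n).indicator fun x => f x / φ x
  have hum : ∀ n, StronglyMeasurable (u n) := fun n =>
    ((hfm.measurable.div hφcm).indicator (hS n)).stronglyMeasurable
  have hub : ∀ n x, ‖u n x‖ ≤ n := fun n x => by
    by_cases hx : x ∈ S n
    · simp only [u, Set.indicator_of_mem hx]
      exact hx
    · simp [u, hx]
  have huφ : ∀ n x, u n x * φ x = (S n).indicator f x := fun n x => by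
    by_cases hx : x ∈ S n
    · simp only [u, Set.indicator_of_mem hx, div_mul_cancel₀ _ (hφc0 x)]
    · simp [u, hx]
  have hku : ∀ n x, k x * u n x = h x * (S n).indicator f x := fun n x => by
    rw [← huφ, hdef]
    field_simp [hφc0 x]
  have hlim : ∀ x, Tendsto (fun n => (S n).indicator f x) atTop (𝓝 (f x)) := fun x => by
    obtain ⟨N, hN⟩ := exists_nat_ge ‖f x / φ x‖
    refine tendsto_const_nhds.congr' ?_
    filter_upwards [eventually_ge_atTop N] with n hn
    rw [Set.indicator_of_mem]
    exact hN.trans (by exact_mod_cast hn)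
  have hint : Integrable (fun x => h x * f x) μ :=
    ((integral_norm_mul_le (hh.toLp h) f).1).congr (hh.coeFn_toLp.mono fun x hx => by
      dsimp only
      rw [hx])
  rw [integral_congr_ae (g := fun x => h x * f x) (hh.coeFn_toLp.mono fun x hx => by
    dsimp only
    rw [hx])]
  have h1 : Tendsto (fun n => L (((Lp.memLp f).indicator (hS n)).toLp _)) atTop (𝓝 (L f)) := by
    conv_rhs => rw [← Lp.toLp_coeFn f (Lp.memLp f)]
    exact (L.continuous.tendsto _).comp <| tendsto_toLp_of_dominated hp _ _ (Lp.memLp f).norm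
      (fun n x => norm_indicator_le_norm_self _ _) (fun x => le_rfl) hlim
  refine tendsto_nhds_unique h1 ?_
  have h2 : ∀ n, L (((Lp.memLp f).indicator (hS n)).toLp _)
      = ∫ x, h x * (S n).indicator f x ∂μ := fun n => by
    rw [← integral_congr_ae (Eventually.of_forall (hku n)), ← hL (u n) n (hum n) (hub n)]
    congr 1
    exact MemLp.toLp_congr _ _ (Eventually.of_forall fun x => (huφ n x).symm)
  simp only [h2]
  refine tendsto_integral_of_dominated_convergence (fun x => ‖h x * f x‖)
    (fun n => hm.aestronglyMeasurable.mul ((Lp.memLp f).indicator (hS n)).1) hint.norm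
    (fun n => Eventually.of_forall fun x => ?_)
    (Eventually.of_forall fun x => (hlim x).const_mul _)
  rw [norm_mul, norm_mul]
  gcongr
  exact norm_indicator_le_norm_self _ _

end duality

end representation

/-- **Characterisation of `r`-nuclear operators on `L^p`-spaces.** Let `(Ω₁,μ₁)`, `(Ω₂,μ₂)` be
σ-finite measure spaces, `0 < r ≤ 1`, `1 ≤ p₁, p₂ < ∞` and `1/p₁ + 1/q₁ = 1`. A bounded operator
`T : L^{p₁}(μ₁) → L^{p₂}(μ₂)` is `r`-nuclear iff there are sequences `(g_m)` in `L^{p₂}(μ₂)` and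
`(h_m)` in `L^{q₁}(μ₁)` with `∑ₘ ‖g_m‖^r ‖h_m‖^r < ∞`, the series `∑ₘ g_m(x) h_m(y)` converging
absolutely a.e., and `T f (x) = ∫ (∑ₘ g_m(x) h_m(y)) f(y) dμ₁(y)` for a.e. `x`. -/
theorem rNuclear_iff_kernel_representation
    {Ω₁ Ω₂ : Type*} [MeasurableSpace Ω₁] [MeasurableSpace Ω₂]
    (μ₁ : Measure Ω₁) (μ₂ : Measure Ω₂) [SigmaFinite μ₁] [SigmaFinite μ₂]
    (r : ℝ) (hr0 : 0 < r) (hr1 : r ≤ 1)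
    (p₁ p₂ q₁ : ℝ≥0∞) [Fact (1 ≤ p₁)] [Fact (1 ≤ p₂)] [Fact (1 ≤ q₁)]
    (hp₁ : p₁ ≠ ∞) (hp₂ : p₂ ≠ ∞) (hq₁ : 1 / p₁ + 1 / q₁ = 1)
    (T : Lp ℂ p₁ μ₁ →L[ℂ] Lp ℂ p₂ μ₂) :
    IsRNuclear r T ↔
      ∃ (g : ℕ → Lp ℂ p₂ μ₂) (h : ℕ → Lp ℂ q₁ μ₁),
        Summable (fun m => ‖g m‖ ^ r * ‖h m‖ ^ r) ∧
        (∀ᵐ z ∂(μ₂.prod μ₁), Summable fun m => ‖g m z.1 * h m z.2‖) ∧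
        ∀ f : Lp ℂ p₁ μ₁, ∀ᵐ x ∂μ₂,
          T f x = ∫ y, (∑' m, g m x * h m y) * f y ∂μ₁ := by
  have hconj : ENNReal.HolderConjugate q₁ p₁ :=
    ENNReal.holderConjugate_iff.2 (by simpa only [one_div, add_comm] using hq₁)
  have hsum : ∀ a b : ℕ → ℝ, (∀ m, 0 ≤ a m) → (∀ m, 0 ≤ b m) →
      Summable (fun m => a m ^ r * b m ^ r) → Summable fun m => a m * b m := by
    intro a b ha hb hab
    refine Summable.of_norm_bounded_eventually_nat hab ?_
    filter_upwards [hab.tendsto_atTop_zero.eventually (Iic_mem_nhds zero_lt_one)] with m hm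
    have hc := mul_nonneg (ha m) (hb m)
    rw [← Real.mul_rpow (ha m) (hb m)] at hm
    rw [Real.norm_of_nonneg hc, ← Real.mul_rpow (ha m) (hb m)]
    have hc1 : a m * b m ≤ 1 := le_of_not_gt fun h => hm.not_gt (Real.one_lt_rpow h hr0)
    exact Real.self_le_rpow_of_le_one hc hc1 hr1
  constructor
  · rintro ⟨x', y, hxy, hs⟩
    choose h hle hrep using fun m => exists_Lp_eq_integral_of_dual (q := q₁) hp₁ (x' m)
    have hs' : Summable fun m => ‖y m‖ ^ r * ‖h m‖ ^ r := by
      refine Summable.of_nonneg_of_le (fun m => by positivity) (fun m => ?_) hs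
      rw [mul_comm]
      gcongr
      exact hle m
    have hgh := hsum _ _ (fun m => norm_nonneg _) (fun m => norm_nonneg _) hs'
    obtain ⟨φ, -, hφ0, hφ⟩ := exists_pos_memLp (μ := μ₁)
      (zero_lt_one.trans_le (Fact.out : 1 ≤ p₁)).ne' hp₁
    have hφ' : MemLp (fun x => (φ x : ℂ)) p₁ μ₁ := hφ.ofReal
    refine ⟨y, h, hs', ae_prod_summable_norm (f := hφ'.toLp _) hgh ?_, fun f => ?_⟩
    · filter_upwards [hφ'.coeFn_toLp] with x hx
      rw [hx]
      exact Complex.ofReal_ne_zero.2 (hφ0 x).ne'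
    · filter_upwards [(ae_tsum_smul_eq_integral hgh f).2] with x hx
      rw [← hx, ← (hxy f).tsum_eq]
      simp only [hrep]
  · rintro ⟨g, h, hs, -, hT⟩
    have hgh := hsum _ _ (fun m => norm_nonneg _) (fun m => norm_nonneg _) hs
    let x' : ℕ → (Lp ℂ p₁ μ₁ →L[ℂ] ℂ) := fun m =>
      (ContinuousLinearMap.mul ℂ ℂ).lpPairing μ₁ q₁ p₁ (h m)
    have hx' : ∀ m f, x' m f = ∫ y, h m y * f y ∂μ₁ := fun m f => by
      simp only [x', ContinuousLinearMap.lpPairing_eq_integral, ContinuousLinearMap.mul_apply']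
    refine ⟨x', g, fun f => ?_, ?_⟩
    · obtain ⟨hs', hae⟩ := ae_tsum_smul_eq_integral hgh f
      simp only [hx']
      convert hs'.hasSum
      refine Lp.ext ?_
      filter_upwards [hT f, hae] with x h1 h2
      rw [h1, h2]
    · refine Summable.of_nonneg_of_le (fun m => by positivity) (fun m => ?_) hs
      rw [mul_comm]
      gcongr
      refine ContinuousLinearMap.opNorm_le_bound _ (norm_nonneg _) fun f => ?_
      rw [hx']
      exact (norm_integral_le_integral_norm _).trans (integral_norm_mul_le (h m) f).2
end
end

section
/- Let E be a complex Banach space with the approximation property, let 0 < r ≤ 1, and let T : E → E be an r-nuclear operator. Set s by 1/s = 1/r − 1/2 (i.e. s = 2r/(2−r)). Then the family λ ↦ m(λ)·|λ|^s is summable over λ ∈ ℂ and ∑_{λ∈ℂ} m(λ) |λ|^s ≤ n_r(T)^s, where m(λ) is the algebraic multiplicity of λ as an eigenvalue of T. -/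
open MeasureTheory ENNReal NNReal Real

noncomputable section

/-- The quasi-norm `n_r(T)`: the infimum of `(∑ₘ ‖x'_m‖^r ‖y_m‖^r)^{1/r}` over all
representations `T = ∑ₘ x'_m ⊗ y_m` as above. -/
noncomputable def nuclearQuasiNorm {E F : Type*} [NormedAddCommGroup E] [NormedSpace ℂ E]
    [NormedAddCommGroup F] [NormedSpace ℂ F] (r : ℝ) (T : E →L[ℂ] F) : ℝ :=
  sInf {c : ℝ | ∃ (x' : ℕ → (E →L[ℂ] ℂ)) (y : ℕ → F),
    (∀ v : E, HasSum (fun m => x' m v • y m) (T v)) ∧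
    Summable (fun m => ‖x' m‖ ^ r * ‖y m‖ ^ r) ∧
    c = (∑' m, ‖x' m‖ ^ r * ‖y m‖ ^ r) ^ (1 / r)}

/-- `E` has the approximation property: for every compact `K ⊆ E` and `ε > 0` there is a
bounded finite-rank operator `B` on `E` with `‖x - Bx‖ < ε` for all `x ∈ K`. -/
def HasApproxProperty (E : Type*) [NormedAddCommGroup E] [NormedSpace ℂ E] : Prop :=
  ∀ K : Set E, IsCompact K → ∀ ε : ℝ, 0 < ε →
    ∃ B : E →L[ℂ] E, FiniteDimensional ℂ (LinearMap.range (B : E →ₗ[ℂ] E)) ∧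
      ∀ x ∈ K, ‖x - B x‖ < ε

/-- The algebraic multiplicity of `l ∈ ℂ` as an eigenvalue of `T`: the (possibly zero) finrank of
the generalized eigenspace `⨆_{j ≥ 1} ker((T - l·I)^j)`. -/
noncomputable def algMult {E : Type*} [NormedAddCommGroup E] [NormedSpace ℂ E]
    (T : E →L[ℂ] E) (l : ℂ) : ℕ :=
  Module.finrank ℂ
    ↥(⨆ j : ℕ, LinearMap.ker (((T : E →ₗ[ℂ] E) - l • (1 : E →ₗ[ℂ] E)) ^ (j + 1)))

open Module in
/-- A vector of a generalized eigenspace outside a subspace `W` can be replaced by one which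
`T - l` moves into `W`. -/
lemma exists_mem_maxGenEigenspace_notMem_sub_mem {K V : Type*} [Field K] [AddCommGroup V]
    [Module K V] (T : End K V) (l : K) (W : Submodule K V) (h : ¬ T.maxGenEigenspace l ≤ W) :
    ∃ w ∈ T.maxGenEigenspace l, w ∉ W ∧ T w - l • w ∈ W := by
  classical
  obtain ⟨v, hv, hvW⟩ := SetLike.not_le_iff_exists.1 h
  obtain ⟨k, hk⟩ := (End.mem_maxGenEigenspace T l v).1 hv
  have hex : ∃ k : ℕ, ((T - l • (1 : End K V)) ^ k) v ∈ W := ⟨k, by simp [hk]⟩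
  have h0 : Nat.find hex ≠ 0 := fun h0 => hvW (by simpa [h0] using Nat.find_spec hex)
  obtain ⟨m, hm⟩ := Nat.exists_eq_succ_of_ne_zero h0
  refine ⟨((T - l • (1 : End K V)) ^ m) v, ?_, Nat.find_min hex (by omega), ?_⟩
  · refine (End.mem_maxGenEigenspace T l _).2 ⟨k, ?_⟩
    rw [← Module.End.mul_apply, ← pow_add, add_comm, pow_add, Module.End.mul_apply, hk, map_zero]
  · have := Nat.find_spec hex
    rw [hm, Nat.succ_eq_add_one, pow_succ', Module.End.mul_apply] at this
    simpa using this

open Module in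
/-- Finitely many finite-dimensional generalized eigenspaces of an endomorphism yield a linearly
independent family on which the endomorphism is triangular, whose diagonal contains each eigenvalue
at least as often as its algebraic multiplicity. -/
lemma exists_linearIndependent_triangular {K V : Type*} [Field K] [DecidableEq K] [AddCommGroup V]
    [Module K V] (T : End K V) (s : Finset K)
    (hs : ∀ l ∈ s, FiniteDimensional K (T.maxGenEigenspace l)) :
    ∃ (n : ℕ) (f : Fin n → V) (μ : Fin n → K), LinearIndependent K f ∧ (∀ j, μ j ∈ s) ∧
      (∀ j, T (f j) - μ j • f j ∈ Submodule.span K (f '' Set.Iio j)) ∧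
      ∀ l ∈ s, finrank K (T.maxGenEigenspace l) ≤ (Finset.univ.filter fun j => μ j = l).card := by
  classical
  have hfin : FiniteDimensional K ↥(s.sup T.maxGenEigenspace) := by
    induction s using Finset.induction_on with
    | empty => rw [Finset.sup_empty]; infer_instance
    | insert a t _ ih =>
      have h1 := hs a (Finset.mem_insert_self a t)
      have h2 := ih fun l hl => hs l (Finset.mem_insert_of_mem hl)
      rw [Finset.sup_insert]
      exact Submodule.finite_sup _ _
  let Good : ℕ → Prop := fun n => ∃ (f : Fin n → V) (μ : Fin n → K), LinearIndependent K f ∧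
    (∀ j, μ j ∈ s) ∧ (∀ j, T (f j) - μ j • f j ∈ Submodule.span K (f '' Set.Iio j)) ∧
    ∀ j, f j ∈ T.maxGenEigenspace (μ j)
  have good_zero : Good 0 :=
    ⟨Fin.elim0, Fin.elim0, linearIndependent_empty_type, fun j => j.elim0, fun j => j.elim0,
      fun j => j.elim0⟩
  have bound : ∀ n, Good n → n ≤ finrank K ↥(s.sup T.maxGenEigenspace) := by
    rintro n ⟨f, μ, hf, hμ, -, hmem⟩
    have h1 : finrank K (Submodule.span K (Set.range f)) = n := by
      simpa using finrank_span_eq_card hf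
    rw [← h1]
    refine Submodule.finrank_mono (Submodule.span_le.2 ?_)
    rintro _ ⟨j, rfl⟩
    exact Finset.le_sup (f := T.maxGenEigenspace) (hμ j) (hmem j)
  set n := Nat.findGreatest Good (finrank K ↥(s.sup T.maxGenEigenspace)) with hn
  have hgood : Good n := Nat.findGreatest_spec (Nat.zero_le _) good_zero
  have hmax : ¬ Good (n + 1) := fun h => by
    have := Nat.le_findGreatest (bound _ h) h
    omega
  obtain ⟨f, μ, hf, hμ, htri, hmem⟩ := hgood
  have hle : ∀ l ∈ s, T.maxGenEigenspace l ≤ Submodule.span K (Set.range f) := by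
    intro l hl
    by_contra hcon
    obtain ⟨w, hw, hwW, hTw⟩ := exists_mem_maxGenEigenspace_notMem_sub_mem T l _ hcon
    refine hmax ⟨Fin.snoc f w, Fin.snoc μ l, linearIndependent_finSnoc.2 ⟨hf, hwW⟩, ?_, ?_, ?_⟩
    · refine Fin.lastCases ?_ fun j => ?_
      · simpa using hl
      · simpa using hμ j
    · refine Fin.lastCases ?_ fun j => ?_
      · simp only [Fin.snoc_last]
        refine Submodule.span_mono ?_ hTw
        rintro _ ⟨i, rfl⟩
        exact ⟨i.castSucc, Fin.castSucc_lt_last i, by simp⟩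
      · simp only [Fin.snoc_castSucc]
        refine Submodule.span_mono ?_ (htri j)
        rintro _ ⟨i, hi, rfl⟩
        exact ⟨i.castSucc, by simpa using hi, by simp⟩
    · refine Fin.lastCases ?_ fun j => ?_
      · simpa using hw
      · simpa using hmem j
  refine ⟨n, f, μ, hf, hμ, htri, fun l hl => ?_⟩
  have hsub : T.maxGenEigenspace l ≤ Submodule.span K (f '' {j | μ j = l}) := by
    intro v hv
    have h1 : Set.range f = f '' {j | μ j = l} ∪ f '' {j | μ j ≠ l} := by
      rw [← Set.image_union, ← Set.image_univ]
      congr 1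
      ext j
      simp [em]
    have h2 := hle l hl hv
    rw [h1, Submodule.span_union] at h2
    obtain ⟨a, ha, b, hb, rfl⟩ := Submodule.mem_sup.1 h2
    have ha' : a ∈ T.maxGenEigenspace l := by
      refine Submodule.span_le.2 ?_ ha
      rintro _ ⟨j, hj, rfl⟩
      exact hj ▸ hmem j
    have hb' : b ∈ T.maxGenEigenspace l := by simpa using Submodule.sub_mem _ hv ha'
    have hb'' : b ∈ ⨆ (m) (_ : m ≠ l), T.maxGenEigenspace m := by
      refine Submodule.span_le.2 ?_ hb
      rintro _ ⟨j, hj, rfl⟩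
      exact le_iSup₂ (f := fun m (_ : m ≠ l) => T.maxGenEigenspace m) (μ j) hj (hmem j)
    have hb0 : b = 0 :=
      Submodule.disjoint_def.1 (T.independent_maxGenEigenspace l) b hb' hb''
    simpa [hb0] using ha
  have hco : f '' {j | μ j = l} = ((Finset.univ.filter fun j => μ j = l).image f : Finset V) := by
    simp
  rw [hco] at hsub
  exact (Submodule.finrank_mono hsub).trans
    ((finrank_span_finset_le_card _).trans Finset.card_image_le)

/-- Hölder's inequality for finitely many factors. -/
lemma sum_prod_rpow_le_prod_rpow {ι κ : Type*} (s : Finset ι) (t : Finset κ) (w S : κ → ℝ)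
    (F : κ → ι → ℝ) (hw : ∀ k ∈ t, 0 ≤ w k) (hw1 : ∑ k ∈ t, w k = 1)
    (hF : ∀ k ∈ t, ∀ j ∈ s, 0 ≤ F k j) (hS : ∀ k ∈ t, 0 < S k)
    (hFS : ∀ k ∈ t, ∑ j ∈ s, F k j ≤ S k) :
    ∑ j ∈ s, ∏ k ∈ t, F k j ^ w k ≤ ∏ k ∈ t, S k ^ w k := by
  have hpos : 0 < ∏ k ∈ t, S k ^ w k := Finset.prod_pos fun k hk => rpow_pos_of_pos (hS k hk) _
  rw [← div_le_one hpos, Finset.sum_div]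
  calc ∑ j ∈ s, (∏ k ∈ t, F k j ^ w k) / ∏ k ∈ t, S k ^ w k
      = ∑ j ∈ s, ∏ k ∈ t, (F k j / S k) ^ w k := by
        refine Finset.sum_congr rfl fun j hj => ?_
        rw [← Finset.prod_div_distrib]
        exact Finset.prod_congr rfl fun k hk =>
          (div_rpow (hF k hk j hj) (hS k hk).le _).symm
    _ ≤ ∑ j ∈ s, ∑ k ∈ t, w k * (F k j / S k) :=
        Finset.sum_le_sum fun j hj => geom_mean_le_arith_mean_weighted t w _ hw hw1
          fun k hk => div_nonneg (hF k hk j hj) (hS k hk).le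
    _ = ∑ k ∈ t, w k * ((∑ j ∈ s, F k j) / S k) := by
        rw [Finset.sum_comm]
        simp_rw [Finset.sum_div, Finset.mul_sum]
    _ ≤ ∑ k ∈ t, w k := Finset.sum_le_sum fun k hk =>
        mul_le_of_le_one_right (hw k hk) ((div_le_one (hS k hk)).2 (hFS k hk))
    _ = 1 := hw1

/-- Jensen's inequality for the power `θ ∈ [0, 1]` and a countable probability vector. -/
lemma tsum_mul_rpow_le_rpow_tsum {ι : Type*} {p b : ι → ℝ} (hp : ∀ i, 0 ≤ p i)
    (hp1 : HasSum p 1) (hb : ∀ i, 0 ≤ b i) (hpb : Summable fun i => p i * b i)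
    {θ : ℝ} (hθ0 : 0 ≤ θ) (hθ1 : θ ≤ 1) :
    (Summable fun i => p i * b i ^ θ) ∧ ∑' i, p i * b i ^ θ ≤ (∑' i, p i * b i) ^ θ := by
  have young : ∀ t : ℝ, 0 < t → ∀ i, p i * b i ^ θ ≤ t ^ θ * (θ / t * (p i * b i) + (1 - θ) * p i) := by
    intro t ht i
    have h1 : (b i / t) ^ θ ≤ 1 + θ * (b i / t - 1) := by
      have hb' : 0 ≤ b i / t := div_nonneg (hb i) ht.le
      have := rpow_one_add_le_one_add_mul_self (s := b i / t - 1) (by linarith) hθ0 hθ1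
      simpa using this
    have h2 : b i ^ θ = t ^ θ * (b i / t) ^ θ := by
      rw [← mul_rpow ht.le (div_nonneg (hb i) ht.le), mul_div_cancel₀ _ ht.ne']
    calc p i * b i ^ θ = p i * t ^ θ * (b i / t) ^ θ := by rw [h2]; ring
      _ ≤ p i * t ^ θ * (1 + θ * (b i / t - 1)) :=
        mul_le_mul_of_nonneg_left h1 (mul_nonneg (hp i) (rpow_nonneg ht.le _))
      _ = _ := by ring
  have hsum : ∀ t : ℝ, HasSum (fun i => t ^ θ * (θ / t * (p i * b i) + (1 - θ) * p i))
      (t ^ θ * (θ / t * (∑' i, p i * b i) + (1 - θ) * 1)) := fun t =>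
    ((hpb.hasSum.mul_left _).add (hp1.mul_left _)).mul_left _
  have hnn : ∀ i, 0 ≤ p i * b i ^ θ := fun i => mul_nonneg (hp i) (rpow_nonneg (hb i) _)
  have hs : Summable fun i => p i * b i ^ θ :=
    Summable.of_nonneg_of_le hnn (young 1 one_pos) (hsum 1).summable
  refine ⟨hs, ?_⟩
  have hG : 0 ≤ ∑' i, p i * b i := tsum_nonneg fun i => mul_nonneg (hp i) (hb i)
  rcases hG.eq_or_lt with h0 | hpos
  · have hz : ∀ i, p i * b i = 0 := fun i =>
      congrFun ((hasSum_zero_iff_of_nonneg fun i => mul_nonneg (hp i) (hb i)).1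
        (h0 ▸ hpb.hasSum)) i
    rcases hθ0.eq_or_lt with rfl | hθ
    · simp [hp1.tsum_eq]
    · have : ∀ i, p i * b i ^ θ = 0 := fun i => by
        rcases mul_eq_zero.1 (hz i) with h | h
        · simp [h]
        · simp [h, Real.zero_rpow hθ.ne']
      simp only [this, tsum_zero]
      exact rpow_nonneg hG _
  · refine (hs.tsum_le_tsum (young _ hpos) (hsum _).summable).trans ?_
    rw [(hsum _).tsum_eq, div_mul_cancel₀ _ hpos.ne']
    simp

/-- Gram–Schmidt orthonormalisation for the inner product pulled back along a linear map. -/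
lemma exists_orthonormal_comp_of_map_ne_zero {V H : Type*} [AddCommGroup V] [Module ℂ V]
    [NormedAddCommGroup H] [InnerProductSpace ℂ H] (Φ : V →ₗ[ℂ] H) {n : ℕ} (f : Fin n → V)
    (h : ∀ j, ∀ u ∈ Submodule.span ℂ (f '' Set.Iio j), Φ (f j - u) ≠ 0) :
    ∃ (g : Fin n → V) (c : Fin n → ℝ), (∀ j, 0 < c j) ∧ Orthonormal ℂ (fun j => Φ (g j)) ∧
      (∀ j, g j - (c j : ℂ) • f j ∈ Submodule.span ℂ (f '' Set.Iio j)) ∧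
      (∀ j, ∀ u ∈ Submodule.span ℂ (f '' Set.Iio j), inner ℂ (Φ (g j)) (Φ u) = 0) ∧
      ∀ j, inner ℂ (Φ (g j)) (Φ (f j)) = ((c j)⁻¹ : ℝ) := by
  set G := InnerProductSpace.gramSchmidt ℂ (fun j => Φ (f j)) with hGdef
  have hspan : ∀ j, Submodule.span ℂ (G '' Set.Iio j) =
      (Submodule.span ℂ (f '' Set.Iio j)).map Φ := fun j => by
    rw [hGdef, InnerProductSpace.span_gramSchmidt_Iio, Submodule.map_span, Set.image_image]
  have hex : ∀ j, ∃ u ∈ Submodule.span ℂ (f '' Set.Iio j), G j = Φ (f j - u) := by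
    intro j
    have h1 : Φ (f j) - G j ∈ (Submodule.span ℂ (f '' Set.Iio j)).map Φ := by
      rw [← hspan, hGdef, InnerProductSpace.gramSchmidt_def ℂ _ j, _root_.sub_sub_cancel]
      refine Submodule.sum_mem _ fun i hi => ?_
      have := Submodule.starProjection_apply_mem
        (Submodule.span ℂ {InnerProductSpace.gramSchmidt ℂ (fun j => Φ (f j)) i}) (Φ (f j))
      refine Submodule.span_mono ?_ this
      rw [Set.singleton_subset_iff]
      exact ⟨i, by simpa using hi, rfl⟩
    obtain ⟨u, hu, huj⟩ := h1
    exact ⟨u, hu, by rw [map_sub, huj, _root_.sub_sub_cancel]⟩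
  choose u hu huG using hex
  have hG0 : ∀ j, G j ≠ 0 := fun j => by rw [huG]; exact h j _ (hu j)
  have hGc : ∀ j, (‖G j‖ : ℂ) ≠ 0 := fun j => by simpa using hG0 j
  have hΦ : ∀ j, Φ (((‖G j‖⁻¹ : ℝ) : ℂ) • (f j - u j)) = ((‖G j‖⁻¹ : ℝ) : ℂ) • G j := fun j => by
    rw [map_smul, ← huG]
  have hpair : ∀ i j, i ≠ j → inner ℂ (G i) (G j) = 0 := fun i j hij =>
    InnerProductSpace.gramSchmidt_orthogonal ℂ _ hij
  have horth : ∀ j, ∀ v ∈ Submodule.span ℂ (f '' Set.Iio j), inner ℂ (G j) (Φ v) = 0 := by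
    intro j v hv
    have h1 : Φ v ∈ Submodule.span ℂ (G '' Set.Iio j) := by
      rw [hspan]; exact Submodule.mem_map_of_mem hv
    refine Submodule.span_induction ?_ ?_ ?_ ?_ h1
    · rintro _ ⟨i, hi, rfl⟩
      exact hpair j i (ne_of_gt hi)
    · simp
    · intro x y _ _ hx hy
      rw [inner_add_right, hx, hy, add_zero]
    · intro a x _ hx
      rw [inner_smul_right, hx, mul_zero]
  refine ⟨fun j => ((‖G j‖⁻¹ : ℝ) : ℂ) • (f j - u j), fun j => ‖G j‖⁻¹,
    fun j => inv_pos.2 (norm_pos_iff.2 (hG0 j)), ?_, ?_, ?_, ?_⟩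
  · simp_rw [hΦ]
    refine ⟨fun j => ?_, fun i j hij => ?_⟩
    · rw [norm_smul]
      simp [hG0 j]
    · simp only [inner_smul_left, inner_smul_right, hpair i j hij, mul_zero]
  · intro j
    simp only [smul_sub, sub_sub_cancel_left]
    exact Submodule.neg_mem _ (Submodule.smul_mem _ _ (hu j))
  · intro j v hv
    rw [hΦ, inner_smul_left, horth j v hv, mul_zero]
  · intro j
    have h1 : Φ (f j) = G j + Φ (u j) := by rw [huG]; simp
    rw [hΦ, h1, inner_smul_left, inner_add_right, horth j _ (hu j), add_zero,
      inner_self_eq_norm_sq_to_K]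
    have := hGc j
    push_cast
    simp only [map_inv₀, Complex.conj_ofReal, Complex.coe_algebraMap, inv_inv]
    field_simp

lemma inner_map_eq_of_triangular {V H : Type*} [AddCommGroup V] [Module ℂ V]
    [NormedAddCommGroup H] [InnerProductSpace ℂ H] (Ψ : V →ₗ[ℂ] H) (L : V →ₗ[ℂ] V) {n : ℕ}
    {f g g' : Fin n → V} {c c' : Fin n → ℝ} {ν : Fin n → ℂ}
    (hg : ∀ j, g j - (c j : ℂ) • f j ∈ Submodule.span ℂ (f '' Set.Iio j))
    (hg0 : ∀ j, ∀ u ∈ Submodule.span ℂ (f '' Set.Iio j), inner ℂ (Ψ (g' j)) (Ψ u) = 0)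
    (hg1 : ∀ j, inner ℂ (Ψ (g' j)) (Ψ (f j)) = ((c' j)⁻¹ : ℝ))
    (hL : ∀ j, L (f j) - ν j • f j ∈ Submodule.span ℂ (f '' Set.Iio j)) (j : Fin n) :
    inner ℂ (Ψ (g' j)) (Ψ (L (g j))) = c j * ν j * ((c' j)⁻¹ : ℝ) := by
  have hmap : ∀ u ∈ Submodule.span ℂ (f '' Set.Iio j),
      L u ∈ Submodule.span ℂ (f '' Set.Iio j) := by
    intro u hu
    refine Submodule.span_induction ?_ (by simp) (fun x y _ _ hx hy => ?_)
      (fun a x _ hx => ?_) hu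
    · rintro _ ⟨i, hi, rfl⟩
      have h1 := Submodule.span_mono (Set.image_mono (f := f) (Set.Iio_subset_Iio (le_of_lt hi)))
        (hL i)
      have h2 : f i ∈ Submodule.span ℂ (f '' Set.Iio j) := Submodule.subset_span ⟨i, hi, rfl⟩
      simpa using Submodule.add_mem _ h1 (Submodule.smul_mem _ (ν i) h2)
    · rw [map_add]; exact Submodule.add_mem _ hx hy
    · rw [map_smul]; exact Submodule.smul_mem _ _ hx
  have hdec : L (g j) = L (g j - (c j : ℂ) • f j) + (c j : ℂ) • (L (f j) - ν j • f j) +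
      ((c j : ℂ) * ν j) • f j := by
    rw [map_sub, map_smul, smul_sub, mul_smul]
    abel
  rw [hdec, map_add, inner_add_right, hg0 j _ (Submodule.add_mem _ (hmap _ (hg j))
    (Submodule.smul_mem _ _ (hL j))), zero_add, map_smul, inner_smul_right, hg1]

/-- The map `v ↦ (wᵢ xᵢ(v))ᵢ` into `ℓ²` for functionals `xᵢ` of norm at most one and square
summable weights `wᵢ`. -/
def weightedCoord {E : Type*} [NormedAddCommGroup E] [NormedSpace ℂ E] (x : ℕ → E →L[ℂ] ℂ)
    (hx : ∀ i, ‖x i‖ ≤ 1) (w : ℕ → ℝ) (hw : Summable fun i => w i ^ 2) :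
    E →ₗ[ℂ] lp (fun _ : ℕ => ℂ) 2 where
  toFun v := ⟨fun i => w i * x i v, by
    refine memℓp_gen ?_
    refine Summable.of_nonneg_of_le (fun i => by positivity) (fun i => ?_) (hw.mul_left (‖v‖ ^ 2))
    have h1 : ‖x i v‖ ≤ ‖v‖ := ((x i).le_of_opNorm_le (hx i) v).trans_eq (one_mul _)
    have h2 : ‖x i v‖ ^ 2 ≤ ‖v‖ ^ 2 := pow_le_pow_left₀ (norm_nonneg _) h1 2
    rw [ENNReal.toReal_ofNat, Real.rpow_ofNat, norm_mul, mul_pow, Complex.norm_real,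
      Real.norm_eq_abs, sq_abs, mul_comm]
    exact mul_le_mul_of_nonneg_right h2 (sq_nonneg _)⟩
  map_add' u v := by
    ext i
    simp only [map_add, mul_add]
    rfl
  map_smul' a v := by
    ext i
    simp [mul_left_comm]

@[simp]
lemma weightedCoord_apply {E : Type*} [NormedAddCommGroup E] [NormedSpace ℂ E]
    (x : ℕ → E →L[ℂ] ℂ) (hx : ∀ i, ‖x i‖ ≤ 1) (w : ℕ → ℝ) (hw : Summable fun i => w i ^ 2)
    (v : E) (i : ℕ) : weightedCoord x hx w hw v i = w i * x i v := rfl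

lemma lp_two_hasSum_norm_sq (e : lp (fun _ : ℕ => ℂ) 2) :
    HasSum (fun i => ‖e i‖ ^ 2) (‖e‖ ^ 2) := by
  have := lp.hasSum_norm (p := 2) (by simp) e
  simpa using this

lemma sum_norm_sq_apply_le_one {ι : Type*} [Fintype ι] {e : ι → lp (fun _ : ℕ => ℂ) 2}
    (he : Orthonormal ℂ e) (i : ℕ) : ∑ j, ‖e j i‖ ^ 2 ≤ 1 := by
  have := he.sum_inner_products_le (lp.single 2 i (1 : ℂ)) (s := Finset.univ)
  simpa [lp.inner_single_right, lp.norm_single] using this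

/-- An orthonormal-diagonal estimate for the diagonal operator with symbol `b ^ θ`. -/
lemma norm_inner_le_rpow_tsum {e e' z : lp (fun _ : ℕ => ℂ) 2} (he : ‖e‖ = 1) (he' : ‖e'‖ = 1)
    {b : ℕ → ℝ} (hb : ∀ i, 0 ≤ b i)
    (hsum : Summable fun i => (‖e i‖ ^ 2 + ‖e' i‖ ^ 2) / 2 * b i) {θ : ℝ} (hθ0 : 0 ≤ θ)
    (hθ1 : θ ≤ 1) (hz : ∀ i, z i = (b i ^ θ : ℝ) * e i) :
    ‖inner ℂ e' z‖ ≤ (∑' i, (‖e i‖ ^ 2 + ‖e' i‖ ^ 2) / 2 * b i) ^ θ := by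
  have hp1 : HasSum (fun i => (‖e i‖ ^ 2 + ‖e' i‖ ^ 2) / 2) 1 := by
    have := ((lp_two_hasSum_norm_sq e).add (lp_two_hasSum_norm_sq e')).div_const 2
    rw [he, he'] at this
    norm_num at this
    exact this
  obtain ⟨hs, hle⟩ := tsum_mul_rpow_le_rpow_tsum (fun i => by positivity) hp1 hb hsum hθ0 hθ1
  refine le_trans ?_ hle
  rw [lp.inner_eq_tsum]
  refine tsum_of_norm_bounded hs.hasSum fun i => ?_
  have hbi := rpow_nonneg (hb i) θ
  rw [hz, RCLike.inner_apply, norm_mul, norm_mul, RCLike.norm_conj, Complex.norm_real,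
    Real.norm_of_nonneg hbi]
  nlinarith [sq_nonneg (‖e i‖ - ‖e' i‖)]

/-- A triangular family for a nuclear operator with coefficients `b * (b ^ θ) ^ k` yields
the corresponding power-sum bound for its diagonal. -/
lemma sum_norm_rpow_le_of_triangular {E : Type*} [NormedAddCommGroup E] [NormedSpace ℂ E]
    (T : E →L[ℂ] E) {b : ℕ → ℝ} (hb : ∀ i, 0 ≤ b i) (hbs : Summable b) {x : ℕ → E →L[ℂ] ℂ}
    (hx : ∀ i, ‖x i‖ ≤ 1) {y : ℕ → E} (hy : ∀ i, ‖y i‖ ≤ 1) {θ : ℝ} (hθ0 : 0 ≤ θ) (hθ1 : θ ≤ 1)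
    {k : ℕ} (hT : ∀ v, HasSum (fun m => (((b m * (b m ^ θ) ^ k : ℝ) : ℂ) * x m v) • y m) (T v))
    {s : ℝ} (hs : 0 < s) (hsk : k * (θ * s) + s / 2 = 1)
    {n : ℕ} {f : Fin n → E} {μ : Fin n → ℂ} (hf : LinearIndependent ℂ f) (hμ : ∀ j, μ j ≠ 0)
    (htri : ∀ j, T (f j) - μ j • f j ∈ Submodule.span ℂ (f '' Set.Iio j)) :
    ∑ j, ‖μ j‖ ^ s ≤ (∑' i, b i) ^ (s * (1 + θ * k)) := by
  set S := ∑' i, b i with hS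
  have hbS : ∀ i, b i ≤ S := fun i => hbs.le_tsum i fun j _ => hb j
  have hS0 : 0 ≤ S := tsum_nonneg hb
  have hδ0 : ∀ i, 0 ≤ b i ^ θ := fun i => rpow_nonneg (hb i) θ
  let w : ℕ → ℕ → ℝ := fun l i => √(b i) * (b i ^ θ) ^ l
  have hw : ∀ l, Summable fun i => w l i ^ 2 := by
    intro l
    refine Summable.of_nonneg_of_le (fun i => sq_nonneg _) (fun i => ?_)
      (hbs.mul_right (((S ^ θ) ^ l) ^ 2))
    simp only [w, mul_pow, Real.sq_sqrt (hb i)]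
    have := rpow_le_rpow (hb i) (hbS i) hθ0
    have := hδ0 i
    have := hb i
    gcongr
  let Φ : ℕ → E →ₗ[ℂ] lp (fun _ : ℕ => ℂ) 2 := fun l => weightedCoord x hx (w l) (hw l)
  have hΦ : ∀ l v i, Φ l v i = ((√(b i) * (b i ^ θ) ^ l : ℝ) : ℂ) * x i v := fun l v i =>
    weightedCoord_apply x hx (w l) (hw l) v i
  have hΦsucc : ∀ l v i, Φ (l + 1) v i = (b i ^ θ : ℝ) * Φ l v i := fun l v i => by
    simp only [hΦ, pow_succ]
    push_cast
    ring
  have hker : ∀ l ≤ k, ∀ v, Φ l v = 0 → T v = 0 := by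
    intro l hl v hv
    refine (hT v).unique ?_
    convert hasSum_zero with m
    have h0 : Φ l v m = 0 := by rw [hv]; rfl
    have h1 : b m * (b m ^ θ) ^ k = √(b m) * (b m ^ θ) ^ (k - l) * (√(b m) * (b m ^ θ) ^ l) := by
      nth_rw 1 [← Real.mul_self_sqrt (hb m), ← Nat.sub_add_cancel hl, pow_add]
      ring
    rw [h1, Complex.ofReal_mul, mul_assoc, ← hΦ, h0, mul_zero, zero_smul]
  have hne : ∀ l ≤ k, ∀ j, ∀ u ∈ Submodule.span ℂ (f '' Set.Iio j), Φ l (f j - u) ≠ 0 := by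
    intro l hl j u hu h0
    have hT0 := hker l hl _ h0
    have hTu : T u ∈ Submodule.span ℂ (f '' Set.Iio j) := by
      refine Submodule.span_induction ?_ (by simp) (fun x y _ _ hx hy => ?_)
        (fun a x _ hx => ?_) hu
      · rintro _ ⟨i, hi, rfl⟩
        have h1 := Submodule.span_mono
          (Set.image_mono (f := f) (Set.Iio_subset_Iio (le_of_lt hi))) (htri i)
        have h2 : f i ∈ Submodule.span ℂ (f '' Set.Iio j) := Submodule.subset_span ⟨i, hi, rfl⟩
        simpa using Submodule.add_mem _ h1 (Submodule.smul_mem _ (μ i) h2)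
      · rw [map_add]; exact Submodule.add_mem _ hx hy
      · rw [map_smul]; exact Submodule.smul_mem _ _ hx
    have hTf : T (f j) ∈ Submodule.span ℂ (f '' Set.Iio j) := by
      rw [map_sub, sub_eq_zero] at hT0
      rwa [hT0]
    have h1 : μ j • f j ∈ Submodule.span ℂ (f '' Set.Iio j) := by
      simpa using Submodule.sub_mem _ hTf (htri j)
    have h2 := (Submodule.smul_mem_iff _ (hμ j)).1 h1
    exact hf.notMem_span_image (lt_irrefl j) h2
  choose! g c hc hon hgf hg0 hg1 using fun l (hl : l ≤ k) =>
    exists_orthonormal_comp_of_map_ne_zero (Φ l) f (hne l hl)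
  let G : ℕ → Fin n → ℝ := fun l j => ∑' i, (‖Φ l (g l j) i‖ ^ 2 +
      ‖Φ (l + 1) (g (l + 1) j) i‖ ^ 2) / 2 * b i
  let h : Fin n → ℂ := fun j => inner ℂ (Φ 0 (g 0 j)) (Φ 0 (T (g k j)))
  have hpb : ∀ (e : lp (fun _ : ℕ => ℂ) 2), Summable fun i => ‖e i‖ ^ 2 * b i := fun e =>
    Summable.of_nonneg_of_le (fun i => mul_nonneg (sq_nonneg _) (hb i))
      (fun i => mul_le_mul_of_nonneg_left (hbS i) (sq_nonneg _))
      ((lp_two_hasSum_norm_sq e).summable.mul_right S)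
  have hpb2 : ∀ e e' : lp (fun _ : ℕ => ℂ) 2,
      Summable fun i => (‖e i‖ ^ 2 + ‖e' i‖ ^ 2) / 2 * b i := fun e e' => by
    refine (((hpb e).add (hpb e')).div_const 2).congr fun i => ?_
    ring
  have hG0 : ∀ l j, 0 ≤ G l j := fun l j =>
    tsum_nonneg fun i => mul_nonneg (by positivity) (hb i)
  have hGS : ∀ l < k, ∑ j, G l j ≤ S := by
    intro l hl
    rw [← Summable.tsum_finsetSum fun j _ => hpb2 _ _]
    refine Summable.tsum_le_tsum (fun i => ?_) (summable_sum fun j _ => hpb2 _ _) hbs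
    rw [← Finset.sum_mul, ← Finset.sum_div, Finset.sum_add_distrib]
    refine mul_le_of_le_one_left (hb i) ?_
    have h1 := sum_norm_sq_apply_le_one (hon l hl.le) i
    have h2 := sum_norm_sq_apply_le_one (hon (l + 1) hl) i
    linarith
  -- the diagonal of the Hilbert–Schmidt factor
  have hhS : ∑ j, ‖h j‖ ^ 2 ≤ S ^ 2 := by
    have hz : ∀ i, Memℓp (fun m => ((√(b m) : ℝ) : ℂ) * (starRingEnd ℂ) (x i (y m))) 2 := by
      intro i
      refine memℓp_gen (Summable.of_nonneg_of_le (fun m => by positivity) (fun m => ?_) hbs)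
      have h1 : ‖x i (y m)‖ ≤ 1 := ((x i).le_of_opNorm_le (hx i) _).trans (by simpa using hy m)
      rw [ENNReal.toReal_ofNat, Real.rpow_ofNat, norm_mul, mul_pow, Complex.norm_real,
        Real.norm_eq_abs, sq_abs, Real.sq_sqrt (hb m), RCLike.norm_conj]
      exact mul_le_of_le_one_right (hb m) (pow_le_one₀ (norm_nonneg _) h1)
    let z : ℕ → lp (fun _ : ℕ => ℂ) 2 := fun i => ⟨_, hz i⟩
    have hzn : ∀ i, ‖z i‖ ^ 2 ≤ S := by
      intro i
      rw [← (lp_two_hasSum_norm_sq (z i)).tsum_eq]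
      refine Summable.tsum_le_tsum (fun m => ?_) (lp_two_hasSum_norm_sq (z i)).summable hbs
      have h1 : ‖x i (y m)‖ ≤ 1 := ((x i).le_of_opNorm_le (hx i) _).trans (by simpa using hy m)
      change ‖((√(b m) : ℝ) : ℂ) * (starRingEnd ℂ) (x i (y m))‖ ^ 2 ≤ _
      rw [norm_mul, mul_pow, Complex.norm_real,
        Real.norm_eq_abs, sq_abs, Real.sq_sqrt (hb m), RCLike.norm_conj]
      exact mul_le_of_le_one_right (hb m) (pow_le_one₀ (norm_nonneg _) h1)
    have hzi : ∀ i v, inner ℂ (z i) (Φ k v) = x i (T v) := by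
      intro i v
      have h1 := (x i).hasSum (hT v)
      refine HasSum.unique (f := fun m => inner ℂ (z i m) (Φ k v m)) (lp.hasSum_inner _ _) ?_
      convert! h1 using 2 with m
      change inner ℂ (((√(b m) : ℝ) : ℂ) * (starRingEnd ℂ) (x i (y m))) _ = _
      rw [hΦ, RCLike.inner_apply, map_smul, map_mul, Complex.conj_ofReal, Complex.conj_conj,
        smul_eq_mul]
      have h2 : ((√(b m) : ℝ) : ℂ) * ((√(b m) : ℝ) : ℂ) = (b m : ℂ) := by
        rw [← Complex.ofReal_mul, Real.mul_self_sqrt (hb m)]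
      push_cast
      linear_combination (((b m ^ θ : ℝ) : ℂ) ^ k * x m v * x i (y m)) * h2
    have hcoord : ∀ i, ∑ j, ‖Φ 0 (T (g k j)) i‖ ^ 2 ≤ b i * S := by
      intro i
      have h1 := (hon k le_rfl).sum_inner_products_le (z i) (s := Finset.univ)
      calc ∑ j, ‖Φ 0 (T (g k j)) i‖ ^ 2 = ∑ j, b i * ‖inner ℂ (Φ k (g k j)) (z i)‖ ^ 2 := by
            refine Finset.sum_congr rfl fun j _ => ?_
            rw [norm_inner_symm, hzi, hΦ, pow_zero, mul_one, norm_mul, mul_pow, Complex.norm_real,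
              Real.norm_eq_abs, sq_abs, Real.sq_sqrt (hb i)]
        _ = b i * ∑ j, ‖inner ℂ (Φ k (g k j)) (z i)‖ ^ 2 := by rw [Finset.mul_sum]
        _ ≤ b i * S := mul_le_mul_of_nonneg_left (h1.trans (hzn i)) (hb i)
    have hhn : ∀ j, ‖h j‖ ^ 2 ≤ ‖Φ 0 (T (g k j))‖ ^ 2 := by
      intro j
      refine pow_le_pow_left₀ (norm_nonneg _) ?_ 2
      refine (norm_inner_le_norm _ _).trans ?_
      rw [(hon 0 (Nat.zero_le k)).1 j, one_mul]
    calc ∑ j, ‖h j‖ ^ 2 ≤ ∑ j, ‖Φ 0 (T (g k j))‖ ^ 2 := Finset.sum_le_sum fun j _ => hhn j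
      _ = ∑' i, ∑ j, ‖Φ 0 (T (g k j)) i‖ ^ 2 :=
        (hasSum_sum fun j _ => lp_two_hasSum_norm_sq (Φ 0 (T (g k j)))).tsum_eq.symm
      _ ≤ ∑' i, b i * S := Summable.tsum_le_tsum hcoord
        (summable_sum fun j _ => (lp_two_hasSum_norm_sq _).summable) (hbs.mul_right S)
      _ = S ^ 2 := by rw [_root_.tsum_mul_right, sq]
  have hh : ∀ j, h j = c k j * μ j * ((c 0 j)⁻¹ : ℝ) :=
    inner_map_eq_of_triangular (Φ 0) (T : E →ₗ[ℂ] E) (hgf k le_rfl) (hg0 0 (Nat.zero_le k))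
      (hg1 0 (Nat.zero_le k)) htri
  have hρ : ∀ l < k, ∀ j, c l j / c (l + 1) j ≤ G l j ^ θ := by
    intro l hl j
    have h1 := inner_map_eq_of_triangular (Φ (l + 1)) LinearMap.id (ν := fun _ => 1)
      (hgf l hl.le) (hg0 (l + 1) hl) (hg1 (l + 1) hl) (fun j => by simp) j
    have h2 := norm_inner_le_rpow_tsum ((hon l hl.le).1 j) ((hon (l + 1) hl).1 j) hb
      (hpb2 _ _) hθ0 hθ1 (hΦsucc l (g l j))
    rw [LinearMap.id_apply] at h1
    rw [h1, mul_one, ← Complex.ofReal_mul, Complex.norm_real, ← div_eq_mul_inv,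
      Real.norm_of_nonneg (div_nonneg (hc l hl.le j).le (hc (l + 1) hl j).le)] at h2
    exact h2
  have hμle : ∀ j, ‖μ j‖ ≤ ‖h j‖ * ∏ l ∈ Finset.range k, G l j ^ θ := by
    intro j
    have hck := hc k le_rfl j
    have hc0 := hc 0 (Nat.zero_le k) j
    have htel : ∏ l ∈ Finset.range k, c l j / c (l + 1) j = c 0 j / c k j := by
      have aux : ∀ m ≤ k, ∏ l ∈ Finset.range m, c l j / c (l + 1) j = c 0 j / c m j := by
        intro m
        induction m with
        | zero => intro _; simp [hc0.ne']
        | succ m ih =>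
          intro hm
          have := (hc m (by omega) j).ne'
          rw [Finset.prod_range_succ, ih (by omega)]
          field_simp
      exact aux k le_rfl
    have h1 : ‖μ j‖ = ‖h j‖ * ∏ l ∈ Finset.range k, c l j / c (l + 1) j := by
      rw [hh, htel, norm_mul, norm_mul, Complex.norm_real, Complex.norm_real,
        Real.norm_of_nonneg hck.le, Real.norm_of_nonneg (inv_pos.2 hc0).le]
      field_simp
    rw [h1]
    refine mul_le_mul_of_nonneg_left (Finset.prod_le_prod (fun l hl => ?_) fun l hl => ?_)
      (norm_nonneg _)
    · have hl := Finset.mem_range.1 hl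
      exact div_nonneg (hc l hl.le j).le (hc (l + 1) hl j).le
    · exact hρ l (Finset.mem_range.1 hl) j
  rcases hS0.eq_or_lt with hS' | hSpos
  · have hh0 : ∀ j, h j = 0 := by
      intro j
      have h1 : ‖h j‖ ^ 2 ≤ 0 := by
        refine (Finset.single_le_sum (f := fun j => ‖h j‖ ^ 2) (fun j _ => sq_nonneg _)
          (Finset.mem_univ j)).trans (hhS.trans_eq ?_)
        rw [← hS']; norm_num
      simpa using h1.antisymm (sq_nonneg _)
    have : ∑ j, ‖μ j‖ ^ s = 0 := Finset.sum_eq_zero fun j _ => by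
      have := hμle j
      rw [hh0, norm_zero, zero_mul] at this
      exact absurd (norm_le_zero_iff.1 this) (hμ j)
    rw [this]
    exact rpow_nonneg hS0 _
  · have key := sum_prod_rpow_le_prod_rpow Finset.univ (Finset.range (k + 1))
      (fun l => if l < k then θ * s else s / 2) (fun l => if l < k then S else S ^ 2)
      (fun l j => if l < k then G l j else ‖h j‖ ^ 2) ?_ ?_ ?_ ?_ ?_
    · refine le_trans (Finset.sum_le_sum fun j _ => ?_) (key.trans_eq ?_)
      · rw [Finset.prod_range_succ]
        simp only [lt_irrefl, if_false]
        have h1 : ∏ l ∈ Finset.range k, (if l < k then G l j else ‖h j‖ ^ 2) ^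
            (if l < k then θ * s else s / 2) = (∏ l ∈ Finset.range k, G l j ^ θ) ^ s := by
          rw [← Real.finsetProd_rpow _ _ fun l _ => rpow_nonneg (hG0 l j) _]
          refine Finset.prod_congr rfl fun l hl => ?_
          rw [if_pos (Finset.mem_range.1 hl), if_pos (Finset.mem_range.1 hl),
            Real.rpow_mul (hG0 l j)]
        have h2 : (‖h j‖ ^ 2) ^ (s / 2) = ‖h j‖ ^ s := by
          rw [← Real.rpow_natCast, ← Real.rpow_mul (norm_nonneg _)]
          congr 1
          push_cast
          ring
        rw [h1, h2, mul_comm, ← Real.mul_rpow (norm_nonneg _)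
          (Finset.prod_nonneg fun l _ => rpow_nonneg (hG0 l j) _)]
        exact rpow_le_rpow (norm_nonneg _) (hμle j) hs.le
      · rw [Finset.prod_range_succ]
        simp only [lt_irrefl, if_false]
        have h1 : ∏ l ∈ Finset.range k, (if l < k then S else S ^ 2) ^
            (if l < k then θ * s else s / 2) = (S ^ (θ * s)) ^ k := by
          rw [Finset.prod_congr rfl fun l hl => by
            rw [if_pos (Finset.mem_range.1 hl), if_pos (Finset.mem_range.1 hl)]]
          simp
        rw [h1, ← Real.rpow_natCast, ← Real.rpow_natCast, ← Real.rpow_mul hS0,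
          ← Real.rpow_mul hS0, ← Real.rpow_add hSpos]
        congr 1
        push_cast
        ring
    · intro l _
      split_ifs <;> positivity
    · rw [Finset.sum_range_succ, Finset.sum_congr rfl fun l hl => by
        rw [if_pos (Finset.mem_range.1 hl)]]
      simpa using hsk
    · intro l _ j _
      split_ifs
      · exact hG0 l j
      · positivity
    · intro l _
      split_ifs <;> positivity
    · intro l _
      split_ifs with hl
      · exact hGS l hl
      · exact hhS

lemma algMult_eq_finrank_maxGenEigenspace {E : Type*} [NormedAddCommGroup E] [NormedSpace ℂ E]
    (T : E →L[ℂ] E) (l : ℂ) :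
    algMult T l = Module.finrank ℂ (Module.End.maxGenEigenspace (T : E →ₗ[ℂ] E) l) := by
  have : (⨆ j : ℕ, LinearMap.ker (((T : E →ₗ[ℂ] E) - l • (1 : E →ₗ[ℂ] E)) ^ (j + 1))) =
      Module.End.maxGenEigenspace (T : E →ₗ[ℂ] E) l := by
    refine le_antisymm (iSup_le fun j v hv => ?_) fun v hv => ?_
    · exact (Module.End.mem_maxGenEigenspace _ _ _).2 ⟨j + 1, hv⟩
    · obtain ⟨k, hk⟩ := (Module.End.mem_maxGenEigenspace _ _ _).1 hv
      refine Submodule.mem_iSup_of_mem k ?_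
      rw [LinearMap.mem_ker, pow_succ', Module.End.mul_apply, hk, map_zero]
  rw [algMult, this]

/-- The power sum of finitely many eigenvalues is controlled by any `r`-nuclear representation. -/
lemma sum_algMult_mul_rpow_le {E : Type*} [NormedAddCommGroup E] [NormedSpace ℂ E]
    {r : ℝ} (hr0 : 0 < r) (hr1 : r ≤ 1) (T : E →L[ℂ] E) (x' : ℕ → E →L[ℂ] ℂ) (y : ℕ → E)
    (hT : ∀ v, HasSum (fun m => x' m v • y m) (T v))
    (hsum : Summable fun m => ‖x' m‖ ^ r * ‖y m‖ ^ r) (t : Finset ℂ) :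
    ∑ l ∈ t, (algMult T l : ℝ) * ‖l‖ ^ (2 * r / (2 - r)) ≤
      ((∑' m, ‖x' m‖ ^ r * ‖y m‖ ^ r) ^ (1 / r)) ^ (2 * r / (2 - r)) := by
  classical
  have h2r : 0 < 2 - r := by linarith
  set s := 2 * r / (2 - r) with hs
  have hs0 : 0 < s := by positivity
  set k : ℕ := ⌈(1 - r) / r⌉₊ + 1 with hk
  have hk0 : (0 : ℝ) < k := by positivity
  set θ : ℝ := (1 - r) / r / k with hθ
  have hq : 0 ≤ (1 - r) / r := div_nonneg (by linarith) hr0.le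
  have hθ0 : 0 ≤ θ := div_nonneg hq hk0.le
  have hθ1 : θ ≤ 1 := by
    rw [hθ, div_le_one hk0, hk]
    push_cast
    linarith [Nat.le_ceil ((1 - r) / r)]
  have hθk : θ * k = (1 - r) / r := div_mul_cancel₀ _ hk0.ne'
  have hexp : 1 + θ * k = 1 / r := by
    rw [hθk]
    field_simp
    ring
  have hsk : k * (θ * s) + s / 2 = 1 := by
    have : k * (θ * s) + s / 2 = s * ((1 - r) / r + 1 / 2) := by rw [← hθk]; ring
    rw [this, hs]
    field_simp
    ring
  set b : ℕ → ℝ := fun m => ‖x' m‖ ^ r * ‖y m‖ ^ r with hb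
  have hb0 : ∀ m, 0 ≤ b m := fun m => by positivity
  have hbr : ∀ m, b m * (b m ^ θ) ^ k = ‖x' m‖ * ‖y m‖ := by
    intro m
    have h1 : b m * (b m ^ θ) ^ k = b m ^ (1 / r) := by
      rcases (hb0 m).eq_or_lt with h | h
      · rw [← h, Real.zero_rpow (one_div_pos.2 hr0).ne', zero_mul]
      · rw [← hexp, Real.rpow_add h, Real.rpow_one, ← Real.rpow_mul_natCast (hb0 m)]
    rw [h1]
    simp only [hb]
    rw [← Real.mul_rpow (norm_nonneg _) (norm_nonneg _), ← Real.rpow_mul (by positivity),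
      mul_one_div_cancel hr0.ne', Real.rpow_one]
  let x : ℕ → E →L[ℂ] ℂ := fun m => ((‖x' m‖⁻¹ : ℝ) : ℂ) • x' m
  let z : ℕ → E := fun m => ((‖y m‖⁻¹ : ℝ) : ℂ) • y m
  have hx : ∀ m, ‖x m‖ ≤ 1 := fun m => by
    simp only [x, norm_smul, Complex.norm_real, norm_inv, norm_norm]
    exact inv_mul_le_one
  have hz : ∀ m, ‖z m‖ ≤ 1 := fun m => by
    simp only [z, norm_smul, Complex.norm_real, norm_inv, norm_norm]
    exact inv_mul_le_one
  have hT' : ∀ v, HasSum (fun m => (((b m * (b m ^ θ) ^ k : ℝ) : ℂ) * x m v) • z m) (T v) := by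
    intro v
    convert! hT v using 2 with m
    rw [hbr]
    rcases eq_or_ne (x' m) 0 with h | h
    · simp [h, x]
    rcases eq_or_ne (y m) 0 with h' | h'
    · simp [h', z]
    have h1 : (‖x' m‖ : ℂ) ≠ 0 := by simpa using h
    have h2 : (‖y m‖ : ℂ) ≠ 0 := by simpa using h'
    simp only [x, z, _root_.smul_apply, smul_smul, smul_eq_mul]
    congr 1
    push_cast
    field_simp
  let t' := t.filter fun l => l ≠ 0 ∧ algMult T l ≠ 0
  have hfin : ∀ l ∈ t', FiniteDimensional ℂ (Module.End.maxGenEigenspace (T : E →ₗ[ℂ] E) l) := by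
    intro l hl
    have h1 := (Finset.mem_filter.1 hl).2.2
    rw [algMult_eq_finrank_maxGenEigenspace] at h1
    exact Module.finite_of_finrank_pos (Nat.pos_of_ne_zero h1)
  obtain ⟨n, f, μ, hf, hμ, htri, hcard⟩ :=
    exists_linearIndependent_triangular (T : E →ₗ[ℂ] E) t' hfin
  have hμ0 : ∀ j, μ j ≠ 0 := fun j => (Finset.mem_filter.1 (hμ j)).2.1
  have hmain := sum_norm_rpow_le_of_triangular T hb0 hsum hx hz hθ0 hθ1 hT' hs0 hsk hf hμ0 htri
  have hred : ∑ l ∈ t, (algMult T l : ℝ) * ‖l‖ ^ s = ∑ l ∈ t', (algMult T l : ℝ) * ‖l‖ ^ s := by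
    refine (Finset.sum_filter_of_ne fun l _ hl => ⟨?_, ?_⟩).symm
    · rintro rfl
      exact hl (by rw [norm_zero, Real.zero_rpow hs0.ne', mul_zero])
    · intro h0
      exact hl (by rw [h0, Nat.cast_zero, zero_mul])
  calc ∑ l ∈ t, (algMult T l : ℝ) * ‖l‖ ^ s = ∑ l ∈ t', (algMult T l : ℝ) * ‖l‖ ^ s := hred
    _ ≤ ∑ l ∈ t', ∑ j ∈ Finset.univ.filter (fun j => μ j = l), ‖μ j‖ ^ s := by
        refine Finset.sum_le_sum fun l hl => ?_
        rw [Finset.sum_congr rfl fun j hj => by rw [(Finset.mem_filter.1 hj).2],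
          Finset.sum_const, nsmul_eq_mul, algMult_eq_finrank_maxGenEigenspace]
        exact mul_le_mul_of_nonneg_right (Nat.cast_le.2 (hcard l hl))
          (rpow_nonneg (norm_nonneg _) _)
    _ = ∑ j, ‖μ j‖ ^ s := Finset.sum_fiberwise_of_maps_to (fun j _ => hμ j) _
    _ ≤ (∑' m, b m) ^ (s * (1 + θ * k)) := hmain
    _ = ((∑' m, b m) ^ (1 / r)) ^ s := by
        rw [hexp, mul_comm, Real.rpow_mul (tsum_nonneg hb0)]

/-- **Grothendieck's eigenvalue summability for `r`-nuclear operators.** If `E` is a complex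
Banach space with the approximation property, `0 < r ≤ 1`, and `T : E → E` is `r`-nuclear, then
with `1/s = 1/r - 1/2` (i.e. `s = 2r/(2-r)`) the eigenvalues of `T`, counted with algebraic
multiplicities, satisfy `∑ₙ |λₙ(T)|^s ≤ n_r(T)^s`. -/
theorem rNuclear_eigenvalue_summability
    {E : Type*} [NormedAddCommGroup E] [NormedSpace ℂ E] [CompleteSpace E]
    (hE : HasApproxProperty E) (r : ℝ) (hr0 : 0 < r) (hr1 : r ≤ 1)
    (T : E →L[ℂ] E) (hT : IsRNuclear r T) :
    Summable (fun l : ℂ => (algMult T l : ℝ) * ‖l‖ ^ (2 * r / (2 - r))) ∧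
      ∑' l : ℂ, (algMult T l : ℝ) * ‖l‖ ^ (2 * r / (2 - r)) ≤
        nuclearQuasiNorm r T ^ (2 * r / (2 - r)) := by
  have h2r : 0 < 2 - r := by linarith
  have hs0 : 0 < 2 * r / (2 - r) := by positivity
  set s := 2 * r / (2 - r)
  have hnn : ∀ l : ℂ, 0 ≤ (algMult T l : ℝ) * ‖l‖ ^ s := fun l => by positivity
  obtain ⟨x₀, y₀, hT₀, hsum₀⟩ := hT
  have hsummable : Summable fun l : ℂ => (algMult T l : ℝ) * ‖l‖ ^ s :=
    summable_of_sum_le hnn (sum_algMult_mul_rpow_le hr0 hr1 T x₀ y₀ hT₀ hsum₀)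
  have hpos : 0 ≤ ∑' l : ℂ, (algMult T l : ℝ) * ‖l‖ ^ s := tsum_nonneg hnn
  refine ⟨hsummable, ?_⟩
  have hle : (∑' l : ℂ, (algMult T l : ℝ) * ‖l‖ ^ s) ^ (1 / s) ≤ nuclearQuasiNorm r T := by
    refine le_csInf ⟨_, x₀, y₀, hT₀, hsum₀, rfl⟩ ?_
    rintro _ ⟨x', y, hT', hsum, rfl⟩
    have hc : 0 ≤ (∑' m, ‖x' m‖ ^ r * ‖y m‖ ^ r) ^ (1 / r) :=
      rpow_nonneg (tsum_nonneg fun m => by positivity) _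
    rw [one_div s, Real.rpow_inv_le_iff_of_pos hpos hc hs0]
    exact hsummable.tsum_le_of_sum_le (sum_algMult_mul_rpow_le hr0 hr1 T x' y hT' hsum)
  have := rpow_le_rpow (rpow_nonneg hpos _) hle hs0.le
  rwa [← Real.rpow_mul hpos, one_div_mul_cancel hs0.ne', Real.rpow_one] at this
end
end

section
/- Let 0 < r ≤ 1 and let a : ℤⁿ → ℂ satisfy ∑_{k∈ℤⁿ} |a(k)|^r < ∞ (hence ∑_{k} |a(k)| < ∞, so κ(x) = ∑_{k∈ℤⁿ} a(k) e_k(x) converges absolutely and uniformly and defines a continuous function κ on 𝕋ⁿ). Then for all 1 ≤ p₁, p₂ < ∞, every bounded linear operator A : L^{p₁}(μ) → L^{p₂}(μ) satisfying, for all f ∈ L^{p₁}(μ), A f(x) = ∫_{𝕋ⁿ} κ(x − y) f(y) dμ(y) for μ-almost every x, is r-nuclear. -/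
open MeasureTheory ENNReal NNReal Real

noncomputable section

/-- The `n`-torus `𝕋ⁿ = (ℝ/ℤ)ⁿ`; its `volume` measure is the product of the normalized
Haar measures of the circle factors, a probability measure. -/
abbrev Torus (n : ℕ) := Fin n → AddCircle (1 : ℝ)

/-- The character `e_k(x) = ∏ i, exp(2πi k_i x_i)` on the `n`-torus. -/
noncomputable def eK {n : ℕ} (k : Fin n → ℤ) (x : Torus n) : ℂ :=
  ∏ i, (fourier (k i) : C(AddCircle (1 : ℝ), ℂ)) (x i)

/-- A summable `r`-th power with `0 < r ≤ 1` forces absolute summability. -/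
theorem summable_norm_of_summable_rpow {ι : Type*} {a : ι → ℂ} {r : ℝ} (hr0 : 0 < r)
    (hr1 : r ≤ 1) (ha : Summable fun k => ‖a k‖ ^ r) : Summable fun k => ‖a k‖ := by
  refine Summable.of_norm_bounded_eventually ha ?_
  filter_upwards [ha.tendsto_cofinite_zero.eventually_le_const one_pos] with k hk
  have h1 : ‖a k‖ ≤ 1 := by
    by_contra! h
    exact (Real.one_lt_rpow h hr0).not_ge hk
  rw [norm_norm]
  exact Real.self_le_rpow_of_le_one (norm_nonneg _) h1 hr1

theorem eK_add {n : ℕ} (k : Fin n → ℤ) (x y : Torus n) : eK k (x + y) = eK k x * eK k y := by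
  simp only [eK, ← Finset.prod_mul_distrib]
  refine Finset.prod_congr rfl fun i _ => ?_
  simp [fourier_apply, smul_add, AddCircle.toCircle_add]

theorem norm_eK {n : ℕ} (k : Fin n → ℤ) (x : Torus n) : ‖eK k x‖ = 1 := by
  simp only [eK, norm_prod, fourier_apply, Circle.norm_coe, Finset.prod_const_one]

theorem continuous_eK {n : ℕ} (k : Fin n → ℤ) : Continuous (eK k) :=
  continuous_finsetProd _ fun i _ => (fourier (k i)).continuous.comp (continuous_apply i)

/-- The character `eK k` as a bundled continuous function. -/
def characterMap {n : ℕ} (k : Fin n → ℤ) : C(Torus n, ℂ) := ⟨eK k, continuous_eK k⟩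

theorem norm_characterMap_le {n : ℕ} (k : Fin n → ℤ) : ‖characterMap k‖ ≤ 1 :=
  (ContinuousMap.norm_le _ zero_le_one).2 fun x => (norm_eK k x).le

section FiniteMeasure

variable {X : Type*} [MeasurableSpace X] {μ : Measure X} [IsFiniteMeasure μ]
  {p : ℝ≥0∞} [Fact (1 ≤ p)]

theorem Lp_integrable (f : Lp ℂ p μ) : Integrable f μ :=
  (Lp.memLp f).integrable Fact.out

variable (μ p) in
/-- On a finite measure space, the `L¹` norm is controlled by the `Lᵖ` norm. -/
theorem exists_integral_norm_le : ∃ C : ℝ, 0 ≤ C ∧ ∀ f : Lp ℂ p μ, ∫ x, ‖f x‖ ∂μ ≤ C * ‖f‖ := by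
  set c : ℝ≥0∞ := μ Set.univ ^ (1 / (1 : ℝ≥0∞).toReal - 1 / p.toReal) with hc
  have hcf : c ≠ ∞ := by
    refine ENNReal.rpow_ne_top_of_nonneg ?_ (measure_ne_top _ _)
    rcases eq_or_ne p ∞ with rfl | hp
    · simp
    · have : 1 ≤ p.toReal := by
        simpa using (ENNReal.toReal_le_toReal one_ne_top hp).2 (Fact.out : 1 ≤ p)
      simpa using inv_le_one_of_one_le₀ this
  refine ⟨c.toReal, ENNReal.toReal_nonneg, fun f => ?_⟩
  have h := eLpNorm_le_eLpNorm_mul_rpow_measure_univ (μ := μ) (Fact.out : 1 ≤ p)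
    (Lp.aestronglyMeasurable f)
  rw [integral_norm_eq_lintegral_enorm (Lp.aestronglyMeasurable f), ← eLpNorm_one_eq_lintegral_enorm,
    Lp.norm_def, ← ENNReal.toReal_mul, mul_comm c]
  exact ENNReal.toReal_mono (ENNReal.mul_ne_top (Lp.eLpNorm_ne_top f) hcf) h

theorem integrable_mul_Lp {g : X → ℂ} (hg : AEStronglyMeasurable g μ) (hb : ∀ x, ‖g x‖ ≤ 1)
    (f : Lp ℂ p μ) : Integrable (fun x => g x * f x) μ :=
  (Lp_integrable f).bdd_mul hg (Filter.Eventually.of_forall hb)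

/-- Integration against a function bounded by `1` is a functional on `Lᵖ`, of norm bounded
independently of the function. -/
theorem exists_integral_functional {C : ℝ} (hC : 0 ≤ C)
    (hCf : ∀ f : Lp ℂ p μ, ∫ x, ‖f x‖ ∂μ ≤ C * ‖f‖) {g : X → ℂ}
    (hg : AEStronglyMeasurable g μ) (hb : ∀ x, ‖g x‖ ≤ 1) :
    ∃ φ : Lp ℂ p μ →L[ℂ] ℂ, (∀ f, φ f = ∫ x, g x * f x ∂μ) ∧ ‖φ‖ ≤ C := by
  let L : Lp ℂ p μ →ₗ[ℂ] ℂ :=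
    { toFun := fun f => ∫ x, g x * f x ∂μ
      map_add' := fun f h => by
        rw [← integral_add (integrable_mul_Lp hg hb f) (integrable_mul_Lp hg hb h)]
        refine integral_congr_ae ?_
        filter_upwards [Lp.coeFn_add f h] with x hx
        rw [hx, Pi.add_apply, mul_add]
      map_smul' := fun c f => by
        rw [RingHom.id_apply, smul_eq_mul, ← integral_const_mul]
        refine integral_congr_ae ?_
        filter_upwards [Lp.coeFn_smul c f] with x hx
        simp only [hx, Pi.smul_apply, smul_eq_mul]
        ring }
  refine ⟨L.mkContinuous C fun f => ?_, fun f => rfl, L.mkContinuous_norm_le hC _⟩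
  refine (norm_integral_le_of_norm_le (Lp_integrable f).norm ?_).trans (hCf f)
  refine Filter.Eventually.of_forall fun x => ?_
  rw [norm_mul]
  exact mul_le_of_le_one_left (norm_nonneg _) (hb x)

end FiniteMeasure

/-- Expansion of the convolution with an absolutely convergent trigonometric series. -/
theorem hasSum_convolution {n : ℕ} {a : (Fin n → ℤ) → ℂ} (ha : Summable fun k => ‖a k‖)
    {f : Torus n → ℂ} (hf : Integrable f volume) (x : Torus n) :
    HasSum (fun k => a k * (∫ y, eK k (-y) * f y) * eK k x)
      (∫ y, (∑' k : Fin n → ℤ, a k * eK k (x - y)) * f y) := by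
  have hint : ∀ k, Integrable (fun y => a k * eK k (x - y) * f y) volume := fun k =>
    hf.bdd_mul (c := ‖a k‖)
      (continuous_const.mul ((continuous_eK k).comp (continuous_const.sub continuous_id))
        ).aestronglyMeasurable
      (Filter.Eventually.of_forall fun y => by simp [norm_eK])
  have hsum : Summable fun k => ∫ y, ‖a k * eK k (x - y) * f y‖ := by
    simp only [norm_mul, norm_eK, mul_one, integral_const_mul]
    exact ha.mul_right _
  have h := hasSum_integral_of_summable_integral_norm hint hsum
  have hmul : ∀ y, ∑' k, a k * eK k (x - y) * f y = (∑' k, a k * eK k (x - y)) * f y :=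
    fun y => tsum_mul_right
  simp only [hmul] at h
  refine (funext fun k => ?_ : (fun k => a k * (∫ y, eK k (-y) * f y) * eK k x) = _) ▸ h
  rw [mul_right_comm, ← integral_const_mul]
  refine integral_congr_ae (Filter.Eventually.of_forall fun y => ?_)
  simp only [sub_eq_add_neg, eK_add]
  ring

/-- **`r`-nuclearity of convolution operators on the torus.** Let `0 < r ≤ 1` and
`a : ℤⁿ → ℂ` with `∑_k |a(k)|^r < ∞`, and let `κ(x) = ∑_k a(k) e_k(x)`. Then for all
`1 ≤ p₁, p₂ < ∞`, every bounded operator `A : L^{p₁}(μ) → L^{p₂}(μ)` satisfying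
`A f (x) = ∫ κ(x - y) f(y) dμ(y)` a.e. is `r`-nuclear. -/
theorem convolution_rNuclear (n : ℕ) (hn : 1 ≤ n)
    (r : ℝ) (hr0 : 0 < r) (hr1 : r ≤ 1)
    (a : (Fin n → ℤ) → ℂ) (ha : Summable fun k => ‖a k‖ ^ r) :
    ∀ (p₁ p₂ : ℝ≥0∞) [Fact (1 ≤ p₁)] [Fact (1 ≤ p₂)], p₁ ≠ ∞ → p₂ ≠ ∞ →
      ∀ A : Lp ℂ p₁ (volume : Measure (Torus n)) →L[ℂ]
            Lp ℂ p₂ (volume : Measure (Torus n)),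
        (∀ f : Lp ℂ p₁ (volume : Measure (Torus n)),
          ∀ᵐ x ∂(volume : Measure (Torus n)),
            A f x = ∫ y, (∑' k : Fin n → ℤ, a k * eK k (x - y)) * f y ∂volume) →
        IsRNuclear r A := by
  intro p₁ p₂ _ _ _ _ A hA
  have ha1 := summable_norm_of_summable_rpow hr0 hr1 ha
  obtain ⟨C, hC, hCf⟩ := exists_integral_norm_le (volume : Measure (Torus n)) p₁
  choose φ hφ hφC using fun k : Fin n → ℤ =>
    exists_integral_functional hC hCf (g := fun y => eK k (-y))
      ((continuous_eK k).comp continuous_neg).aestronglyMeasurable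
      (fun y => (norm_eK k (-y)).le)
  let J := ContinuousMap.toLp (E := ℂ) p₂ (volume : Measure (Torus n)) ℂ
  have hJ : ∀ k : Fin n → ℤ, ‖J (characterMap k)‖ ≤ ‖J‖ := fun k =>
    J.le_of_opNorm_le_of_le le_rfl (norm_characterMap_le k) |>.trans (mul_one _).le
  have hA' : ∀ f, HasSum (fun k => (a k • φ k) f • J (characterMap k)) (A f) := by
    intro f
    have hs : Summable fun k => (a k • φ k) f • characterMap k := by
      refine Summable.of_norm_bounded (ha1.mul_right (C * ‖f‖)) fun k => ?_
      rw [norm_smul, smul_apply, norm_smul]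
      calc ‖a k‖ * ‖φ k f‖ * ‖characterMap k‖ ≤ ‖a k‖ * ‖φ k f‖ * 1 := by
            gcongr
            exact norm_characterMap_le k
        _ ≤ ‖a k‖ * (C * ‖f‖) := by
            rw [mul_one]
            gcongr
            exact (φ k).le_of_opNorm_le (hφC k) f
    obtain ⟨G, hG⟩ := hs
    have hAG : A f = J G := by
      refine Lp.ext ?_
      filter_upwards [hA f, ContinuousMap.coeFn_toLp (p := p₂) (𝕜 := ℂ) volume G] with x hx hGx
      rw [hx, hGx]
      refine (hasSum_convolution ha1 (Lp_integrable f) x).unique ?_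
      convert ContinuousMap.hasSum_apply hG x using 2 with k
      simp [hφ, characterMap]
    rw [hAG]
    simpa using hG.mapL J
  have : Nonempty (Fin n) := ⟨⟨0, hn⟩⟩
  obtain ⟨e⟩ : Nonempty (ℕ ≃ (Fin n → ℤ)) := nonempty_equiv_of_countable
  refine ⟨fun m => a (e m) • φ (e m), fun m => J (characterMap (e m)),
    fun f => (e.hasSum_iff (f := fun k => (a k • φ k) f • J (characterMap k))).2 (hA' f), ?_⟩
  refine (e.summable_iff (f := fun k => ‖a k • φ k‖ ^ r * ‖J (characterMap k)‖ ^ r)).2 ?_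
  refine Summable.of_nonneg_of_le (fun k => by positivity) (fun k => ?_)
    (ha.mul_right (C ^ r * ‖J‖ ^ r))
  rw [norm_smul, Real.mul_rpow (norm_nonneg _) (norm_nonneg _), mul_assoc]
  gcongr
  · exact hφC k
  · exact hJ k
end
end

section
/- Let a : ℤⁿ → ℂ be a bounded function and let T : L²(μ) → L²(μ) be a bounded linear operator such that T [e_k] = a(k) · [e_k] for every k ∈ ℤⁿ, where [e_k] denotes the equivalence class of e_k in L²(μ), and assume the closed linear span of {[e_k] : k ∈ ℤⁿ} is all of L²(μ) (which holds by Stone–Weierstrass). Then for every 0 < r ≤ 1, the operator T is r-nuclear if and only if ∑_{k∈ℤⁿ} |a(k)|^r < ∞. -/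
open MeasureTheory ENNReal NNReal Real

noncomputable section

section HilbertSpace

variable {H ι : Type*} [NormedAddCommGroup H] [InnerProductSpace ℂ H] {e : ι → H}

/-- The trace of an orthogonal projection onto a finite-dimensional subspace is at most its
dimension. -/
lemma Orthonormal.sum_norm_starProjection_sq_le (he : Orthonormal ℂ e) (V : Submodule ℂ H)
    [FiniteDimensional ℂ V] (K : Finset ι) :
    ∑ k ∈ K, ‖V.starProjection (e k)‖ ^ 2 ≤ Module.finrank ℂ V := by
  let f := stdOrthonormalBasis ℂ V
  have hf : ∀ x : H, ‖V.starProjection x‖ ^ 2 = ∑ j, ‖inner ℂ x (f j : H)‖ ^ 2 := fun x => by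
    rw [Submodule.starProjection_apply, Submodule.norm_coe, ← f.sum_sq_norm_inner_right]
    simp only [Submodule.inner_orthogonalProjectionOnto_eq_of_mem_left, norm_inner_symm x]
  calc ∑ k ∈ K, ‖V.starProjection (e k)‖ ^ 2
      = ∑ j, ∑ k ∈ K, ‖inner ℂ (e k) (f j : H)‖ ^ 2 := by simp only [hf]; exact Finset.sum_comm
    _ ≤ ∑ j, ‖(f j : H)‖ ^ 2 := Finset.sum_le_sum fun j _ => he.sum_inner_products_le _
    _ = Module.finrank ℂ V := by simp [Submodule.norm_coe, f.orthonormal.1]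

lemma Orthonormal.sum_norm_inner_mul_norm_inner_le (he : Orthonormal ℂ e) (u y : H)
    (K : Finset ι) : ∑ k ∈ K, ‖inner ℂ u (e k)‖ * ‖inner ℂ (e k) y‖ ≤ ‖u‖ * ‖y‖ := by
  refine (Real.sum_mul_le_sqrt_mul_sqrt K _ _).trans ?_
  simp only [norm_inner_symm u]
  gcongr <;> exact Real.sqrt_le_iff.2 ⟨norm_nonneg _, he.sum_inner_products_le _⟩

/-- If `T` acts diagonally on an orthonormal family with eigenvalues `a k` and is a sum of
rank-one operators of norms `‖x' m‖ * ‖y m‖`, then the `a k` are dominated by these norms, after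
truncation at any level `s`. -/
lemma Orthonormal.sum_min_norm_le_tsum_min [CompleteSpace H] (he : Orthonormal ℂ e) {a : ι → ℂ}
    {T : H →L[ℂ] H} (hT : ∀ k v, inner ℂ (e k) (T v) = a k * inner ℂ (e k) v)
    {x' : ℕ → (H →L[ℂ] ℂ)} {y : ℕ → H}
    (hsum : ∀ v, HasSum (fun m => x' m v • y m) (T v))
    (hs : Summable fun m => ‖x' m‖ * ‖y m‖) {s : ℝ} (hs0 : 0 < s) (K : Finset ι) :
    ∑ k ∈ K, min s ‖a k‖ ≤ ∑' m, min s (‖x' m‖ * ‖y m‖) := by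
  classical
  have hfin : {m | s < ‖x' m‖ * ‖y m‖}.Finite := by
    have := hs.tendsto_cofinite_zero.eventually_le_const hs0
    simpa [Filter.eventually_cofinite] using this
  obtain ⟨S, hS⟩ := hfin.exists_finset
  simp only [Set.mem_ofPred_eq] at hS
  let u : ℕ → H := fun m => (InnerProductSpace.toDual ℂ H).symm (x' m)
  have hu : ∀ m v, inner ℂ (u m) v = x' m v := fun m v => InnerProductSpace.toDual_symm_apply
  have hun : ∀ m, ‖u m‖ = ‖x' m‖ := fun m => LinearIsometryEquiv.norm_map _ _
  let V : Submodule ℂ H := Submodule.span ℂ (S.image u : Finset H)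
  have hV : (Module.finrank ℂ V : ℝ) ≤ S.card := by
    exact_mod_cast (finrank_span_finset_le_card _).trans Finset.card_image_le
  let Q := V.starProjection
  let R := Vᗮ.starProjection
  have hR : ∀ m v, x' m (R v) = inner ℂ (R (u m)) v := fun m v => by
    rw [Submodule.inner_starProjection_left_eq_right, hu]
  have hRS : ∀ m ∈ S, R (u m) = 0 := fun m hm => by
    apply Submodule.starProjection_orthogonal_apply_eq_zero
    exact Submodule.subset_span (by simpa using ⟨m, hm, rfl⟩)
  let c : ℕ → ι → ℝ := fun m k => ‖inner ℂ (R (u m)) (e k)‖ * ‖inner ℂ (e k) (y m)‖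
  let d : ℕ → ℝ := fun m => if m ∈ S then 0 else ‖x' m‖ * ‖y m‖
  have hc : ∀ (L : Finset ι) m, ∑ k ∈ L, c m k ≤ d m := fun L m => by
    by_cases hm : m ∈ S
    · simp [c, d, hm, hRS m hm]
    · refine (he.sum_norm_inner_mul_norm_inner_le _ _ L).trans ?_
      simp only [d, hm, if_false, ← hun]
      gcongr
      exact Submodule.norm_starProjection_apply_le _ _
  have hd : Summable d := hs.of_nonneg_of_le
    (fun m => by simp only [d]; split_ifs <;> positivity)
    (fun m => by simp only [d]; split_ifs <;> [positivity; rfl])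
  have hcs : ∀ k, Summable fun m => c m k := fun k => hd.of_nonneg_of_le
    (fun m => by positivity) (fun m => by simpa using hc {k} m)
  have hk : ∀ k, min s ‖a k‖ ≤ s * ‖Q (e k)‖ ^ 2 + ∑' m, c m k := fun k => by
    have hpyth : ‖Q (e k)‖ ^ 2 + ‖R (e k)‖ ^ 2 = 1 := by
      have := V.norm_sq_eq_add_norm_sq_starProjection (e k)
      rw [he.1 k] at this
      linarith
    have hRk : ‖a k‖ * ‖R (e k)‖ ^ 2 ≤ ∑' m, c m k := by
      have hkR : ‖inner ℂ (e k) (T (R (e k)))‖ = ‖a k‖ * ‖R (e k)‖ ^ 2 := by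
        rw [hT, norm_mul]
        congr 1
        have : inner ℂ (e k) (R (e k)) = inner ℂ (R (e k)) (R (e k)) := by
          rw [Submodule.inner_starProjection_left_eq_right]
          congr 1
          exact (Submodule.starProjection_eq_self_iff.2
            (Submodule.starProjection_apply_mem _ _)).symm
        rw [this, inner_self_eq_norm_sq_to_K]
        simp
      have h := (hsum (R (e k))).mapL (innerSL ℂ (e k))
      have hn : ∀ m, ‖innerSL ℂ (e k) (x' m (R (e k)) • y m)‖ = c m k := fun m => by
        simp [c, hR]
      rw [← hkR, ← innerSL_apply_apply, ← h.tsum_eq]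
      refine (norm_tsum_le_tsum_norm ?_).trans_eq ?_ <;> simp only [hn]
      exact hcs k
    calc min s ‖a k‖ = min s ‖a k‖ * ‖Q (e k)‖ ^ 2 + min s ‖a k‖ * ‖R (e k)‖ ^ 2 := by
          rw [← mul_add, hpyth, mul_one]
      _ ≤ s * ‖Q (e k)‖ ^ 2 + ‖a k‖ * ‖R (e k)‖ ^ 2 := by
          gcongr
          · exact min_le_left _ _
          · exact min_le_right _ _
      _ ≤ _ := by gcongr
  have hSs : HasSum (fun m : ℕ => if m ∈ S then s else 0) (S.card * s) := by
    have := hasSum_sum_of_ne_finset_zero (L := .unconditional ℕ)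
      (f := fun m : ℕ => if m ∈ S then s else 0) (s := S) (fun m hm => by simp [hm])
    simpa using this
  calc ∑ k ∈ K, min s ‖a k‖ ≤ ∑ k ∈ K, (s * ‖Q (e k)‖ ^ 2 + ∑' m, c m k) :=
        Finset.sum_le_sum fun k _ => hk k
    _ = s * ∑ k ∈ K, ‖Q (e k)‖ ^ 2 + ∑' m, ∑ k ∈ K, c m k := by
        rw [Finset.sum_add_distrib, Finset.mul_sum, Summable.tsum_finsetSum fun k _ => hcs k]
    _ ≤ s * S.card + ∑' m, d m := by
        gcongr
        · exact (he.sum_norm_starProjection_sq_le V K).trans hV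
        · exact summable_sum fun k _ => hcs k
        · exact hc K _
    _ = ∑' m, min s (‖x' m‖ * ‖y m‖) := by
        rw [mul_comm, ← hSs.tsum_eq, ← hSs.summable.tsum_add hd]
        refine tsum_congr fun m => ?_
        by_cases hm : m ∈ S
        · simp [d, hm, ((hS m).1 hm).le]
        · simp [d, hm, not_lt.1 (mt (hS m).2 hm)]

/-- A diagonal operator with `r`-summable eigenvalues is `r`-nuclear. -/
lemma HilbertBasis.isRNuclear_of_summable [Denumerable ι] (b : HilbertBasis ι ℂ H) {a : ι → ℂ}
    {T : H →L[ℂ] H} (hT : ∀ k, T (b k) = a k • b k) {r : ℝ}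
    (ha : Summable fun k => ‖a k‖ ^ r) : IsRNuclear r T := by
  let φ : ℕ ≃ ι := (Denumerable.eqv ι).symm
  refine ⟨fun m => a (φ m) • innerSL ℂ (b (φ m)), fun m => b (φ m), fun v => ?_, ?_⟩
  · refine (φ.hasSum_iff (f := fun k => (a k • innerSL ℂ (b k)) v • b k)).2 ?_
    convert! (b.hasSum_repr v).mapL T using 2 with k
    simp [hT, b.repr_apply_apply, smul_smul, mul_comm]
  · simpa [norm_smul, b.orthonormal.1, Function.comp_def] using φ.summable_iff.2 ha

/-- A continuous operator acting diagonally on a Hilbert basis multiplies the coordinates. -/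
lemma HilbertBasis.inner_apply_of_diagonal (b : HilbertBasis ι ℂ H) {a : ι → ℂ}
    {T : H →L[ℂ] H} (hT : ∀ k, T (b k) = a k • b k) (k : ι) (v : H) :
    inner ℂ (b k) (T v) = a k * inner ℂ (b k) v := by
  classical
  have h : (innerSL ℂ (b k)).comp T = a k • innerSL ℂ (b k) := by
    refine ContinuousLinearMap.ext_on
      (s := Set.range b) (Submodule.dense_iff_topologicalClosure_eq_top.2 b.dense_span) ?_
    rintro _ ⟨l, rfl⟩
    by_cases hkl : k = l
    · subst hkl; simp [hT]
    · simp [hT, b.orthonormal.2 hkl]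
  simpa using DFunLike.congr_fun h v

end HilbertSpace

section Truncation

lemma lintegral_min_mul_rpow {r : ℝ} (hr0 : 0 < r) (hr1 : r < 1) {x : ℝ} (hx : 0 ≤ x) :
    ∫⁻ s in Set.Ioi (0 : ℝ), ENNReal.ofReal (min s x * s ^ (r - 2)) =
      ENNReal.ofReal (1 / r + 1 / (1 - r)) * ENNReal.ofReal (x ^ r) := by
  rcases hx.eq_or_lt with rfl | hx
  · rw [setLIntegral_congr_fun (g := fun _ => 0) measurableSet_Ioi]
    · simp [Real.zero_rpow hr0.ne']
    · intro s (hs : 0 < s)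
      simp [min_eq_right hs.le]
  have hr : 0 < 1 - r := by linarith
  rw [← Set.Ioc_union_Ioi_eq_Ioi hx.le, lintegral_union measurableSet_Ioi
    (Set.Ioc_disjoint_Ioi le_rfl)]
  have h1 : ∫⁻ s in Set.Ioc 0 x, ENNReal.ofReal (min s x * s ^ (r - 2)) =
      ENNReal.ofReal (x ^ r / r) := by
    have hval : ∫ s in Set.Ioc 0 x, s ^ (r - 1) = x ^ r / r := by
      rw [← intervalIntegral.integral_of_le hx.le, integral_rpow (Or.inl (by linarith))]
      simp [Real.zero_rpow hr0.ne']
    rw [← hval, ofReal_integral_eq_lintegral_ofReal]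
    · refine setLIntegral_congr_fun measurableSet_Ioc fun s hs => ?_
      rw [min_eq_left hs.2, ← Real.rpow_one_add' hs.1.le (by linarith)]
      ring_nf
    · exact (intervalIntegrable_iff_integrableOn_Ioc_of_le hx.le).1
        (intervalIntegral.intervalIntegrable_rpow' (by linarith))
    · filter_upwards [ae_restrict_mem measurableSet_Ioc] with s hs using Real.rpow_nonneg hs.1.le _
  have h2 : ∫⁻ s in Set.Ioi x, ENNReal.ofReal (min s x * s ^ (r - 2)) =
      ENNReal.ofReal (x ^ r / (1 - r)) := by
    have hval : ∫ s in Set.Ioi x, x * s ^ (r - 2) = x ^ r / (1 - r) := by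
      rw [integral_const_mul, integral_Ioi_rpow_of_lt (by linarith) hx, ← neg_div_neg_eq, neg_neg,
        mul_div_assoc', ← Real.rpow_one_add' hx.le (by linarith)]
      ring_nf
    rw [← hval, ofReal_integral_eq_lintegral_ofReal]
    · refine setLIntegral_congr_fun measurableSet_Ioi fun s hs => ?_
      rw [min_eq_right (le_of_lt hs)]
    · exact (integrableOn_Ioi_rpow_of_lt (by linarith) hx).const_mul x
    · filter_upwards [ae_restrict_mem measurableSet_Ioi] with s hs
      exact mul_nonneg hx.le (Real.rpow_nonneg (hx.trans hs).le _)
  rw [h1, h2, ← ENNReal.ofReal_add (by positivity) (by positivity),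
    ← ENNReal.ofReal_mul (by positivity)]
  ring_nf

/-- If all truncated sums of `f` are bounded by those of `g` and `∑ g ^ r` converges, then so does
`∑ f ^ r`. -/
lemma summable_rpow_of_sum_min_le {ι κ : Type*} [Countable κ] {f : ι → ℝ} {g : κ → ℝ}
    (hf : ∀ k, 0 ≤ f k) (hg : ∀ m, 0 ≤ g m) (hgs : Summable g)
    (h : ∀ s : ℝ, 0 < s → ∀ K : Finset ι, ∑ k ∈ K, min s (f k) ≤ ∑' m, min s (g m))
    {r : ℝ} (hr0 : 0 < r) (hr1 : r ≤ 1) (hgr : Summable fun m => g m ^ r) :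
    Summable fun k => f k ^ r := by
  have hmin : ∀ s : ℝ, 0 < s → Summable fun m => min s (g m) := fun s hs =>
    hgs.of_nonneg_of_le (fun m => le_min hs.le (hg m)) (fun m => min_le_right _ _)
  rcases hr1.eq_or_lt with rfl | hr1
  · simp only [Real.rpow_one]
    refine summable_of_sum_le (c := ∑' m, g m) hf fun K => ?_
    obtain ⟨B, hB⟩ := (K.image f).bddAbove
    have hs : (0 : ℝ) < max 1 B := by positivity
    calc ∑ k ∈ K, f k = ∑ k ∈ K, min (max 1 B) (f k) := by
          refine Finset.sum_congr rfl fun k hk => (min_eq_right ?_).symm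
          exact (hB (by simpa using ⟨k, hk, rfl⟩)).trans (le_max_right _ _)
      _ ≤ ∑' m, min (max 1 B) (g m) := h _ hs K
      _ ≤ ∑' m, g m := (hmin _ hs).tsum_le_tsum (fun m => min_le_right _ _) hgs
  have hC : (0 : ℝ) < 1 / r + 1 / (1 - r) := by
    have : 0 < 1 - r := by linarith
    positivity
  have hmeas : ∀ x : ℝ, Measurable fun s : ℝ => ENNReal.ofReal (min s x * s ^ (r - 2)) :=
    fun x => by fun_prop
  refine summable_of_sum_le (c := ∑' m, g m ^ r) (fun k => Real.rpow_nonneg (hf k) r) fun K => ?_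
  have hle : ∫⁻ s in Set.Ioi (0 : ℝ), ∑ k ∈ K, ENNReal.ofReal (min s (f k) * s ^ (r - 2)) ≤
      ∫⁻ s in Set.Ioi (0 : ℝ), ∑' m, ENNReal.ofReal (min s (g m) * s ^ (r - 2)) := by
    refine setLIntegral_mono' measurableSet_Ioi fun s (hs : 0 < s) => ?_
    rw [← ENNReal.ofReal_sum_of_nonneg fun k _ => by have := hf k; positivity,
      ← ENNReal.ofReal_tsum_of_nonneg (fun m => by have := hg m; positivity)
        ((hmin s hs).mul_right _), _root_.tsum_mul_right, ← Finset.sum_mul]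
    gcongr
    exact h s hs K
  rw [lintegral_finsetSum _ fun k _ => hmeas _, lintegral_tsum fun m => (hmeas _).aemeasurable] at hle
  simp only [lintegral_min_mul_rpow hr0 hr1 (hf _), lintegral_min_mul_rpow hr0 hr1 (hg _)] at hle
  rw [← Finset.mul_sum, ENNReal.tsum_mul_left,
    ENNReal.mul_le_mul_iff_right (by simpa using hC) ENNReal.ofReal_ne_top,
    ← ENNReal.ofReal_sum_of_nonneg fun k _ => Real.rpow_nonneg (hf k) r,
    ← ENNReal.ofReal_tsum_of_nonneg (fun m => Real.rpow_nonneg (hg m) r) hgr] at hle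
  exact (ENNReal.ofReal_le_ofReal_iff (tsum_nonneg fun m => Real.rpow_nonneg (hg m) r)).1 hle

lemma Summable.of_summable_rpow {κ : Type*} {g : κ → ℝ} (hg : ∀ m, 0 ≤ g m) {r : ℝ} (hr0 : 0 < r)
    (hr1 : r ≤ 1) (h : Summable fun m => g m ^ r) : Summable g := by
  refine h.of_norm_bounded_eventually ?_
  filter_upwards [h.tendsto_cofinite_zero.eventually_le_const one_pos] with m hm
  rw [Real.norm_of_nonneg (hg m)]
  have hm1 : g m ≤ 1 := by
    by_contra! hlt
    exact absurd hm (not_le.2 (Real.one_lt_rpow hlt hr0))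
  exact Real.self_le_rpow_of_le_one (hg m) hm1 hr1

end Truncation

/-- A diagonal operator on a Hilbert space is `r`-nuclear if and only if its eigenvalues are
`r`-summable. -/
lemma HilbertBasis.isRNuclear_iff_summable {H ι : Type*} [NormedAddCommGroup H]
    [InnerProductSpace ℂ H] [CompleteSpace H] [Denumerable ι] (b : HilbertBasis ι ℂ H)
    {a : ι → ℂ} {T : H →L[ℂ] H} (hT : ∀ k, T (b k) = a k • b k) {r : ℝ} (hr0 : 0 < r)
    (hr1 : r ≤ 1) : IsRNuclear r T ↔ Summable fun k => ‖a k‖ ^ r := by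
  refine ⟨?_, b.isRNuclear_of_summable hT⟩
  rintro ⟨x', y, hsum, hs⟩
  have hxy : ∀ m, 0 ≤ ‖x' m‖ * ‖y m‖ := fun m => by positivity
  have hs' : Summable fun m => (‖x' m‖ * ‖y m‖) ^ r := by
    simpa only [Real.mul_rpow (norm_nonneg _) (norm_nonneg _)] using hs
  have hs1 := Summable.of_summable_rpow hxy hr0 hr1 hs'
  exact summable_rpow_of_sum_min_le (fun k => norm_nonneg _) hxy hs1
    (fun s hs0 K => b.orthonormal.sum_min_norm_le_tsum_min
      (fun k v => b.inner_apply_of_diagonal hT k v) hsum hs1 hs0 K) hr0 hr1 hs'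

lemma volume_torus (n : ℕ) :
    (volume : Measure (Torus n)) = Measure.pi fun _ => AddCircle.haarAddCircle := by
  simp [volume_pi, AddCircle.volume_eq_smul_haarAddCircle]

lemma orthonormal_toLp_mFourier {n : ℕ} (μ : Measure (Torus n)) [IsFiniteMeasure μ]
    (hμ : μ = Measure.pi fun _ => AddCircle.haarAddCircle) :
    Orthonormal ℂ fun k : Fin n → ℤ =>
      ContinuousMap.toLp (E := ℂ) 2 μ ℂ (UnitAddTorus.mFourier k) := by
  subst hμ
  exact UnitAddTorus.orthonormal_mFourier

/-- **`r`-nuclearity of Fourier multipliers on `L²` of the torus.** Let `a : ℤⁿ → ℂ` be bounded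
and let `T : L²(μ) → L²(μ)` satisfy `T[e_k] = a(k) [e_k]` for all `k ∈ ℤⁿ`, where the closed
span of the `[e_k]` is all of `L²(μ)`. Then for every `0 < r ≤ 1`, `T` is `r`-nuclear iff
`∑_k |a(k)|^r < ∞`. -/
theorem multiplier_rNuclear_iff (n : ℕ) (hn : 1 ≤ n)
    (a : (Fin n → ℤ) → ℂ) (M : ℝ) (hM : ∀ k, ‖a k‖ ≤ M)
    (T : Lp ℂ 2 (volume : Measure (Torus n)) →L[ℂ] Lp ℂ 2 (volume : Measure (Torus n)))
    (hT : ∀ (k : Fin n → ℤ) (g : Lp ℂ 2 (volume : Measure (Torus n))),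
      ⇑g =ᵐ[volume] eK k → T g = a k • g)
    (hspan : (Submodule.span ℂ {g : Lp ℂ 2 (volume : Measure (Torus n)) |
        ∃ k : Fin n → ℤ, ⇑g =ᵐ[volume] eK k}).topologicalClosure = ⊤)
    (r : ℝ) (hr0 : 0 < r) (hr1 : r ≤ 1) :
    IsRNuclear r T ↔ Summable (fun k : Fin n → ℤ => ‖a k‖ ^ r) := by
  let E : (Fin n → ℤ) → Lp ℂ 2 (volume : Measure (Torus n)) := fun k =>
    ContinuousMap.toLp (E := ℂ) 2 volume ℂ (UnitAddTorus.mFourier k)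
  have hE : ∀ k, ⇑(E k) =ᵐ[volume] eK k := fun k => ContinuousMap.coeFn_toLp _ _
  have hset : {g : Lp ℂ 2 (volume : Measure (Torus n)) | ∃ k : Fin n → ℤ, ⇑g =ᵐ[volume] eK k} =
      Set.range E := by
    ext g
    exact exists_congr fun k =>
      ⟨fun hg => Lp.ext ((hE k).trans hg.symm), fun hg => hg ▸ hE k⟩
  rw [hset] at hspan
  let b := HilbertBasis.mk (orthonormal_toLp_mFourier volume (volume_torus n)) hspan.ge
  have hb : ∀ k, b k = E k := fun k => congr_fun (HilbertBasis.coe_mk _ _) k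
  have : Nonempty (Fin n) := ⟨⟨0, hn⟩⟩
  obtain ⟨_⟩ := nonempty_denumerable (Fin n → ℤ)
  exact b.isRNuclear_iff_summable (fun k => hT k _ (by rw [hb]; exact hE k)) hr0 hr1
end
end

section
/- Let t > 0 and define the heat kernel κ_t(x) = ∑_{k∈ℤⁿ} exp(−4π² t ∑_i k_i²) e_k(x), a series converging absolutely and uniformly to a continuous function on 𝕋ⁿ. (i) For all 1 ≤ p₁, p₂ < ∞, every bounded linear operator A : L^{p₁}(μ) → L^{p₂}(μ) satisfying, for all f ∈ L^{p₁}(μ), A f(x) = ∫_{𝕋ⁿ} κ_t(x − y) f(y) dμ(y) for μ-almost every x (i.e. the heat semigroup e^{tΔ}), is nuclear. (ii) For every 1 ≤ p < ∞ and every 0 < r ≤ 1, such an operator A : L^{p}(μ) → L^{p}(μ) is r-nuclear. -/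
open MeasureTheory ENNReal NNReal Real

noncomputable section

/-- The heat kernel `κ_t(x) = ∑_k exp(-4π² t ∑ᵢ kᵢ²) e_k(x)` on the `n`-torus. -/
noncomputable def heatK (n : ℕ) (t : ℝ) (x : Torus n) : ℂ :=
  ∑' k : Fin n → ℤ, (Real.exp (-(4 * π ^ 2 * t * ∑ i, ((k i : ℝ)) ^ 2)) : ℂ) * eK k x

lemma summable_prod_apply {f : ℤ → ℝ} (hf₀ : ∀ k, 0 ≤ f k) (hf : Summable f) (n : ℕ) :
    Summable fun k : Fin n → ℤ => ∏ i, f (k i) := by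
  induction n with
  | zero => exact Summable.of_finite
  | succ n ih =>
    rw [← (Fin.consEquiv fun _ => ℤ).summable_iff]
    have h := hf.mul_of_nonneg ih hf₀ fun k => Finset.prod_nonneg fun i _ => hf₀ (k i)
    exact h.congr fun k => by simp [Fin.prod_univ_succ, Fin.consEquiv]

lemma summable_exp_neg_mul_int_sq {a : ℝ} (ha : 0 < a) :
    Summable fun k : ℤ => Real.exp (-(a * (k : ℝ) ^ 2)) := by
  have h : Summable fun k : ℕ => Real.exp (-(a * (k : ℝ) ^ 2)) := by
    refine (Real.summable_exp_nat_mul_of_ge (neg_lt_zero.2 ha) (f := fun k => (k : ℝ) ^ 2)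
      fun k => ?_).congr fun k => by ring_nf
    exact_mod_cast Nat.le_self_pow two_ne_zero k
  exact Summable.of_nat_of_neg (by simpa using h) (by simpa using h)

/-- The heat multiplier `exp(-4π² t ∑ᵢ kᵢ²)`. -/
def heatCoeff {n : ℕ} (t : ℝ) (k : Fin n → ℤ) : ℝ :=
  Real.exp (-(4 * π ^ 2 * t * ∑ i, ((k i : ℝ)) ^ 2))

lemma heatCoeff_pos {n : ℕ} (t : ℝ) (k : Fin n → ℤ) : 0 < heatCoeff t k := Real.exp_pos _

lemma heatCoeff_rpow {n : ℕ} (t r : ℝ) (k : Fin n → ℤ) :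
    heatCoeff t k ^ r = heatCoeff (t * r) k := by
  rw [heatCoeff, heatCoeff, ← Real.exp_mul]
  ring_nf

lemma summable_heatCoeff (n : ℕ) {t : ℝ} (ht : 0 < t) :
    Summable (heatCoeff t : (Fin n → ℤ) → ℝ) := by
  refine (summable_prod_apply (fun k => (Real.exp_pos _).le)
    (summable_exp_neg_mul_int_sq (a := 4 * π ^ 2 * t) (by positivity)) n).congr fun k => ?_
  rw [heatCoeff, ← Real.exp_sum, Finset.sum_neg_distrib, Finset.mul_sum]

instance : IsProbabilityMeasure (volume : Measure (AddCircle (1 : ℝ))) :=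
  ⟨UnitAddCircle.measure_univ⟩

section Functional

variable {X : Type*} [TopologicalSpace X] [CompactSpace X] [MeasurableSpace X] [BorelSpace X]
  {μ : Measure X} [IsProbabilityMeasure μ] {p : ℝ≥0∞} [Fact (1 ≤ p)]

lemma integrable_continuousMap_mul_Lp (g : C(X, ℂ)) (f : Lp ℂ p μ) :
    Integrable (fun x => g x * f x) μ :=
  ((Lp.memLp f).integrable Fact.out).bdd_mul (g.memLp (p := p) μ ℂ).aestronglyMeasurable
    (.of_forall g.norm_coe_le_norm)

lemma integral_norm_mul_Lp_le (g : C(X, ℂ)) (f : Lp ℂ p μ) :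
    ∫ x, ‖g x * f x‖ ∂μ ≤ ‖g‖ * ‖f‖ := by
  have hf : Integrable f μ := (Lp.memLp f).integrable Fact.out
  calc ∫ x, ‖g x * f x‖ ∂μ ≤ ∫ x, ‖g‖ * ‖f x‖ ∂μ := by
        refine integral_mono (integrable_continuousMap_mul_Lp g f).norm
          (hf.norm.const_mul _) fun x => ?_
        rw [norm_mul]
        gcongr
        exact g.norm_coe_le_norm x
    _ = ‖g‖ * ∫ x, ‖f x‖ ∂μ := integral_const_mul _ _
    _ ≤ ‖g‖ * ‖f‖ := by
        gcongr
        rw [integral_norm_eq_lintegral_enorm hf.1, ← eLpNorm_one_eq_lintegral_enorm, Lp.norm_def]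
        exact ENNReal.toReal_mono (Lp.eLpNorm_ne_top f)
          (eLpNorm_le_eLpNorm_of_exponent_le Fact.out hf.1)

/-- Integration against a continuous function, as a functional on `L^p` of a probability space. -/
def integralMulLp (μ : Measure X) [IsProbabilityMeasure μ] (p : ℝ≥0∞) [Fact (1 ≤ p)]
    (g : C(X, ℂ)) : Lp ℂ p μ →L[ℂ] ℂ :=
  LinearMap.mkContinuous
    { toFun := fun f => ∫ x, g x * f x ∂μ
      map_add' := fun f₁ f₂ => by
        rw [← integral_add (integrable_continuousMap_mul_Lp g f₁)
          (integrable_continuousMap_mul_Lp g f₂)]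
        refine integral_congr_ae ?_
        filter_upwards [Lp.coeFn_add f₁ f₂] with x hx
        rw [hx, Pi.add_apply, mul_add]
      map_smul' := fun c f => by
        rw [RingHom.id_apply, smul_eq_mul, ← integral_const_mul]
        refine integral_congr_ae ?_
        filter_upwards [Lp.coeFn_smul c f] with x hx
        rw [hx, Pi.smul_apply, smul_eq_mul, mul_left_comm] }
    ‖g‖ fun f => (norm_integral_le_integral_norm _).trans (integral_norm_mul_Lp_le g f)

lemma integralMulLp_apply (g : C(X, ℂ)) (f : Lp ℂ p μ) :
    integralMulLp μ p g f = ∫ x, g x * f x ∂μ := rfl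

lemma norm_integralMulLp_le (g : C(X, ℂ)) : ‖integralMulLp μ p g‖ ≤ ‖g‖ :=
  LinearMap.mkContinuous_norm_le _ (norm_nonneg g) _

end Functional

open UnitAddTorus in
lemma eK_eq_mFourier {n : ℕ} (k : Fin n → ℤ) (x : Torus n) : eK k x = mFourier k x := rfl

lemma fourier_apply_sub (k : ℤ) (x y : AddCircle (1 : ℝ)) :
    fourier k (x - y) = fourier (-k) y * fourier k x := by
  simp only [fourier_apply, ← Circle.coe_mul, ← AddCircle.toCircle_add]
  congr 2
  rw [smul_sub, neg_smul]
  abel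

open UnitAddTorus in
lemma mFourier_apply_sub {n : ℕ} (k : Fin n → ℤ) (x y : Torus n) :
    mFourier k (x - y) = mFourier (-k) y * mFourier k x := by
  change ∏ i, fourier (k i) (x i - y i) = (∏ i, fourier (-k i) (y i)) * ∏ i, fourier (k i) (x i)
  simp only [fourier_apply_sub, Finset.prod_mul_distrib]

open UnitAddTorus in
/-- Convolution with the heat kernel diagonalizes in the characters. -/
lemma hasSum_integral_heatK {n : ℕ} {t : ℝ} (ht : 0 < t) {p : ℝ≥0∞} [Fact (1 ≤ p)]
    (f : Lp ℂ p (volume : Measure (Torus n))) (x : Torus n) :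
    HasSum (fun k => heatCoeff t k * integralMulLp volume p (mFourier (-k)) f * mFourier k x)
      (∫ y, heatK n t (x - y) * f y) := by
  have hterm (k : Fin n → ℤ) (y : Torus n) :
      (heatCoeff t k : ℂ) * eK k (x - y) * f y =
        (heatCoeff t k * mFourier k x) * (mFourier (-k) y * f y) := by
    rw [eK_eq_mFourier, mFourier_apply_sub]
    ring
  have h := hasSum_integral_of_summable_integral_norm (μ := (volume : Measure (Torus n)))
    (F := fun k y => (heatCoeff t k : ℂ) * eK k (x - y) * f y) (fun k => ?_) ?_
  · convert! h using 1
    · funext k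
      simp only [hterm, integral_const_mul, integralMulLp_apply]
      ring
    · exact integral_congr_ae (.of_forall fun y => tsum_mul_right.symm)
  · simp only [hterm]
    exact (integrable_continuousMap_mul_Lp (mFourier (-k)) f).const_mul _
  · refine ((summable_heatCoeff n ht).mul_right ‖f‖).of_nonneg_of_le
      (fun k => integral_nonneg fun y => norm_nonneg _) fun k => ?_
    simp only [hterm, norm_mul (_ * _ : ℂ), integral_const_mul]
    have h₁ := integral_norm_mul_Lp_le (mFourier (-k)) f
    have h₂ := (mFourier k).norm_coe_le_norm x
    rw [mFourier_norm] at h₁ h₂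
    rw [one_mul] at h₁
    have h₃ : ‖(heatCoeff t k : ℂ) * mFourier k x‖ ≤ heatCoeff t k := by
      rw [norm_mul, Complex.norm_of_nonneg (heatCoeff_pos t k).le]
      exact mul_le_of_le_one_right (heatCoeff_pos t k).le h₂
    exact mul_le_mul h₃ h₁ (integral_nonneg fun y => norm_nonneg _) (heatCoeff_pos t k).le

open UnitAddTorus in
lemma isRNuclear_of_ae_eq_integral_heatK {n : ℕ} (hn : 1 ≤ n) {t : ℝ} (ht : 0 < t) {r : ℝ}
    (hr : 0 < r) {p₁ p₂ : ℝ≥0∞} [Fact (1 ≤ p₁)] [Fact (1 ≤ p₂)]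
    (A : Lp ℂ p₁ (volume : Measure (Torus n)) →L[ℂ] Lp ℂ p₂ (volume : Measure (Torus n)))
    (hA : ∀ f : Lp ℂ p₁ (volume : Measure (Torus n)),
      ∀ᵐ x ∂(volume : Measure (Torus n)), A f x = ∫ y, heatK n t (x - y) * f y ∂volume) :
    IsRNuclear r A := by
  have : Nonempty (Fin n) := ⟨⟨0, hn⟩⟩
  obtain ⟨e⟩ : Nonempty (ℕ ≃ (Fin n → ℤ)) := inferInstance
  let L : C(Torus n, ℂ) →L[ℂ] Lp ℂ p₂ (volume : Measure (Torus n)) :=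
    ContinuousMap.toLp p₂ volume ℂ
  let φ (k : Fin n → ℤ) : Lp ℂ p₁ (volume : Measure (Torus n)) →L[ℂ] ℂ :=
    (heatCoeff t k : ℂ) • integralMulLp volume p₁ (mFourier (-k))
  have hφ (k : Fin n → ℤ) : ‖φ k‖ ≤ heatCoeff t k := by
    rw [norm_smul, Complex.norm_of_nonneg (heatCoeff_pos t k).le]
    refine mul_le_of_le_one_right (heatCoeff_pos t k).le ((norm_integralMulLp_le _).trans ?_)
    rw [mFourier_norm]
  have hL (k : Fin n → ℤ) : ‖L (mFourier k)‖ ≤ ‖L‖ := by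
    simpa [mFourier_norm] using L.le_opNorm (mFourier k)
  refine ⟨fun m => φ (e m), fun m => L (mFourier (e m)), fun f => ?_, ?_⟩
  · refine (e.hasSum_iff (f := fun k => φ k f • L (mFourier k))).2 ?_
    have hsum : Summable fun k => φ k f • (mFourier k : C(Torus n, ℂ)) := by
      refine .of_norm_bounded ((summable_heatCoeff n ht).mul_right ‖f‖) fun k => ?_
      rw [norm_smul, mFourier_norm, mul_one]
      exact (φ k).le_of_opNorm_le (hφ k) f
    have hAf : A f = L (∑' k, φ k f • (mFourier k : C(Torus n, ℂ))) := by
      refine Lp.ext ?_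
      filter_upwards [hA f, ContinuousMap.coeFn_toLp (p := p₂) (𝕜 := ℂ) volume
        (∑' k, φ k f • (mFourier k : C(Torus n, ℂ)))] with x hx hLx
      rw [hx, hLx]
      exact (hasSum_integral_heatK ht f x).unique (ContinuousMap.hasSum_apply hsum.hasSum x)
    rw [hAf]
    simpa using L.hasSum hsum.hasSum
  · refine (e.summable_iff (f := fun k => ‖φ k‖ ^ r * ‖L (mFourier k)‖ ^ r)).2 ?_
    refine ((summable_heatCoeff n (mul_pos ht hr)).mul_right (‖L‖ ^ r)).of_nonneg_of_le
      (fun k => by positivity) fun k => ?_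
    rw [← heatCoeff_rpow]
    gcongr
    · exact Real.rpow_nonneg (heatCoeff_pos t k).le r
    · exact hφ k
    · exact hL k

/-- **Nuclearity of the heat semigroup on the torus.** For `t > 0`:
(i) for all `1 ≤ p₁, p₂ < ∞`, every bounded operator `A : L^{p₁}(μ) → L^{p₂}(μ)` with
`A f (x) = ∫ κ_t(x-y) f(y) dμ(y)` a.e. (i.e. `A = e^{tΔ}`) is nuclear;
(ii) for `1 ≤ p < ∞` and `0 < r ≤ 1`, such an operator `A : L^p(μ) → L^p(μ)` is `r`-nuclear. -/
theorem heat_semigroup_nuclear (n : ℕ) (hn : 1 ≤ n) (t : ℝ) (ht : 0 < t) :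
    (∀ (p₁ p₂ : ℝ≥0∞) [Fact (1 ≤ p₁)] [Fact (1 ≤ p₂)], p₁ ≠ ∞ → p₂ ≠ ∞ →
      ∀ A : Lp ℂ p₁ (volume : Measure (Torus n)) →L[ℂ]
            Lp ℂ p₂ (volume : Measure (Torus n)),
        (∀ f : Lp ℂ p₁ (volume : Measure (Torus n)),
          ∀ᵐ x ∂(volume : Measure (Torus n)),
            A f x = ∫ y, heatK n t (x - y) * f y ∂volume) →
        IsRNuclear 1 A) ∧
    (∀ (p : ℝ≥0∞) [Fact (1 ≤ p)], p ≠ ∞ → ∀ r : ℝ, 0 < r → r ≤ 1 →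
      ∀ A : Lp ℂ p (volume : Measure (Torus n)) →L[ℂ]
            Lp ℂ p (volume : Measure (Torus n)),
        (∀ f : Lp ℂ p (volume : Measure (Torus n)),
          ∀ᵐ x ∂(volume : Measure (Torus n)),
            A f x = ∫ y, heatK n t (x - y) * f y ∂volume) →
        IsRNuclear r A) := by
  exact ⟨fun p₁ p₂ _ _ _ _ A hA => isRNuclear_of_ae_eq_integral_heatK hn ht one_pos A hA,
    fun p _ _ r hr _ A hA => isRNuclear_of_ae_eq_integral_heatK hn ht hr A hA⟩
end
end
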